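/- Let Ω ⊂ ℂⁿ be a bounded pseudoconvex domain, φ ∈ SPSH(Ω) and u a φ-admissible test function. Then lim_{k→∞} ∫_0^1 ∫_Ω k^{−n} B_{k(φ+tu)}(z) u(z) e^{−k(φ(z)+t u(z))} dλ(z) dt = π^{−n} ∫_0^1 ∫_Ω u(z) det H_{φ+tu}(z) dλ(z) dt, and this common value equals the Monge–Ampère energy E(φ+u) = (π^{−n}/(n+1)) Σ_{j=0}^n ∫_Ω u(z) D_j(H_{φ+u}(z), H_φ(z)) dλ(z). -/

import Mathlib

open MeasureTheory Complex Filter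
open scoped ENNReal Topology BigOperators Real ComplexOrder

noncomputable section

variable {n : ℕ}

/-- Wirtinger derivative `∂f/∂z_j` of a function on `ℂⁿ`. -/
def wDeriv (f : (Fin n → ℂ) → ℂ) (j : Fin n) (z : Fin n → ℂ) : ℂ :=
  (1/2) * (fderiv ℝ f z (Pi.single j 1) - Complex.I * fderiv ℝ f z (Pi.single j Complex.I))

/-- Wirtinger derivative `∂f/∂z̄_j` of a function on `ℂⁿ`. -/
def wDerivBar (f : (Fin n → ℂ) → ℂ) (j : Fin n) (z : Fin n → ℂ) : ℂ :=
  (1/2) * (fderiv ℝ f z (Pi.single j 1) + Complex.I * fderiv ℝ f z (Pi.single j Complex.I))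

/-- Complex Hessian `H_φ(z) = (∂²φ/∂z_j∂z̄_k)_{j,k}` of a real-valued function on `ℂⁿ`. -/
def cHessian (φ : (Fin n → ℂ) → ℝ) (z : Fin n → ℂ) : Matrix (Fin n) (Fin n) ℂ :=
  Matrix.of fun j k => wDerivBar (fun w => wDeriv (fun v => (φ v : ℂ)) j w) k z

/-- A function is plurisubharmonic on `Ω` if it is upper semicontinuous on `Ω` and satisfies
the sub-mean value inequality on every closed complex disc contained in `Ω`. -/
def PlurisubharmonicOn (Ω : Set (Fin n → ℂ)) (f : (Fin n → ℂ) → ℝ) : Prop :=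
  UpperSemicontinuousOn f Ω ∧
  ∀ a b : Fin n → ℂ, (∀ ζ : ℂ, ‖ζ‖ ≤ 1 → a + ζ • b ∈ Ω) →
    f a ≤ (2 * π)⁻¹ * ∫ θ in (0:ℝ)..(2*π), f (a + Complex.exp (θ * Complex.I) • b)

/-- A (bounded) open set `Ω ⊆ ℂⁿ` is pseudoconvex iff `z ↦ -log dist(z, Ωᶜ)` is
plurisubharmonic on `Ω`. -/
def Pseudoconvex (Ω : Set (Fin n → ℂ)) : Prop :=
  PlurisubharmonicOn Ω fun z => -Real.log (Metric.infDist z Ωᶜ)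

/-- `φ ∈ SPSH(Ω)`: smooth on `Ω` with positive definite complex Hessian at every point of `Ω`. -/
def SPSHOn (Ω : Set (Fin n → ℂ)) (φ : (Fin n → ℂ) → ℝ) : Prop :=
  ContDiffOn ℝ (⊤ : ℕ∞) φ Ω ∧ ∀ z ∈ Ω, (cHessian φ z).PosDef

/-- Squared weighted Bergman norm `∫_Ω |f|² e^{-ψ} dλ` (as an extended real,
so that finiteness encodes square-integrability). -/
def wnorm2 (Ω : Set (Fin n → ℂ)) (ψ : (Fin n → ℂ) → ℝ) (f : (Fin n → ℂ) → ℂ) : ℝ≥0∞ :=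
  ∫⁻ z in Ω, ENNReal.ofReal (‖f z‖ ^ 2 * Real.exp (-ψ z))

/-- Membership in the weighted Bergman space `H(ψ)`: holomorphic on `Ω` and
`∫_Ω |f|² e^{-ψ} dλ < ∞`. -/
def MemBergman (Ω : Set (Fin n → ℂ)) (ψ : (Fin n → ℂ) → ℝ) (f : (Fin n → ℂ) → ℂ) : Prop :=
  DifferentiableOn ℂ f Ω ∧ wnorm2 Ω ψ f < ⊤

/-- The diagonal of the Bergman kernel of `H(ψ)`:
`B_ψ(z) = sup {|f(z)|² : f ∈ H(ψ), ‖f‖_ψ ≤ 1}`. -/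
def bergmanDiag (Ω : Set (Fin n → ℂ)) (ψ : (Fin n → ℂ) → ℝ) (z : Fin n → ℂ) : ℝ :=
  sSup {t : ℝ | ∃ f, DifferentiableOn ℂ f Ω ∧ wnorm2 Ω ψ f ≤ 1 ∧ t = ‖f z‖ ^ 2}

/-- Weighted inner product `⟨f,g⟩_ψ = ∫_Ω f ḡ e^{-ψ} dλ`. -/
def wInner (Ω : Set (Fin n → ℂ)) (ψ : (Fin n → ℂ) → ℝ) (f g : (Fin n → ℂ) → ℂ) : ℂ :=
  ∫ z in Ω, f z * (starRingEnd ℂ) (g z) * Real.exp (-ψ z)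

/-- Mixed determinants `D_j(A,B)`, defined so that
`det (s•A + r•B) = ∑_j (n choose j) s^j r^(n-j) D_j(A,B)`: explicitly `D_j(A,B)` is
`(n choose j)⁻¹` times the sum over all `j`-element subsets `S` of the row indices of the
determinant of the matrix whose rows are those of `A` on `S` and those of `B` elsewhere. -/
def mixedDet (A B : Matrix (Fin n) (Fin n) ℂ) (j : ℕ) : ℂ :=
  ((n.choose j : ℂ))⁻¹ *
    ∑ S ∈ Finset.univ.powersetCard j,
      Matrix.det (Matrix.of fun i k => if i ∈ S then A i k else B i k)

local notation "Cv" m:max => (Fin m → ℂ)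
local notation "Tt" => (⊤ : ℕ∞)
local notation "ex" => Real.exp
local notation "stC" => starRingEnd ℂ
local notation "cB" => Metric.closedBall
local notation "mB" => Metric.ball
local notation "oR" => ENNReal.ofReal
local notation "sT" => Real.smoothTransition
local notation "Rc" f:max => fun x => (f x : ℂ)

abbrev Sm (f : Cv n → ℂ) : Prop := ContDiff ℝ Tt f

abbrev SmAt (f : Cv n → ℂ) (z : Cv n) : Prop := ContDiffAt ℝ Tt f z

def Tst (D : Set (Cv n)) (f : Cv n → ℂ) : Prop :=
  ContDiff ℝ Tt f ∧ HasCompactSupport f ∧ tsupport f ⊆ D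

def wD (s : ℂ) (f : Cv n → ℂ) (j : Fin n) (z : Cv n) : ℂ :=
  (1/2) * (fderiv ℝ f z (Pi.single j 1) + s * fderiv ℝ f z (Pi.single j Complex.I))

local notation "Dm" => wD (-I)

lemma wDeriv_eq (f : Cv n → ℂ) : wDeriv f = Dm f := by
  funext j z; simp only [wDeriv, wD]; ring

lemma wDerivBar_eq (f : Cv n → ℂ) : wDerivBar f = wD I f := by
  funext j z; simp only [wDerivBar, wD]

section wD
variable {s t : ℂ} {f g : Cv n → ℂ} {j k : Fin n} {z : Cv n}

lemma SmAt.diff (h : SmAt f z) : DifferentiableAt ℝ f z := h.differentiableAt (by simp)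

lemma Sm.diff (h : Sm f) (z) : DifferentiableAt ℝ f z := h.contDiffAt.differentiableAt (by simp)

lemma wD_congr (h : f =ᶠ[𝓝 z] g) : wD s f j z = wD s g j z := by
  simp only [wD, h.fderiv_eq]

lemma wD_congr' (h : f =ᶠ[𝓝 z] g) : wD s f j =ᶠ[𝓝 z] wD s g j := by
  filter_upwards [h.eventuallyEq_nhds] with x hx using wD_congr hx

lemma wD_add (hf : DifferentiableAt ℝ f z) (hg : DifferentiableAt ℝ g z) :
    wD s (fun x => f x + g x) j z = wD s f j z + wD s g j z := by
  simp only [wD, fderiv_fun_add hf hg, _root_.add_apply]; ring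

lemma wD_sub (hf : DifferentiableAt ℝ f z) (hg : DifferentiableAt ℝ g z) :
    wD s (fun x => f x - g x) j z = wD s f j z - wD s g j z := by
  simp only [wD, fderiv_fun_sub hf hg, _root_.sub_apply]; ring

lemma wD_mul (hf : DifferentiableAt ℝ f z) (hg : DifferentiableAt ℝ g z) :
    wD s (fun x => f x * g x) j z = f z * wD s g j z + wD s f j z * g z := by
  simp only [wD, fderiv_fun_mul hf hg, _root_.add_apply, _root_.smul_apply,
    smul_eq_mul]; ring

lemma wD_const (c : ℂ) : wD s (fun _ : Cv n => c) j z = 0 := by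
  simp [wD]

lemma wD_const_mul (c : ℂ) (hf : DifferentiableAt ℝ f z) :
    wD s (fun x => c * f x) j z = c * wD s f j z := by
  rw [wD_mul (differentiableAt_const c) hf, wD_const]; ring

lemma wD_sum {ι : Type*} (S : Finset ι) (F : ι → Cv n → ℂ)
    (hf : ∀ i ∈ S, DifferentiableAt ℝ (F i) z) :
    wD s (fun x => ∑ i ∈ S, F i x) j z = ∑ i ∈ S, wD s (F i) j z := by
  simp only [wD, fderiv_fun_sum hf, _root_.sum_apply, Finset.mul_sum,
    ← Finset.sum_add_distrib]

lemma wD_conj (f : Cv n → ℂ) :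
    wD s (fun x => stC (f x)) j z = stC (wD (stC s) f j z) := by
  have : fderiv ℝ (fun x => stC (f x)) z
      = (Complex.conjCLE : ℂ →L[ℝ] ℂ).comp (fderiv ℝ f z) :=
    Complex.conjCLE.comp_fderiv (f := f) (x := z)
  simp [wD, this]; left; exact (map_ofNat stC 2).symm

lemma wD_ofReal (φ : Cv n → ℝ) :
    stC (wD s (Rc φ) j z)
      = wD (stC s) (Rc φ) j z := by
  have := wD_conj (s := stC s) (j := j) (z := z) (Rc φ)
  simpa using this.symm

lemma SmAt.wD (h : SmAt f z) (s : ℂ) (j : Fin n) : SmAt (wD s f j) z := by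
  have h1 : ContDiffAt ℝ Tt (fderiv ℝ f) z := h.fderiv_right (by simp)
  have h2 : ∀ v, ContDiffAt ℝ Tt (fun x => fderiv ℝ f x v) z :=
    fun v => h1.clm_apply contDiffAt_const
  exact contDiffAt_const.mul ((h2 _).add (contDiffAt_const.mul (h2 _)))

lemma Sm.wD (h : Sm f) (s : ℂ) (j : Fin n) : Sm (wD s f j) :=
  contDiff_iff_contDiffAt.2 fun _ => SmAt.wD h.contDiffAt s j

lemma fderiv_wD (h : SmAt f z) (v : Cv n) :
    fderiv ℝ (_root_.wD s f j) z v = (1/2) * (fderiv ℝ (fderiv ℝ f) z v (Pi.single j 1)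
      + s * fderiv ℝ (fderiv ℝ f) z v (Pi.single j I)) := by
  have h1 : DifferentiableAt ℝ (fderiv ℝ f) z :=
    (ContDiffAt.fderiv_right (m := 1) h (by norm_cast)).differentiableAt (by simp)
  have h2 : ∀ w, HasFDerivAt (fun x => fderiv ℝ f x w) ((fderiv ℝ (fderiv ℝ f) z).flip w) z :=
    fun w => by simpa using h1.hasFDerivAt.clm_apply (hasFDerivAt_const w z)
  have h3 := ((h2 (Pi.single j 1)).add ((h2 (Pi.single j I)).const_mul s)).const_mul (1/2)
  have : fderiv ℝ (_root_.wD s f j) z = _ := h3.fderiv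
  rw [this]; simp; ring

lemma wD_comm (h : SmAt f z) : wD s (wD t f j) k z = wD t (wD s f k) j z := by
  have hs : IsSymmSndFDerivAt ℝ f z := h.isSymmSndFDerivAt (by simp; exact WithTop.coe_le_coe.2 (le_top : (2:ℕ∞) ≤ ⊤))
  conv_lhs => rw [wD, fderiv_wD h, fderiv_wD h]
  conv_rhs => rw [wD, fderiv_wD h, fderiv_wD h]
  rw [hs.eq (Pi.single j 1) (Pi.single k 1), hs.eq (Pi.single j 1) (Pi.single k I),
    hs.eq (Pi.single j I) (Pi.single k I), hs.eq (Pi.single j I) (Pi.single k 1)]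
  ring

lemma wD_chain {F : ℝ → ℝ} {F' : ℝ} {ρ : Cv n → ℝ} (hF : HasDerivAt F F' (ρ z))
    (hρ : DifferentiableAt ℝ ρ z) :
    wD s (fun x => ((F (ρ x) : ℝ) : ℂ)) j z = F' * wD s (Rc ρ) j z := by
  have h1 : HasFDerivAt (Rc ρ) (Complex.ofRealCLM.comp (fderiv ℝ ρ z)) z :=
    Complex.ofRealCLM.hasFDerivAt.comp z hρ.hasFDerivAt
  have h2 : HasFDerivAt (fun x => ((F (ρ x) : ℝ) : ℂ)) (Complex.ofRealCLM.comp (F' • fderiv ℝ ρ z)) z :=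
    Complex.ofRealCLM.hasFDerivAt.comp z (hF.comp_hasFDerivAt z hρ.hasFDerivAt)
  simp only [wD, h1.fderiv, h2.fderiv]; simp; ring

lemma wD_exp (hf : DifferentiableAt ℝ f z) :
    wD s (fun x => Complex.exp (f x)) j z = Complex.exp (f z) * wD s f j z := by
  have h := (hf.hasFDerivAt.cexp).fderiv
  simp only [wD, h]; simp; ring

lemma wD_eq_zero_of_notMem (h : z ∉ tsupport f) : wD s f j z = 0 := by
  rw [wD_congr (notMem_tsupport_iff_eventuallyEq.1 h)]; exact wD_const 0

lemma tsupport_wD : tsupport (wD s f j) ⊆ tsupport f :=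
  closure_minimal (fun x hx => by
    by_contra h; exact hx (wD_eq_zero_of_notMem h)) (isClosed_tsupport f)

lemma hcs_wD (h : HasCompactSupport f) : HasCompactSupport (wD s f j) :=
  h.of_isClosed_subset (isClosed_tsupport _) tsupport_wD

lemma Tst.wD {D : Set (Cv n)} (h : Tst D f) (s j) : Tst D (wD s f j) :=
  ⟨Sm.wD h.1 s j, hcs_wD h.2.1, tsupport_wD.trans h.2.2⟩

lemma integral_wD (h : Sm f) (hc : HasCompactSupport f) : ∫ z, wD s f j z = 0 := by
  have key : ∀ v, Integrable (fun x => fderiv ℝ f x v) ∧ ∫ x, fderiv ℝ f x v = 0 := by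
    intro v
    have hi : Integrable (fun x => fderiv ℝ f x v) := by
      refine Continuous.integrable_of_hasCompactSupport ?_ ?_
      · exact (h.continuous_fderiv (by simp)).clm_apply continuous_const
      · exact hc.fderiv_apply (𝕜 := ℝ) (v := v)
    refine ⟨hi, ?_⟩
    have := integral_mul_fderiv_eq_neg_fderiv_mul_of_integrable (μ := volume) (𝕜 := ℂ)
      (f := fun _ : Cv n => (1:ℂ)) (g := f) (v := v) (by simp) (by simpa using hi)
      (by simpa using h.continuous.integrable_of_hasCompactSupport hc)
      (fun _ _ => differentiableAt_const _) (fun x _ => h.diff x)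
    simpa using this
  simp only [wD]
  rw [integral_const_mul, integral_add (key _).1 ((key _).1.const_mul s), integral_const_mul,
    (key _).2, (key _).2]; simp

lemma Sm.integrable (h : Sm f) (hc : HasCompactSupport f) : Integrable f :=
  h.continuous.integrable_of_hasCompactSupport hc

lemma ibp (hf : Sm f) (hg : Sm g) (hc : HasCompactSupport f) :
    ∫ z, wD s f j z * g z = - ∫ z, f z * wD s g j z := by
  have h := integral_wD (s := s) (j := j) (hf.mul hg) (hc.mul_right)
  have e : ∀ z, wD s (fun x => f x * g x) j z = f z * wD s g j z + wD s f j z * g z :=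
    fun z => wD_mul (hf.diff z) (hg.diff z)
  rw [integral_congr_ae (Eventually.of_forall e)] at h
  rw [integral_add (Sm.integrable (hf.mul (Sm.wD hg s j)) hc.mul_right)
    (Sm.integrable ((Sm.wD hf s j).mul hg) (hcs_wD hc).mul_right)] at h
  linear_combination h

lemma fderiv_eq_sum (f : Cv n → ℂ) (z w : Cv n) :
    fderiv ℝ f z w = ∑ j, (w j * Dm f j z + stC (w j) * wD I f j z) := by
  have hw : w = ∑ j, ((w j).re • (Pi.single j 1 : Cv n) + (w j).im • (Pi.single j I : Cv n)) := by
    conv_lhs => rw [← Finset.univ_sum_single w]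
    refine Finset.sum_congr rfl fun j _ => ?_
    ext i
    by_cases h : i = j
    · subst h; simp [Complex.re_add_im]
    · simp [h]
  conv_lhs => rw [hw]
  rw [map_sum]
  refine Finset.sum_congr rfl fun j _ => ?_
  rw [map_add, map_smul, map_smul]
  simp only [wD, Complex.real_smul]
  set a := fderiv ℝ f z (Pi.single j 1)
  set b := fderiv ℝ f z (Pi.single j I)
  conv_rhs => rw [← Complex.re_add_im (w j)]
  simp only [map_add, map_mul, Complex.conj_ofReal, Complex.conj_I]
  linear_combination ((w j).im * b) * Complex.I_sq

end wD

lemma cHessian_apply (φ : Cv n → ℝ) (z) (j k : Fin n) :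
    cHessian φ z j k = wD I (Dm (Rc φ) j) k z := by
  simp only [cHessian, Matrix.of_apply, wDerivBar_eq]
  congr 1; funext w; rw [wDeriv_eq]

lemma smAt_ofReal {φ : Cv n → ℝ} {z : Cv n} (h : ContDiffAt ℝ Tt φ z) :
    SmAt (Rc φ) z := Complex.ofRealCLM.contDiff.contDiffAt.comp z h

lemma SmAt.ev {f : Cv n → ℂ} {z : Cv n} (h : SmAt f z) :
    ∀ᶠ x in 𝓝 z, DifferentiableAt ℝ f x := by
  have h1 : ContDiffAt ℝ 1 f z := h.of_le (by simp)
  filter_upwards [h1.eventually (by simp)] with x hx using hx.differentiableAt (by simp)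

lemma cHess_add {φ u : Cv n → ℝ} {z : Cv n} (t : ℝ) (h : ContDiffAt ℝ Tt φ z)
    (hu : ContDiffAt ℝ Tt u z) :
    cHessian (fun w => φ w + t * u w) z = cHessian φ z + (t : ℂ) • cHessian u z := by
  ext j k
  simp only [cHessian_apply, Matrix.add_apply, Matrix.smul_apply, smul_eq_mul]
  have h1 := smAt_ofReal h
  have h2 := smAt_ofReal hu
  have e : Dm (fun v => ((φ v + t * u v : ℝ) : ℂ)) j =ᶠ[𝓝 z]
      fun v => Dm (Rc φ) j v + t * Dm (Rc u) j v := by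
    filter_upwards [h1.ev, h2.ev] with x hx hy
    rw [← wD_const_mul _ hy, ← wD_add hx (hy.const_mul _)]
    simp only [ofReal_add, ofReal_mul]
  rw [wD_congr e, wD_add (h1.wD _ _).diff ((h2.wD _ _).diff.const_mul _),
    wD_const_mul _ (h2.wD _ _).diff]

lemma cHess_continuousAt {φ : Cv n → ℝ} {z : Cv n} (h : ContDiffAt ℝ Tt φ z) :
    ContinuousAt (cHessian φ) z := by
  refine continuousAt_pi.2 fun j => continuousAt_pi.2 fun k => ?_
  simp only [cHessian_apply]
  exact (((smAt_ofReal h).wD _ _).wD _ _).continuousAt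

lemma mixedDet_expand (A B : Matrix (Fin n) (Fin n) ℂ) (s t : ℂ) :
    (t • A + s • B).det = ∑ j ∈ Finset.range (n+1),
      (n.choose j : ℂ) * t ^ j * s ^ (n - j) * mixedDet A B j := by
  have h0 : (t • A + s • B).det = ∑ S : Finset (Fin n), t ^ S.card * s ^ (n - S.card) *
      Matrix.det (Matrix.of fun i k => if i ∈ S then A i k else B i k) := by
    have := (Matrix.detRowAlternating (R := ℂ) (n := Fin n)).toMultilinearMap.map_add_univ (t • A) (s • B)
    refine this.trans (Finset.sum_congr rfl fun S _ => ?_)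
    have h2 : S.piecewise (t • A) (s • B) = Matrix.of fun i k => (if i ∈ S then t else s) *
        (Matrix.of fun i k => if i ∈ S then A i k else B i k) i k := by
      funext i; ext k
      by_cases h : i ∈ S <;> simp [h, Finset.piecewise, Matrix.smul_apply]
    refine (congrArg Matrix.det h2).trans ?_
    rw [Matrix.det_mul_column]
    congr 1
    rw [Finset.prod_ite]; simp
    congr 1
    rw [Finset.filter_not, Finset.card_sdiff]; simp
  rw [h0, ← Finset.powerset_univ, Finset.sum_powerset]
  simp only [Finset.card_univ, Fintype.card_fin]
  refine Finset.sum_congr rfl fun j hj => ?_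
  have hc : (n.choose j : ℂ) ≠ 0 := by
    exact_mod_cast (Nat.choose_pos (Nat.lt_succ_iff.1 (Finset.mem_range.1 hj))).ne'
  rw [mixedDet, Finset.sum_congr rfl (g := fun S => t ^ j * s ^ (n - j) *
    Matrix.det (Matrix.of fun i k => if i ∈ S then A i k else B i k))
    (fun S hS => by rw [(Finset.mem_powersetCard.1 hS).2]), ← Finset.mul_sum]
  field_simp

lemma beta_int (a b : ℕ) : ∫ t in (0:ℝ)..1, t ^ a * (1 - t) ^ b =
    (a.factorial * b.factorial : ℝ) / (a + b + 1).factorial := by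
  induction b generalizing a with
  | zero => simp [Nat.factorial_succ]; field_simp
  | succ b ih =>
    have h1 : ∀ t ∈ Set.uIcc (0:ℝ) 1, HasDerivAt (fun t : ℝ => t ^ (a+1) * (1 - t) ^ (b+1))
        ((a+1) * (t ^ a * (1-t)^(b+1)) - (b+1) * (t^(a+1) * (1-t)^b)) t := by
      intro t _
      have := (hasDerivAt_pow (a+1) t).mul (((hasDerivAt_id t).const_sub 1).pow (b+1))
      refine this.congr_deriv ?_
      simp; ring
    have h2 := intervalIntegral.integral_eq_sub_of_hasDerivAt h1
      (Continuous.intervalIntegrable (by fun_prop) _ _)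
    rw [intervalIntegral.integral_sub (Continuous.intervalIntegrable (by fun_prop) _ _)
      (Continuous.intervalIntegrable (by fun_prop) _ _), intervalIntegral.integral_const_mul,
      intervalIntegral.integral_const_mul, ih (a+1)] at h2
    simp only [one_pow, sub_self, ne_eq, Nat.add_eq_zero_iff, one_ne_zero, and_false,
      not_false_eq_true, zero_pow, mul_zero, zero_mul, sub_zero] at h2
    have e : a + 1 + b + 1 = a + (b + 1) + 1 := by ring
    rw [e, Nat.factorial_succ a] at h2
    rw [Nat.factorial_succ b]
    push_cast at h2 ⊢
    have : ((a:ℝ) + 1) ≠ 0 := by positivity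
    apply mul_left_cancel₀ this
    rw [sub_eq_zero] at h2
    rw [h2]; ring

lemma cont_mul_tsupport {Ω : Set (Cv n)} {u h : Cv n → ℝ}
    (hu : Continuous u) (hus : tsupport u ⊆ Ω) (hh : ∀ z ∈ Ω, ContinuousAt h z) :
    Continuous fun z => u z * h z :=
  continuous_of_tsupport fun x hx => hu.continuousAt.mul
    (hh x (hus (closure_mono (Function.support_mul_subset_left u h) hx)))

lemma cHess_interp {φ u : Cv n → ℝ} {z : Cv n} (t : ℝ) (h : ContDiffAt ℝ Tt φ z)
    (hu : ContDiffAt ℝ Tt u z) :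
    cHessian (fun w => φ w + t * u w) z =
      (t:ℂ) • cHessian (fun w => φ w + u w) z + (1 - t : ℂ) • cHessian φ z := by
  have h1 := cHess_add 1 h hu
  simp only [one_mul, ofReal_one, one_smul] at h1
  rw [cHess_add t h hu, h1, smul_add, sub_smul, one_smul]; abel

lemma energy_identity {Ω : Set (Cv n)} (hΩ : IsOpen Ω) {φ u : Cv n → ℝ}
    (hφ : ContDiffOn ℝ Tt φ Ω) (hu : ContDiff ℝ Tt u) (huc : HasCompactSupport u)
    (hus : tsupport u ⊆ Ω) :
    (∫ t in (0:ℝ)..1, ∫ z in Ω, u z * (cHessian (fun w => φ w + t * u w) z).det.re) =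
      (1 / (n + 1)) * ∑ j ∈ Finset.range (n + 1),
        ∫ z in Ω, u z * (mixedDet (cHessian (fun w => φ w + u w) z) (cHessian φ z) j).re := by
  have hφ' : ∀ z ∈ Ω, ContDiffAt ℝ Tt φ z := fun z hz => hφ.contDiffAt (hΩ.mem_nhds hz)
  have hint : ∀ j, Integrable (fun z => u z *
      (mixedDet (cHessian (fun w => φ w + u w) z) (cHessian φ z) j).re) := fun j => by
    refine Continuous.integrable_of_hasCompactSupport (cont_mul_tsupport hu.continuous hus ?_)
      huc.mul_right
    intro z hz
    have c1 := cHess_continuousAt (hφ' z hz)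
    have c2 := cHess_continuousAt ((hφ' z hz).add hu.contDiffAt)
    refine Complex.continuous_re.continuousAt.comp ?_
    refine continuousAt_const.mul (tendsto_finsetSum _ fun S _ => ?_)
    have : Continuous fun A : Matrix (Fin n) (Fin n) ℂ => A.det := continuous_id.matrix_det
    refine this.continuousAt.comp (f := fun z => (Matrix.of fun i k => if i ∈ S then
      cHessian (fun w => φ w + u w) z i k else cHessian φ z i k)) ?_
    refine continuousAt_pi.2 fun j => continuousAt_pi.2 fun k => ?_
    simp only [Matrix.of_apply]
    split_ifs
    · exact continuousAt_pi.1 (continuousAt_pi.1 c2 j) k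
    · exact continuousAt_pi.1 (continuousAt_pi.1 c1 j) k
  set J := fun j => ∫ z in Ω, u z *
    (mixedDet (cHessian (fun w => φ w + u w) z) (cHessian φ z) j).re with hJ
  have h1 : ∀ t : ℝ, (∫ z in Ω, u z * (cHessian (fun w => φ w + t * u w) z).det.re) =
      ∑ j ∈ Finset.range (n+1), ((n.choose j : ℝ) * J j) * (t ^ j * (1 - t) ^ (n - j)) := by
    intro t
    have : ∀ z ∈ Ω, u z * (cHessian (fun w => φ w + t * u w) z).det.re =
        ∑ j ∈ Finset.range (n+1), ((n.choose j : ℝ) * (t ^ j * (1 - t) ^ (n - j))) * (u z *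
    (mixedDet (cHessian (fun w => φ w + u w) z) (cHessian φ z) j).re) := by
      intro z hz
      rw [cHess_interp t (hφ' z hz) hu.contDiffAt, mixedDet_expand, Complex.re_sum, Finset.mul_sum]
      refine Finset.sum_congr rfl fun j _ => ?_
      have : ((n.choose j : ℂ) * (t:ℂ) ^ j * (1 - t : ℂ) ^ (n - j)) =
        (((n.choose j : ℝ) * (t ^ j * (1 - t) ^ (n - j)) : ℝ) : ℂ) := by push_cast; ring
      rw [this, Complex.re_ofReal_mul]; ring
    rw [setIntegral_congr_fun hΩ.measurableSet this,
      integral_finsetSum _ (fun j _ => ((hint j).const_mul _).integrableOn)]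
    refine Finset.sum_congr rfl fun j _ => ?_
    rw [integral_const_mul]; simp only [hJ]; ring
  simp only [h1]
  rw [intervalIntegral.integral_finsetSum
    (fun j _ => Continuous.intervalIntegrable (by fun_prop) _ _), Finset.mul_sum]
  refine Finset.sum_congr rfl fun j hj => ?_
  have hj' := Nat.lt_succ_iff.1 (Finset.mem_range.1 hj)
  rw [intervalIntegral.integral_const_mul, beta_int]
  have e : j + (n - j) = n := by omega
  rw [e, Nat.factorial_succ]
  have := Nat.choose_mul_factorial_mul_factorial hj'
  have hn : (n.factorial : ℝ) ≠ 0 := by exact_mod_cast n.factorial_ne_zero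
  rw [← @Nat.cast_inj ℝ] at this
  push_cast at this ⊢
  field_simp
  linear_combination (J j) * this

def bmp (ε : ℝ) (w : Cv n) : ℝ := sT (1 - ∑ j, ‖ε⁻¹ • w j‖ ^ 2)

def mol (ε : ℝ) (w : Cv n) : ℝ := (∫ x : Cv n, bmp ε x)⁻¹ * bmp ε w

lemma bmp_contDiff (ε : ℝ) : ContDiff ℝ Tt (bmp ε : Cv n → ℝ) := by
  refine Real.smoothTransition.contDiff.comp (contDiff_const.sub (ContDiff.sum fun j _ => ?_))
  exact ((contDiff_apply ℝ ℂ j).const_smul _).norm_sq ℝ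

lemma bmp_zero {ε : ℝ} (hε : 0 < ε) {w : Cv n} (hw : w ∉ cB 0 ε) : bmp ε w = 0 := by
  refine Real.smoothTransition.zero_of_nonpos (sub_nonpos.2 ?_)
  have : ∃ j, ε < ‖w j‖ := by
    by_contra h; push Not at h
    exact hw (mem_closedBall_zero_iff.2 ((pi_norm_le_iff_of_nonneg hε.le).2 h))
  obtain ⟨j, hj⟩ := this
  refine le_trans ?_ (Finset.single_le_sum (f := fun j => ‖ε⁻¹ • w j‖ ^ 2)
    (fun i _ => sq_nonneg _) (Finset.mem_univ j))
  rw [norm_smul, Real.norm_of_nonneg (inv_nonneg.2 hε.le)]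
  have : 1 ≤ ε⁻¹ * ‖w j‖ := by rw [← div_eq_inv_mul]; exact (one_le_div hε).2 hj.le
  exact one_le_pow₀ this

lemma mol_contDiff (ε : ℝ) : ContDiff ℝ Tt (mol ε : Cv n → ℝ) :=
  contDiff_const.mul (bmp_contDiff ε)

lemma mol_zero {ε : ℝ} (hε : 0 < ε) {w : Cv n} (hw : w ∉ cB 0 ε) : mol ε w = 0 := by
  rw [mol, bmp_zero hε hw, mul_zero]

lemma mol_tsupport {ε : ℝ} (hε : 0 < ε) : tsupport (mol ε : Cv n → ℝ) ⊆ cB 0 ε :=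
  closure_minimal (fun x hx => by by_contra h; exact hx (mol_zero hε h)) Metric.isClosed_closedBall

lemma mol_hcs {ε : ℝ} (hε : 0 < ε) : HasCompactSupport (mol ε : Cv n → ℝ) :=
  (isCompact_closedBall 0 ε).of_isClosed_subset (isClosed_tsupport _) (mol_tsupport hε)

lemma mol_nonneg (ε : ℝ) (w : Cv n) : 0 ≤ mol ε w :=
  mul_nonneg (inv_nonneg.2 (integral_nonneg fun _ => Real.smoothTransition.nonneg _))
    (Real.smoothTransition.nonneg _)

lemma mol_integral {ε : ℝ} (hε : 0 < ε) : ∫ w : Cv n, mol ε w = 1 := by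
  have h : 0 < ∫ x : Cv n, bmp ε x := by
    refine Continuous.integral_pos_of_hasCompactSupport_nonneg_nonzero (bmp_contDiff ε).continuous
      ?_ (fun _ => Real.smoothTransition.nonneg _) (x := 0) ?_
    · exact (isCompact_closedBall 0 ε).of_isClosed_subset (isClosed_tsupport _)
        (closure_minimal (fun x hx => by by_contra h; exact hx (bmp_zero hε h))
          Metric.isClosed_closedBall)
    · simp [bmp]
  simp only [mol]; rw [integral_const_mul, inv_mul_cancel₀ h.ne']

lemma mol_rot (ε : ℝ) (θ : ℝ) (w : Cv n) : mol ε (Complex.exp (θ * I) • w) = mol ε w := by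
  simp [mol, bmp, Complex.norm_exp_ofReal_mul_I]

lemma rot_mp (θ : ℝ) : MeasurePreserving (fun w : Cv n => Complex.exp (θ * I) • w) := by
  have h : MeasurePreserving (fun w : ℂ => Complex.exp (θ * I) * w) := by
    have := (rotation (Circle.exp θ)).measurePreserving
    convert this using 2
    simp [rotation_apply]
  exact volume_preserving_pi (fun _ : Fin n => h)

lemma mv_circle {G : Cv n → ℂ} {r : ℝ} (hG : DifferentiableOn ℂ G (mB 0 r))
    {w : Cv n} (hw : ‖w‖ < r) :
    ∫ θ in (0:ℝ)..2*π, G (Complex.exp (θ * I) • w) = (2 * π) * G 0 := by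
  have hd : DiffContOnCl ℂ (fun ζ : ℂ => G (ζ • w)) (mB 0 |(1:ℝ)|) := by
    refine DifferentiableOn.diffContOnCl ?_
    refine hG.comp (f := fun ζ : ℂ => ζ • w) (by fun_prop) ?_
    intro ζ hζ
    have : ‖ζ‖ ≤ 1 := by
      have := Metric.closure_ball_subset_closedBall hζ
      simpa using this
    rw [mem_ball_zero_iff, norm_smul]
    nlinarith [norm_nonneg w]
  have := hd.circleAverage
  simp only [Real.circleAverage_def, circleMap_zero, ofReal_one, one_mul, zero_smul] at this
  have h2 : ((2 * π : ℝ) : ℂ) ≠ 0 := by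
    have := Real.pi_ne_zero
    exact_mod_cast (mul_ne_zero two_ne_zero this)
  rw [← this, Complex.real_smul, ofReal_inv, show (2 * π : ℂ) = ((2 * π : ℝ) : ℂ) by push_cast; rfl,
    mul_inv_cancel_left₀ h2]

lemma mv {G : Cv n → ℂ} {r r' : ℝ} (hG : DifferentiableOn ℂ G (mB 0 r)) (hr : r' < r)
    {c : Cv n → ℝ} (hm : Measurable c) (hi : Integrable c)
    (hs : ∀ w, w ∉ cB 0 r' → c w = 0)
    (hrot : ∀ (θ : ℝ) w, c (Complex.exp (θ * I) • w) = c w) :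
    ∫ w, c w * G w = G 0 * ∫ w, (c w : ℂ) := by
  classical
  have hsub : cB (0 : Cv n) r' ⊆ mB 0 r := Metric.closedBall_subset_ball hr
  set G' := (cB (0 : Cv n) r').indicator G with hG'
  have hG'm : Measurable G' := by
    rw [hG', ← Set.piecewise_eq_indicator]
    exact (hG.continuousOn.mono hsub).measurable_piecewise continuousOn_const
      measurableSet_closedBall
  obtain ⟨C, hC⟩ := (isCompact_closedBall (0 : Cv n) r').exists_bound_of_continuousOn
    (hG.continuousOn.mono hsub)
  have hC' : ∀ w, ‖G' w‖ ≤ |C| := fun w => by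
    by_cases h : w ∈ cB (0 : Cv n) r'
    · rw [hG', Set.indicator_of_mem h]; exact (hC w h).trans (le_abs_self C)
    · rw [hG', Set.indicator_of_notMem h]; simp
  set h := fun w => (c w : ℂ) * G' w with hh
  have hcm : Measurable fun w => (c w : ℂ) := Complex.measurable_ofReal.comp hm
  have hhm : Measurable h := hcm.mul hG'm
  have hhi : Integrable h := by
    refine (hi.ofReal (𝕜 := ℂ)).mul_bdd (c := |C|) hG'm.aestronglyMeasurable (Eventually.of_forall hC')
  have e1 : ∀ w, (c w : ℂ) * G w = h w := fun w => by
    by_cases hw : w ∈ cB (0 : Cv n) r'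
    · simp only [hh, hG', Set.indicator_of_mem hw]
    · simp [hh, hs w hw]
  simp only [e1]
  set R := fun (θ : ℝ) (w : Cv n) => h (Complex.exp (θ * I) • w) with hR
  have hRm : Measurable (Function.uncurry R) := by
    refine hhm.comp (Continuous.measurable ?_)
    fun_prop
  have hRi : ∀ θ, Integrable (R θ) := fun θ => (rot_mp θ).integrable_comp_of_integrable hhi
  have hRe : ∀ θ, ∫ w, R θ w = ∫ w, h w := fun θ =>
    (rot_mp θ).integral_comp (MeasurableEquiv.measurableEmbedding
      ((MeasurableEquiv.smul₀ (Complex.exp (θ * I)) (Complex.exp_ne_zero _)))) h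
  have hRn : ∀ θ, ∫ w, ‖R θ w‖ = ∫ w, ‖h w‖ := fun θ =>
    (rot_mp θ).integral_comp (MeasurableEquiv.measurableEmbedding
      ((MeasurableEquiv.smul₀ (Complex.exp (θ * I)) (Complex.exp_ne_zero _)))) (fun w => ‖h w‖)
  have hprod : Integrable (Function.uncurry R) ((volume.restrict (Set.uIoc 0 (2*π))).prod volume) := by
    rw [integrable_prod_iff hRm.aestronglyMeasurable]
    refine ⟨Eventually.of_forall hRi, ?_⟩
    simp only [Function.uncurry, hRn]
    rw [Set.uIoc_of_le (by positivity)]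
    exact integrable_const _
  have hsw := intervalIntegral_integral_swap (f := R) hprod
  simp only [hRe, intervalIntegral.integral_const, sub_zero] at hsw
  have e2 : ∀ w, ∫ θ in (0:ℝ)..2*π, R θ w = (2 * π * G 0) * (c w : ℂ) := by
    intro w
    by_cases hw : w ∈ cB (0 : Cv n) r'
    · have : ∀ θ : ℝ, R θ w = c w * G (Complex.exp (θ * I) • w) := fun θ => by
        rw [hR]; simp only; rw [← e1, hrot]
      simp only [this]
      rw [intervalIntegral.integral_const_mul, mv_circle hG (mem_ball_zero_iff.1 (hsub hw))]; ring
    · have : ∀ θ : ℝ, R θ w = 0 := fun θ => by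
        rw [hR]; simp only; rw [← e1, hrot, hs w hw]; simp
      simp [this, hs w hw]
  simp only [e2, integral_const_mul, Complex.real_smul] at hsw
  have h2 : (2 * π : ℂ) ≠ 0 := by
    have := Real.pi_ne_zero; simp [this]
  push_cast at hsw
  apply mul_left_cancel₀ h2
  rw [hsw]; ring

def moll (ε : ℝ) (F : Cv n → ℂ) (z : Cv n) : ℂ := ∫ y, F y * (mol ε (z - y) : ℂ)

def molC (ε : ℝ) (z : Cv n) : ℂ := (mol ε z : ℂ)

lemma molC_sm (ε : ℝ) : Sm (molC ε : Cv n → ℂ) := ofRealCLM.contDiff.comp (mol_contDiff ε)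

lemma molC_hcs {ε : ℝ} (hε : 0 < ε) : HasCompactSupport (molC ε : Cv n → ℂ) :=
  (mol_hcs hε).comp_left (g := fun x : ℝ => (x : ℂ)) (by simp)

lemma moll_conv (ε : ℝ) (F : Cv n → ℂ) :
    moll ε F = convolution F (molC ε) (ContinuousLinearMap.mul ℝ ℂ) volume := rfl

lemma moll_sm {ε : ℝ} (hε : 0 < ε) {F : Cv n → ℂ} (hF : LocallyIntegrable F) : Sm (moll ε F) := by
  rw [moll_conv]
  exact (molC_hcs hε).contDiff_convolution_right _ hF (molC_sm ε)

lemma moll_swap (ε : ℝ) (F : Cv n → ℂ) (z) : moll ε F z = ∫ w, F (z - w) * (mol ε w : ℂ) := by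
  rw [moll_conv, convolution_eq_swap]; rfl

lemma molC_tst {ε : ℝ} (hε : 0 < ε) {D : Set (Cv n)} {z : Cv n}
    (hz : cB z ε ⊆ D) : Tst D (fun y => molC ε (z - y)) := by
  have hs : tsupport (fun y => molC ε (z - y)) ⊆ cB z ε := by
    refine closure_minimal (fun x hx => ?_) Metric.isClosed_closedBall
    by_contra h
    refine hx ?_
    simp only [molC]
    rw [mol_zero hε, ofReal_zero]
    intro h'; apply h
    rw [mem_closedBall_zero_iff] at h'
    rw [mem_closedBall_iff_norm']; exact h'
  exact ⟨(molC_sm ε).comp (contDiff_const.sub contDiff_id),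
    (isCompact_closedBall z ε).of_isClosed_subset (isClosed_tsupport _) hs, hs.trans hz⟩

lemma moll_wD {ε : ℝ} (hε : 0 < ε) {F : Cv n → ℂ} (hF : LocallyIntegrable F) (s : ℂ) (j : Fin n)
    (z : Cv n) :
    wD s (moll ε F) j z = - ∫ y, F y * wD s (fun y => molC ε (z - y)) j y := by
  have h1 := (molC_hcs hε).hasFDerivAt_convolution_right (ContinuousLinearMap.mul ℝ ℂ) hF
    ((molC_sm ε).of_le (by norm_cast)) z
  have hci : ConvolutionExistsAt F (fderiv ℝ (molC ε)) z
      ((ContinuousLinearMap.mul ℝ ℂ).precompR (Cv n)) volume := by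
    exact ((molC_hcs hε).fderiv ℝ).convolutionExists_right _ hF
      ((molC_sm ε).continuous_fderiv (by simp)) z
  have h2 : ∀ v, fderiv ℝ (moll ε F) z v = ∫ y, F y * fderiv ℝ (molC ε) (z - y) v := by
    intro v
    rw [moll_conv, h1.fderiv, convolution_def, ContinuousLinearMap.integral_apply hci]; rfl
  have hi : ∀ v, Integrable fun y => F y * fderiv ℝ (molC ε) (z - y) v := by
    intro v
    have := (ContinuousLinearMap.apply ℝ ℂ v).integrable_comp hci
    exact this
  have h3 : ∀ y, wD s (fun y => molC ε (z - y)) j y = - wD s (molC ε) j (z - y) := by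
    intro y
    have : HasFDerivAt (fun y => molC ε (z - y)) (-(fderiv ℝ (molC ε) (z - y))) y := by
      have h := (((molC_sm ε).diff (z - y)).hasFDerivAt).comp y ((hasFDerivAt_id y).const_sub z)
      have e : (fderiv ℝ (molC ε) (z - y)).comp (-ContinuousLinearMap.id ℝ (Cv n))
          = -(fderiv ℝ (molC ε) (z - y)) := by ext; simp
      rw [← e]; exact h
    simp only [wD, this.fderiv, _root_.neg_apply]; ring
  simp only [h3, mul_neg, integral_neg, neg_neg]
  simp only [wD, h2]
  rw [← integral_const_mul, ← integral_add (hi _) ((hi _).const_mul s), ← integral_const_mul]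
  congr 1; funext y; ring

lemma jensen2 {α : Type*} [MeasurableSpace α] (μ : Measure α) [IsProbabilityMeasure μ] {f : α → ℝ≥0∞}
    (hf : AEMeasurable f μ) : (∫⁻ a, f a ∂μ) ^ 2 ≤ ∫⁻ a, f a ^ 2 ∂μ := by
  have h := ENNReal.lintegral_mul_le_Lp_mul_Lq μ Real.HolderConjugate.two_two hf
    (aemeasurable_const (b := (1 : ℝ≥0∞)))
  simp at h
  calc (∫⁻ a, f a ∂μ) ^ 2 ≤ ((∫⁻ a, f a ^ 2 ∂μ) ^ (2⁻¹ : ℝ)) ^ 2 := by gcongr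
    _ = _ := by rw [← ENNReal.rpow_natCast, ← ENNReal.rpow_mul]; norm_num

lemma moll_L2_le {ε : ℝ} (hε : 0 < ε) {F : Cv n → ℂ} (hF : AEStronglyMeasurable F volume) :
    ∫⁻ z, ‖moll ε F z‖ₑ ^ 2 ≤ ∫⁻ z, ‖F z‖ₑ ^ 2 := by
  set m : Cv n → ℝ≥0∞ := fun w => oR (mol ε w) with hm
  have hmm : Measurable m := (mol_contDiff ε).continuous.measurable.ennreal_ofReal
  have hm1 : ∫⁻ w, m w = 1 := by
    rw [hm, ← ofReal_integral_eq_lintegral_ofReal ((mol_contDiff ε).continuous.integrable_of_hasCompactSupport (mol_hcs hε))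
      (Eventually.of_forall (mol_nonneg ε)), mol_integral hε, ENNReal.ofReal_one]
  set μ := (volume : Measure (Cv n)).withDensity m with hμ
  have : IsProbabilityMeasure μ := ⟨by rw [hμ, withDensity_apply _ .univ, Measure.restrict_univ, hm1]⟩
  have hac : μ ≪ volume := withDensity_absolutelyContinuous _ _
  have hmeas : ∀ z : Cv n, AEMeasurable (fun w => ‖F (z - w)‖ₑ) volume := fun z =>
    (hF.comp_quasiMeasurePreserving (quasiMeasurePreserving_sub_left volume z)).enorm
  have h1 : ∀ z, ‖moll ε F z‖ₑ ^ 2 ≤ ∫⁻ w, m w * ‖F (z - w)‖ₑ ^ 2 := by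
    intro z
    have : ‖moll ε F z‖ₑ ≤ ∫⁻ w, ‖F (z - w)‖ₑ ∂μ := by
      rw [moll_swap]
      refine (enorm_integral_le_lintegral_enorm _).trans (le_of_eq ?_)
      rw [hμ, lintegral_withDensity_eq_lintegral_mul₀ hmm.aemeasurable (hmeas z)]
      congr 1; funext w
      rw [enorm_mul, Pi.mul_apply, mul_comm, hm]
      congr 1
      rw [← ofReal_norm, Complex.norm_real, Real.norm_of_nonneg (mol_nonneg ε w)]
    calc ‖moll ε F z‖ₑ ^ 2 ≤ (∫⁻ w, ‖F (z - w)‖ₑ ∂μ) ^ 2 := by gcongr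
      _ ≤ ∫⁻ w, ‖F (z - w)‖ₑ ^ 2 ∂μ := jensen2 μ ((hmeas z).mono_ac hac)
      _ = _ := by
        rw [hμ, lintegral_withDensity_eq_lintegral_mul₀ hmm.aemeasurable ((hmeas z).pow_const 2)]; rfl
  calc ∫⁻ z, ‖moll ε F z‖ₑ ^ 2 ≤ ∫⁻ z, ∫⁻ w, m w * ‖F (z - w)‖ₑ ^ 2 := lintegral_mono h1
    _ = ∫⁻ w, ∫⁻ z, m w * ‖F (z - w)‖ₑ ^ 2 := by
      apply lintegral_lintegral_swap
      refine (hmm.comp measurable_snd).aemeasurable.mul (AEMeasurable.pow_const ?_ 2)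
      exact (hF.comp_quasiMeasurePreserving
        (quasiMeasurePreserving_sub_of_right_invariant volume volume)).enorm
    _ = ∫⁻ w, m w * ∫⁻ z, ‖F z‖ₑ ^ 2 := by
      congr 1; funext w
      rw [lintegral_const_mul' _ _ ENNReal.ofReal_ne_top]
      congr 1
      exact lintegral_sub_right_eq_self (fun z => ‖F z‖ₑ ^ 2) w
    _ = _ := by rw [lintegral_mul_const _ hmm, hm1, one_mul]

lemma moll_integrand {ε : ℝ} (hε : 0 < ε) {F : Cv n → ℂ} (hF : LocallyIntegrable F) (z) :
    Integrable fun y => F y * (mol ε (z - y) : ℂ) :=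
  (molC_hcs hε).convolutionExists_right (ContinuousLinearMap.mul ℝ ℂ) hF (molC_sm ε).continuous z

lemma moll_sub {ε : ℝ} (hε : 0 < ε) {F G : Cv n → ℂ} (hF : LocallyIntegrable F)
    (hG : LocallyIntegrable G) (z) : moll ε (F - G) z = moll ε F z - moll ε G z := by
  simp only [moll]
  rw [← integral_sub (moll_integrand hε hF z) (moll_integrand hε hG z)]
  congr 1; funext y; simp [sub_mul]

lemma moll_close {ε : ℝ} (hε : 0 < ε) {F : Cv n → ℂ} (hF : LocallyIntegrable F) {z c δ}
    (h : ∀ y, ‖y - z‖ ≤ ε → ‖F y - c‖ ≤ δ) : ‖moll ε F z - c‖ ≤ δ := by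
  have hi : Integrable fun y => mol ε (z - y) :=
    ((mol_contDiff ε).continuous.integrable_of_hasCompactSupport (mol_hcs hε)).comp_sub_left z
  have hi' : Integrable fun y => (mol ε (z - y) : ℂ) := hi.ofReal
  have h1 : ∫ y, mol ε (z - y) = 1 := by
    rw [integral_sub_left_eq_self (fun y => mol ε y) volume z, mol_integral hε]
  have hc : c = ∫ y, c * (mol ε (z - y) : ℂ) := by
    rw [integral_const_mul, integral_complex_ofReal, h1]; simp
  rw [hc, moll, ← integral_sub (moll_integrand hε hF z) (hi'.const_mul c)]
  have h2 : δ = ∫ y, δ * mol ε (z - y) := by rw [integral_const_mul, h1, mul_one]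
  rw [h2]
  refine norm_integral_le_of_norm_le (hi.const_mul δ) (Eventually.of_forall fun y => ?_)
  rw [← sub_mul, norm_mul, Complex.norm_real, Real.norm_of_nonneg (mol_nonneg _ _)]
  by_cases hy : ‖y - z‖ ≤ ε
  · exact mul_le_mul_of_nonneg_right (h y hy) (mol_nonneg _ _)
  · rw [mol_zero hε]; · simp
    rw [mem_closedBall_zero_iff, norm_sub_rev]; exact hy

lemma moll_L2 {F : Cv n → ℂ} (hF : MemLp F 2) :
    Tendsto (fun ε => eLpNorm (fun z => moll ε F z - F z) 2 volume) (𝓝[>] 0) (𝓝 0) := by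
  have hle : ∀ {ε : ℝ} (hε : 0 < ε) {G : Cv n → ℂ} (hG : AEStronglyMeasurable G volume),
      eLpNorm (moll ε G) 2 volume ≤ eLpNorm G 2 volume := by
    intro ε hε G hG
    rw [eLpNorm_eq_lintegral_rpow_enorm_toReal (by simp) (by simp), eLpNorm_eq_lintegral_rpow_enorm_toReal (by simp) (by simp)]
    simp only [ENNReal.toReal_ofNat, ENNReal.rpow_ofNat]
    exact ENNReal.rpow_le_rpow (moll_L2_le hε hG) (by norm_num)
  have hFl : LocallyIntegrable F := hF.locallyIntegrable (by norm_num)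
  rw [ENNReal.tendsto_nhds_zero]
  intro δ hδ
  rcases eq_or_ne δ ⊤ with rfl | hδt
  · simp
  obtain ⟨g, hgc, hg, hgcont, hgm⟩ := hF.exists_hasCompactSupport_eLpNorm_sub_le (by simp)
    (ε := δ / 3) (ENNReal.div_pos hδ.ne' (by simp)).ne'
  have hgl : LocallyIntegrable g := hgcont.locallyIntegrable
  set K := Metric.cthickening 1 (tsupport g)
  have hK : IsCompact K := IsCompact.cthickening hgc
  have hKf : volume K ≠ ⊤ := hK.measure_lt_top.ne
  obtain ⟨η, hη, hηK⟩ : ∃ η : ℝ, 0 < η ∧ (volume K) ^ (2:ℝ)⁻¹ * oR η ≤ δ / 3 := by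
    have h1 : Tendsto (fun η : ℝ => (volume K) ^ (2:ℝ)⁻¹ * oR η) (𝓝[>] 0) (𝓝 0) := by
      have : Tendsto (fun η : ℝ => (volume K) ^ (2:ℝ)⁻¹ * oR η) (𝓝 0) (𝓝 ((volume K) ^ (2:ℝ)⁻¹ * oR 0)) :=
        ENNReal.Tendsto.const_mul (ENNReal.continuous_ofReal.tendsto 0)
          (Or.inr (ENNReal.rpow_ne_top_of_nonneg (by norm_num) hKf))
      simp only [ENNReal.ofReal_zero, mul_zero] at this
      exact this.mono_left nhdsWithin_le_nhds
    have h2 := (ENNReal.tendsto_nhds_zero.1 h1) (δ / 3) (ENNReal.div_pos hδ.ne' (by simp))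
    obtain ⟨η, h, h'⟩ := (h2.and self_mem_nhdsWithin).exists
    exact ⟨η, h', h⟩
  have huc := hgc.uniformContinuous_of_continuous hgcont
  obtain ⟨r, hr, hrr⟩ := Metric.uniformContinuous_iff.1 huc η hη
  have hev : ∀ᶠ ε : ℝ in 𝓝[>] 0, 0 < ε ∧ ε < r ∧ ε < 1 := by
    filter_upwards [self_mem_nhdsWithin, nhdsWithin_le_nhds (gt_mem_nhds hr),
      nhdsWithin_le_nhds (gt_mem_nhds (zero_lt_one' ℝ))] with ε h1 h2 h3 using ⟨h1, h2, h3⟩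
  filter_upwards [hev] with ε ⟨hε, hεr, hε1⟩
  have hg1 : ∀ z, ‖moll ε g z - g z‖ ≤ η := fun z => moll_close hε hgl fun y hy => by
    have := hrr (a := y) (b := z) (by rw [dist_eq_norm]; linarith)
    rw [dist_eq_norm] at this; exact this.le
  have hg2 : ∀ z ∉ K, moll ε g z - g z = 0 := by
    intro z hz
    have hz' : ∀ y, ‖y - z‖ ≤ ε → g y = 0 := by
      intro y hy
      by_contra h
      refine hz (Metric.mem_cthickening_of_dist_le z y 1 _ (subset_tsupport g h) ?_)
      rw [dist_comm, dist_eq_norm]; linarith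
    have h0 : g z = 0 := hz' z (by simpa using hε.le)
    rw [h0]
    have := moll_close (c := 0) (δ := 0) hε hgl (z := z) (fun y hy => by simp [hz' y hy])
    simpa using this
  have hg3 : eLpNorm (fun z => moll ε g z - g z) 2 volume ≤ δ / 3 := by
    have : eLpNorm (fun z => moll ε g z - g z) 2 volume
        = eLpNorm (fun z => moll ε g z - g z) 2 (volume.restrict K) := by
      rw [← eLpNorm_indicator_eq_eLpNorm_restrict hK.measurableSet]
      congr 1; funext z
      by_cases hz : z ∈ K
      · simp [hz]
      · simp [hz, hg2 z hz]
    rw [this]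
    refine (eLpNorm_le_of_ae_bound (Eventually.of_forall hg1)).trans ?_
    simpa using hηK
  have hsm : ∀ {G : Cv n → ℂ}, LocallyIntegrable G → AEStronglyMeasurable (moll ε G) volume :=
    fun hG => (moll_sm hε hG).continuous.aestronglyMeasurable
  have hFg : MemLp (F - g) 2 := hF.sub hgm
  have e : (fun z => moll ε F z - F z) = moll ε (F - g) + (fun z => moll ε g z - g z) - (F - g) := by
    funext z; simp only [Pi.add_apply, Pi.sub_apply, moll_sub hε hFl hgl]; ring
  rw [e]
  calc _ ≤ eLpNorm (moll ε (F - g)) 2 volume + eLpNorm (fun z => moll ε g z - g z) 2 volume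
        + eLpNorm (F - g) 2 volume := by
        refine (eLpNorm_sub_le ((hsm (hFl.sub hgl)).add ((hsm hgl).sub hgcont.aestronglyMeasurable)) hFg.1 (by norm_num)).trans ?_
        gcongr
        exact eLpNorm_add_le (hsm (hFl.sub hgl)) ((hsm hgl).sub hgcont.aestronglyMeasurable) (by norm_num)
    _ ≤ δ / 3 + δ / 3 + δ / 3 := by
      gcongr
      exact (hle hε hFg.1).trans hg
    _ = δ := ENNReal.add_thirds δ

lemma holo_of_wD {f : Cv n → ℂ} {z : Cv n} (hf : DifferentiableAt ℝ f z)
    (h : ∀ j, wD I f j z = 0) : DifferentiableAt ℂ f z := by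
  rw [differentiableAt_iff_restrictScalars ℝ hf]
  refine ⟨∑ j, (Dm f j z) • (ContinuousLinearMap.proj j : Cv n →L[ℂ] ℂ), ?_⟩
  ext w
  rw [fderiv_eq_sum]
  simp [h, mul_comm]

lemma wD_of_holo {f : Cv n → ℂ} {z : Cv n} (hf : DifferentiableAt ℂ f z) (j : Fin n) :
    wD I f j z = 0 := by
  have h1 : fderiv ℝ f z = (fderiv ℂ f z).restrictScalars ℝ := hf.fderiv_restrictScalars ℝ
  have h2 : (Pi.single j I : Cv n) = I • Pi.single j 1 := by
    rw [← Pi.single_smul]; simp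
  simp only [wD, h1, ContinuousLinearMap.coe_restrictScalars', h2, map_smul, smul_eq_mul]
  rw [← mul_assoc, I_mul_I]; ring

lemma moll_comm {ε δ : ℝ} (hε : 0 < ε) (hδ : 0 < δ) {F : Cv n → ℂ} (hF : LocallyIntegrable F) (z) :
    moll ε (moll δ F) z = moll δ (moll ε F) z := by
  have key : ∀ {ε δ : ℝ}, 0 < ε → 0 < δ → moll ε (moll δ F) z =
      convolution F (convolution (molC δ) (molC ε) (ContinuousLinearMap.mul ℝ ℂ) volume)
        (ContinuousLinearMap.mul ℝ ℂ) volume z := by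
    intro ε δ hε hδ
    rw [moll_conv, moll_conv]
    have hnl : LocallyIntegrable (fun x => ‖(molC δ x : ℂ)‖ : Cv n → ℝ) :=
      (molC_sm δ).continuous.norm.locallyIntegrable
    refine convolution_assoc _ _ _ _ (fun x y z => by simp [mul_assoc]) hF.aestronglyMeasurable
      (molC_sm δ).continuous.aestronglyMeasurable (molC_sm ε).continuous.aestronglyMeasurable
      (Eventually.of_forall fun y => (molC_hcs hδ).convolutionExists_right _ hF (molC_sm δ).continuous y)
      (Eventually.of_forall fun y => (molC_hcs hε).norm.convolutionExists_right _ hnl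
        (molC_sm ε).continuous.norm y) ?_
    have h1 : HasCompactSupport (convolution (fun x : Cv n => ‖molC δ x‖) (fun x => ‖molC ε x‖)
        (ContinuousLinearMap.mul ℝ ℝ) volume) :=
      HasCompactSupport.convolution (L := ContinuousLinearMap.mul ℝ ℝ) (molC_hcs hδ).norm (molC_hcs hε).norm
    have h2 : Continuous (convolution (fun x : Cv n => ‖molC δ x‖) (fun x => ‖molC ε x‖)
        (ContinuousLinearMap.mul ℝ ℝ) volume) :=
      HasCompactSupport.continuous_convolution_right _ (molC_hcs hε).norm hnl (molC_sm ε).continuous.norm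
    exact h1.convolutionExists_right _ (fun x => let ⟨s, hs, hi⟩ := hF x; ⟨s, hs, hi.norm⟩) h2 z
  rw [key hε hδ, key hδ hε]
  congr 1
  rw [← convolution_flip]
  congr 1
  ext <;> simp

lemma moll_mv {ε : ℝ} (hε : 0 < ε) {G : Cv n → ℂ} {z : Cv n} {r : ℝ} (hr : ε < r)
    (hG : DifferentiableOn ℂ G (mB z r)) : moll ε G z = G z := by
  rw [moll_swap]
  have h := mv (G := fun w => G (z - w)) (r := r) (r' := ε) (c := mol ε) ?_ hr
    (mol_contDiff ε).continuous.measurable ((mol_contDiff ε).continuous.integrable_of_hasCompactSupport (mol_hcs hε))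
    (fun w hw => mol_zero hε hw) (mol_rot ε)
  · simp only [mul_comm (G _)]
    rw [h, integral_complex_ofReal, mol_integral hε]; simp
  · refine hG.comp (by fun_prop) ?_
    intro w hw
    rw [mem_ball_zero_iff] at hw
    rw [mem_ball_iff_norm]; simpa using hw

lemma weyl_local {F : Cv n → ℂ} (hF : MemLp F 2) {z₀ : Cv n} {R : ℝ} (hR : 0 < R)
    (hw : ∀ h, Tst (mB z₀ R) h → ∀ j, ∫ z, F z * wD I h j z = 0) :
    ∃ f : Cv n → ℂ, DifferentiableOn ℂ f (mB z₀ (R/2)) ∧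
      ∀ᵐ z, z ∈ mB z₀ (R/2) → f z = F z := by
  have hFl : LocallyIntegrable F := hF.locallyIntegrable (by norm_num)
  have hhol : ∀ ε, 0 < ε → DifferentiableOn ℂ (moll ε F) (mB z₀ (R - ε)) := by
    intro ε hε z hz
    refine (holo_of_wD ((moll_sm hε hFl).diff z) fun j => ?_).differentiableWithinAt
    rw [moll_wD hε hFl, hw _ (molC_tst hε ?_) j, neg_zero]
    exact Metric.closedBall_subset_ball' (by have := Metric.mem_ball.1 hz; linarith)
  have heq : ∀ ε δ, 0 < ε → 0 < δ → ε + δ < R/2 → ∀ z ∈ mB z₀ (R/2), moll ε (moll δ F) z = moll δ F z := by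
    intro ε δ hε hδ h z hz
    refine moll_mv hε (r := R/2 - δ) (by linarith) ((hhol δ hδ).mono ?_)
    exact Metric.ball_subset_ball' (by have := Metric.mem_ball.1 hz; linarith)
  refine ⟨moll (R/8) F, (hhol _ (by positivity)).mono (Metric.ball_subset_ball (by linarith)), ?_⟩
  have hc : ∀ ε, 0 < ε → ε < R/8 → ∀ z ∈ mB z₀ (R/2), moll ε F z = moll (R/8) F z := by
    intro ε hε h z hz
    rw [← heq (R/8) ε (by positivity) hε (by linarith) z hz, moll_comm (by positivity) hε hFl,
      heq ε (R/8) hε (by positivity) (by linarith) z hz]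
  set U := mB z₀ (R/2)
  have hz : eLpNorm (fun z => moll (R/8) F z - F z) 2 (volume.restrict U) = 0 := by
    refine le_antisymm ?_ zero_le
    refine ge_of_tendsto (moll_L2 hF) ?_
    filter_upwards [self_mem_nhdsWithin, nhdsWithin_le_nhds (gt_mem_nhds (show (0:ℝ) < R/8 by positivity))] with ε h1 h2
    rw [← eLpNorm_indicator_eq_eLpNorm_restrict Metric.isOpen_ball.measurableSet]
    refine eLpNorm_mono fun z => ?_
    by_cases hzU : z ∈ U
    · rw [Set.indicator_of_mem hzU, hc ε h1 h2 z hzU]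
    · rw [Set.indicator_of_notMem hzU]; simp
  replace hz : eLpNorm (moll (R/8) F - F) 2 (volume.restrict U) = 0 := hz
  rw [eLpNorm_eq_zero_iff (((moll_sm (by positivity) hFl).continuous.aestronglyMeasurable.sub hF.1).restrict) (by simp)] at hz
  have := (ae_restrict_iff' Metric.isOpen_ball.measurableSet).1 hz
  filter_upwards [this] with z h1 h2
  simpa [sub_eq_zero] using h1 h2

lemma weyl {Ω : Set (Cv n)} (hΩ : IsOpen Ω) {F : Cv n → ℂ}
    (hF : ∀ K ⊆ Ω, IsCompact K → MemLp F 2 (volume.restrict K))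
    (hw : ∀ h, Tst Ω h → ∀ j, ∫ z, F z * wD I h j z = 0) :
    ∃ f : Cv n → ℂ, DifferentiableOn ℂ f Ω ∧ ∀ᵐ z, z ∈ Ω → f z = F z := by
  have loc : ∀ z₀ : Cv n, ∃ r : ℝ, ∃ f : Cv n → ℂ, z₀ ∈ Ω → 0 < r ∧ 
      DifferentiableOn ℂ f (mB z₀ r) ∧ ∀ᵐ z, z ∈ mB z₀ r → f z = F z := by
    intro z₀
    by_cases h0 : z₀ ∈ Ω
    swap; · exact ⟨0, 0, fun h => absurd h h0⟩
    obtain ⟨R, hR, hRΩ⟩ := Metric.nhds_basis_closedBall.mem_iff.1 (hΩ.mem_nhds h0)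
    have hm : MemLp ((cB z₀ R).indicator F) 2 :=
      (memLp_indicator_iff_restrict measurableSet_closedBall).2 (hF _ hRΩ (isCompact_closedBall _ _))
    obtain ⟨f, hf, hff⟩ := weyl_local hm hR (z₀ := z₀) (fun h hh j => by
      rw [← hw h ⟨hh.1, hh.2.1, hh.2.2.trans (Metric.ball_subset_closedBall.trans hRΩ)⟩ j]
      congr 1; funext z
      by_cases hz : z ∈ cB z₀ R
      · rw [Set.indicator_of_mem hz]
      · rw [wD_eq_zero_of_notMem (fun h' => hz (Metric.ball_subset_closedBall (hh.2.2 h')))]; simp)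
    refine ⟨R/2, f, fun _ => ⟨by positivity, hf, ?_⟩⟩
    filter_upwards [hff] with z hz hz'
    rw [hz hz', Set.indicator_of_mem (Metric.ball_subset_closedBall (Metric.ball_subset_ball (by linarith) hz'))]
  choose r g hg using loc
  have key : ∀ z₀ ∈ Ω, ∀ z ∈ Ω, z ∈ mB z₀ (r z₀) → g z z = g z₀ z := by
    intro z₀ h0 z hz hzb
    obtain ⟨-, hd0, ha0⟩ := hg z₀ h0
    obtain ⟨hr, hd, ha⟩ := hg z hz
    have ho : IsOpen (mB z₀ (r z₀) ∩ mB z (r z)) := Metric.isOpen_ball.inter Metric.isOpen_ball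
    refine Measure.eqOn_open_of_ae_eq (μ := volume) (U := mB z₀ (r z₀) ∩ mB z (r z)) ?_ ho
      (hd.continuousOn.mono Set.inter_subset_right) (hd0.continuousOn.mono Set.inter_subset_left)
      ⟨hzb, Metric.mem_ball_self hr⟩
    rw [Filter.EventuallyEq, ae_restrict_iff' ho.measurableSet]
    filter_upwards [ha0, ha] with x h1 h2 hx
    rw [h1 hx.1, h2 hx.2]
  have hev : ∀ z₀ ∈ Ω, ∀ᶠ z in 𝓝 z₀, z ∈ Ω ∧ z ∈ mB z₀ (r z₀) := fun z₀ h0 =>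
    (hΩ.eventually_mem h0).and (Metric.ball_mem_nhds _ (hg z₀ h0).1)
  refine ⟨fun z => g z z, fun z₀ h0 => ?_, ?_⟩
  · have h1 : (fun z => g z z) =ᶠ[𝓝 z₀] g z₀ := by
      filter_upwards [hev z₀ h0] with z hz using key z₀ h0 z hz.1 hz.2
    exact (((hg z₀ h0).2.1.differentiableAt (Metric.ball_mem_nhds _ (hg z₀ h0).1)).congr_of_eventuallyEq
      h1).differentiableWithinAt
  · rw [ae_iff]
    refine measure_null_of_locally_null _ fun z₀ hz₀ => ?_
    simp only [Classical.not_imp, Set.mem_ofPred_eq] at hz₀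
    have h0 := hz₀.1
    refine ⟨_, mem_nhdsWithin_of_mem_nhds (hev z₀ h0) |> fun h => inter_mem h self_mem_nhdsWithin, ?_⟩
    refine measure_mono_null ?_ (ae_iff.1 (hg z₀ h0).2.2)
    rintro z ⟨⟨h1, h2⟩, h3⟩
    simp only [Classical.not_imp, Set.mem_ofPred_eq] at h3 ⊢
    refine ⟨h2, ?_⟩
    rw [← key z₀ h0 z h1 h2]; exact h3.2

def Lf (φ : Cv n → ℝ) (z v : Cv n) : ℝ :=
  (∑ j, ∑ k, cHessian φ z j k * v j * stC (v k)).re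

def dl (φ : Cv n → ℝ) (f : Cv n → ℂ) (j : Fin n) (z : Cv n) : ℂ :=
  Dm f j z - Dm (Rc φ) j z * f z

def om (φ : Cv n → ℝ) (z : Cv n) : ℂ := Complex.exp (-(φ z : ℂ))

section BE
variable {φ : Cv n → ℝ} {f g : Cv n → ℂ}
  {j k : Fin n} {z : Cv n}

lemma om_eq : om φ z = ((ex (-φ z) : ℝ) : ℂ) := by simp [om]

lemma om_conj : stC (om φ z) = om φ z := by rw [om_eq, conj_ofReal]

lemma phiC (hφ : ContDiff ℝ Tt φ) : Sm (Rc φ) := ofRealCLM.contDiff.comp hφ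

lemma om_sm (hφ : ContDiff ℝ Tt φ) : Sm (om φ) := (phiC hφ).neg.cexp

lemma om_wD (hφ : ContDiff ℝ Tt φ) (s : ℂ) : wD s (om φ) j z = - wD s (Rc φ) j z * om φ z := by
  have h := wD_exp (s := s) (j := j) (Sm.diff (phiC hφ).neg z)
  have h2 : wD s (fun x => -(φ x : ℂ)) j z = - wD s (Rc φ) j z := by
    have := wD_const_mul (s := s) (j := j) (-1) ((phiC hφ).diff z)
    simpa using this
  change wD s (fun x => Complex.exp (-(φ x : ℂ))) j z = _ * Complex.exp (-(φ z : ℂ))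
  rw [h, h2]; ring

lemma dl_om (hφ : ContDiff ℝ Tt φ) (hf : DifferentiableAt ℝ f z) : Dm (fun x => f x * om φ x) j z = dl φ f j z * om φ z := by
  rw [wD_mul hf ((om_sm hφ).diff z), om_wD hφ, dl]; ring

lemma dl_sm (hφ : ContDiff ℝ Tt φ) (hf : Sm f) : Sm (dl φ f j) :=
  (Sm.wD hf _ _).sub ((Sm.wD (phiC hφ) _ _).mul hf)

lemma dl_hcs (hf : HasCompactSupport f) : HasCompactSupport (dl φ f j) :=
  (hcs_wD hf).sub hf.mul_left

lemma conj_sm (hf : Sm f) : Sm (fun x => stC (f x)) := conjCLE.contDiff.comp hf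

lemma adj1 (hφ : ContDiff ℝ Tt φ) (hf : Sm f) (hc : HasCompactSupport f) (hg : Sm g) :
    ∫ z, dl φ f j z * stC (g z) * om φ z
      = - ∫ z, f z * stC (wD I g j z) * om φ z := by
  have h := ibp (s := -I) (j := j) (hf.mul (om_sm hφ)) (conj_sm hg) hc.mul_right
  have e : ∀ z, Dm (fun x => f x * om φ x) j z * stC (g z)
      = dl φ f j z * stC (g z) * om φ z := fun z => by
    rw [dl_om hφ (hf.diff z)]; ring
  have e2 : ∀ z, (f z * om φ z) * Dm (fun x => stC (g x)) j z
      = f z * stC (wD I g j z) * om φ z := fun z => by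
    rw [wD_conj]; simp only [map_neg, conj_I, neg_neg]; ring
  simp only [e, e2] at h
  exact h

lemma adj2 (hφ : ContDiff ℝ Tt φ) (hf : Sm f) (hc : HasCompactSupport f) (hg : Sm g) :
    ∫ z, wD I f j z * stC (g z) * om φ z
      = - ∫ z, f z * stC (dl φ g j z) * om φ z := by
  have h := ibp (s := I) (j := j) hf ((conj_sm hg).mul (om_sm hφ)) hc
  have e : ∀ z, wD I f j z * (stC (g z) * om φ z)
      = wD I f j z * stC (g z) * om φ z := fun z => by ring
  have e2 : ∀ z, f z * wD I (fun x => stC (g x) * om φ x) j z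
      = f z * stC (dl φ g j z) * om φ z := fun z => by
    rw [wD_mul ((conj_sm hg).diff z) ((om_sm hφ).diff z), om_wD hφ, wD_conj, dl, map_sub, map_mul,
      wD_ofReal]
    simp only [conj_I, map_neg, neg_neg]; ring
  simp only [e, e2] at h
  exact h

lemma dl_comm (hφ : ContDiff ℝ Tt φ) (hf : Sm f) :
    wD I (dl φ f j) k z = dl φ (wD I f k) j z - cHessian φ z j k * f z := by
  have h1 : wD I (dl φ f j) k z = wD I (fun x => Dm f j x -
    Dm (Rc φ) j x * f x) k z := rfl
  rw [h1, wD_sub ((Sm.wD hf _ _).diff z) (Sm.diff ((Sm.wD (phiC hφ) _ _).mul hf) z),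
    wD_mul ((Sm.wD (phiC hφ) _ _).diff z) (hf.diff z), wD_comm hf.contDiffAt, dl, cHessian_apply]
  ring

lemma be_jk (hφ : ContDiff ℝ Tt φ) {f g : Cv n → ℂ} (hf : Sm f) (hc : HasCompactSupport f) (hg : Sm g) :
    ∫ z, dl φ f j z * stC (dl φ g k z) * om φ z
      = (∫ z, wD I f k z * stC (wD I g j z) * om φ z)
        + ∫ z, cHessian φ z j k * f z * stC (g z) * om φ z := by
  have h1 := adj2 (j := k) hφ (dl_sm (j := j) hφ hf) (dl_hcs hc) hg
  have h2 := adj1 (j := j) hφ (Sm.wD hf I k) (hcs_wD hc) hg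
  simp only [dl_comm hφ hf] at h1
  have hH : Sm (fun z => cHessian φ z j k) := by
    simp only [cHessian_apply]; exact Sm.wD (Sm.wD (phiC hφ) _ _) _ _
  have i1 : Integrable fun z => dl φ (wD I f k) j z * stC (g z) * om φ z :=
    Sm.integrable (((dl_sm hφ (Sm.wD hf I k)).mul (conj_sm hg)).mul (om_sm hφ))
      (dl_hcs (hcs_wD hc)).mul_right.mul_right
  have i2 : Integrable fun z => cHessian φ z j k * f z * stC (g z) * om φ z :=
    Sm.integrable (((hH.mul hf).mul (conj_sm hg)).mul (om_sm hφ))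
      hc.mul_left.mul_right.mul_right
  simp only [sub_mul] at h1
  rw [integral_sub i1 i2, h2] at h1
  linear_combination h1

end BE

lemma cross_ident (a : Fin n → Cv n) :
    (∑ j, ∑ k, a j k * stC (a k j)).re
      = (∑ j, ∑ k, ‖a j k‖ ^ 2) - 1/2 * ∑ j, ∑ k, ‖a j k - a k j‖ ^ 2 := by
  have h1 : ∀ j k, ‖a j k - a k j‖ ^ 2 = ‖a j k‖ ^ 2 + ‖a k j‖ ^ 2 - 2 * (a j k * stC (a k j)).re := by
    intro j k
    simp only [← Complex.normSq_eq_norm_sq]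
    rw [Complex.normSq_sub]
  simp only [h1, Finset.sum_sub_distrib, Finset.sum_add_distrib, ← Finset.mul_sum]
  rw [Finset.sum_comm (f := fun j k => ‖a k j‖ ^ 2)]
  simp only [Complex.re_sum]
  ring

def tau (φ η : Cv n → ℝ) (f : Fin n → Cv n → ℂ) (z : Cv n) : ℂ :=
  ∑ j, (dl φ (f j) j z + Dm (Rc η) j z * f j z)

lemma sumsq_cs (a b : Cv n) : ‖∑ j, a j * b j‖ ^ 2 ≤ (∑ j, ‖a j‖ ^ 2) * ∑ j, ‖b j‖ ^ 2 := by
  calc ‖∑ j, a j * b j‖ ^ 2 ≤ (∑ j, ‖a j‖ * ‖b j‖) ^ 2 := by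
        gcongr
        refine (norm_sum_le _ _).trans (le_of_eq ?_)
        simp only [norm_mul]
    _ ≤ _ := Finset.sum_mul_sq_le_sq_mul_sq _ _ _

lemma basic_est {φ η : Cv n → ℝ} (hφ : ContDiff ℝ Tt φ) (hη : ContDiff ℝ Tt η)
    {f : Fin n → Cv n → ℂ} (hf : ∀ j, Sm (f j)) (hc : ∀ j, HasCompactSupport (f j)) :
    ∫ z, (Lf φ z (fun j => f j z) - 2 * (∑ j, ‖Dm (Rc η) j z‖ ^ 2)
        * ∑ j, ‖f j z‖ ^ 2) * ex (-φ z)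
      ≤ 2 * (∫ z, ‖tau φ η f z‖ ^ 2 * ex (-φ z))
        + 1/2 * ∫ z, (∑ j, ∑ k, ‖wD I (f j) k z - wD I (f k) j z‖ ^ 2) * ex (-φ z) := by
  have hint : ∀ {G : Cv n → ℝ}, Continuous G → (∀ z, (∀ j, z ∉ tsupport (f j)) → G z = 0) →
      Integrable G := by
    intro G hG h0
    refine hG.integrable_of_hasCompactSupport ?_
    refine HasCompactSupport.intro (K := ⋃ j, tsupport (f j)) (isCompact_iUnion fun j => hc j) ?_
    intro z hz
    exact h0 z (by simpa using hz)
  have hom : Continuous fun z => ex (-φ z) := hφ.continuous.neg.rexp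
  have cf : ∀ j, Continuous (f j) := fun j => (hf j).continuous
  have cw : ∀ s j k, Continuous (wD s (f j) k) := fun s j k => (Sm.wD (hf j) s k).continuous
  have cη : ∀ j, Continuous (Dm (Rc η) j) := fun j => (Sm.wD (phiC hη) _ j).continuous
  have cd : ∀ j, Continuous (dl φ (f j) j) := fun j => (dl_sm hφ (hf j)).continuous
  have cH : ∀ j k, Continuous (fun z => cHessian φ z j k) := fun j k => by
    simp only [cHessian_apply]; exact (Sm.wD (Sm.wD (phiC hφ) _ _) _ _).continuous
  have ct : Continuous (tau φ η f) := by
    exact continuous_finsetSum _ fun j _ => (cd j).add ((cη j).mul (cf j))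
  have cL : Continuous fun z => Lf φ z (fun j => f j z) := by
    simp only [Lf]
    exact continuous_re.comp (continuous_finsetSum _ fun j _ => continuous_finsetSum _ fun k _ =>
      ((cH j k).mul (cf j)).mul (continuous_conj.comp (cf k)))
  have z0 : ∀ {z}, (∀ j, z ∉ tsupport (f j)) → ∀ j, f j z = 0 := fun h j => image_eq_zero_of_notMem_tsupport (h j)
  have zw : ∀ {z}, (∀ j, z ∉ tsupport (f j)) → ∀ s j k, wD s (f j) k z = 0 := fun h s j k => wD_eq_zero_of_notMem (h j)
  have zd : ∀ {z}, (∀ j, z ∉ tsupport (f j)) → ∀ j, dl φ (f j) j z = 0 := fun h j => by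
    simp [dl, zw h, z0 h]
  have key : ∫ z, ‖∑ j, dl φ (f j) j z‖ ^ 2 * ex (-φ z)
      = (∫ z, (∑ j, ∑ k, wD I (f j) k z * stC (wD I (f k) j z)).re * ex (-φ z))
        + ∫ z, Lf φ z (fun j => f j z) * ex (-φ z) := by
    have h1 : ∫ z, (∑ j, ∑ k, dl φ (f j) j z * stC (dl φ (f k) k z) * om φ z)
        = (∫ z, (∑ j, ∑ k, wD I (f j) k z * stC (wD I (f k) j z) * om φ z))
        + ∫ z, ∑ j, ∑ k, cHessian φ z j k * f j z * stC (f k z) * om φ z := by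
      have i0 : ∀ j k, Integrable fun z => dl φ (f j) j z * stC (dl φ (f k) k z) * om φ z :=
        fun j k => Sm.integrable (((dl_sm hφ (hf j)).mul (conj_sm (dl_sm hφ (hf k)))).mul (om_sm hφ))
          (dl_hcs (hc j)).mul_right.mul_right
      have i1 : ∀ j k, Integrable fun z => wD I (f j) k z * stC (wD I (f k) j z) * om φ z :=
        fun j k => Sm.integrable (((Sm.wD (hf j) _ _).mul (conj_sm (Sm.wD (hf k) _ _))).mul (om_sm hφ))
          (hcs_wD (hc j)).mul_right.mul_right
      have i2 : ∀ j k, Integrable fun z => cHessian φ z j k * f j z * stC (f k z) * om φ z :=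
        fun j k => by
          refine (((((cH j k).mul (cf j)).mul (continuous_conj.comp (cf k))).mul
            (om_sm hφ).continuous)).integrable_of_hasCompactSupport ?_
          exact (hc j).mul_left.mul_right.mul_right
      simp only [integral_finsetSum _ fun j _ => integrable_finsetSum _ fun k _ => i0 j k,
        integral_finsetSum _ fun k _ => i0 _ k,
        integral_finsetSum _ fun j _ => integrable_finsetSum _ fun k _ => i1 j k,
        integral_finsetSum _ fun k _ => i1 _ k,
        integral_finsetSum _ fun j _ => integrable_finsetSum _ fun k _ => i2 j k,
        integral_finsetSum _ fun k _ => i2 _ k, ← Finset.sum_add_distrib]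
      exact Finset.sum_congr rfl fun j _ => Finset.sum_congr rfl fun k _ =>
        be_jk hφ (hf j) (hc j) (hf k)
    have toRe : ∀ {G : Cv n → ℂ}, Continuous G → (∀ z, (∀ j, z ∉ tsupport (f j)) → G z = 0) →
        (∫ z, G z).re = ∫ z, (G z).re := by
      intro G hG h0
      have : Integrable G := by
        refine hG.integrable_of_hasCompactSupport (HasCompactSupport.intro (K := ⋃ j, tsupport (f j))
          (isCompact_iUnion fun j => hc j) fun z hz => h0 z (by simpa using hz))
      exact (integral_re this).symm
    have h2 := congrArg Complex.re h1
    rw [add_re, toRe, toRe, toRe] at h2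
    · convert h2 using 2
      · funext z
        have : (∑ j, ∑ k, dl φ (f j) j z * stC (dl φ (f k) k z) * om φ z)
            = ((‖∑ j, dl φ (f j) j z‖ ^ 2 : ℝ) : ℂ) * om φ z := by
          rw [ofReal_pow, ← Complex.mul_conj', map_sum, Finset.sum_mul_sum, Finset.sum_mul]
          simp only [Finset.sum_mul]
        rw [this, om_eq, ← ofReal_mul, ofReal_re]
      · congr 1; funext z
        simp only [← Finset.sum_mul]
        rw [om_eq, re_mul_ofReal]
      · congr 1; funext z
        simp only [← Finset.sum_mul]
        rw [om_eq, re_mul_ofReal, Lf]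
    · exact continuous_finsetSum _ fun j _ => continuous_finsetSum _ fun k _ =>
        ((cH j k).mul (cf j)).mul (continuous_conj.comp (cf k)) |>.mul (om_sm hφ).continuous
    · intro z hz; simp [z0 hz]
    · exact continuous_finsetSum _ fun j _ => continuous_finsetSum _ fun k _ =>
        ((cw _ _ _).mul (continuous_conj.comp (cw _ _ _))).mul (om_sm hφ).continuous
    · intro z hz; simp [zw hz]
    · exact continuous_finsetSum _ fun j _ => continuous_finsetSum _ fun k _ =>
        ((cd _).mul (continuous_conj.comp (cd _))).mul (om_sm hφ).continuous
    · intro z hz; simp [zd hz]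
  set S := fun z => ∑ j, ∑ k, ‖wD I (f j) k z - wD I (f k) j z‖ ^ 2 with hS
  set N := fun z => ∑ j, ‖Dm (Rc η) j z‖ ^ 2 with hN
  set V := fun z => ∑ j, ‖f j z‖ ^ 2 with hV
  have cS : Continuous S := continuous_finsetSum _ fun j _ => continuous_finsetSum _ fun k _ =>
    ((cw _ _ _).sub (cw _ _ _)).norm.pow 2
  have cN : Continuous N := continuous_finsetSum _ fun j _ => (cη j).norm.pow 2
  have cV : Continuous V := continuous_finsetSum _ fun j _ => (cf j).norm.pow 2
  have I1 : Integrable fun z => ‖tau φ η f z‖ ^ 2 * ex (-φ z) :=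
    hint ((ct.norm.pow 2).mul hom) fun z hz => by simp [tau, zd hz, z0 hz]
  have I2 : Integrable fun z => S z * ex (-φ z) := hint (cS.mul hom) fun z hz => by simp [hS, zw hz]
  have I3 : Integrable fun z => N z * V z * ex (-φ z) :=
    hint ((cN.mul cV).mul hom) fun z hz => by simp [hV, z0 hz]
  have I4 : Integrable fun z => Lf φ z (fun j => f j z) * ex (-φ z) :=
    hint (cL.mul hom) fun z hz => by simp [Lf, z0 hz]
  have cC : Continuous fun z => (∑ j, ∑ k, wD I (f j) k z * stC (wD I (f k) j z)).re :=
    continuous_re.comp (continuous_finsetSum _ fun j _ => continuous_finsetSum _ fun k _ =>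
        ((cw _ _ _).mul (continuous_conj.comp (cw _ _ _))))
  have I5 : Integrable fun z => (∑ j, ∑ k, wD I (f j) k z * stC (wD I (f k) j z)).re * ex (-φ z) :=
    hint (cC.mul hom) fun z hz => by simp [zw hz]
  have I6 : Integrable fun z => ‖∑ j, dl φ (f j) j z‖ ^ 2 * ex (-φ z) :=
    hint (((continuous_finsetSum _ fun j _ => cd j).norm.pow 2).mul hom) fun z hz => by simp [zd hz]
  have hA : ∫ z, ‖∑ j, dl φ (f j) j z‖ ^ 2 * ex (-φ z) ≤
      2 * (∫ z, ‖tau φ η f z‖ ^ 2 * ex (-φ z)) + 2 * ∫ z, N z * V z * ex (-φ z) := by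
    rw [← integral_const_mul, ← integral_const_mul, ← integral_add (I1.const_mul 2) (I3.const_mul 2)]
    refine integral_mono I6 ((I1.const_mul 2).add (I3.const_mul 2)) fun z => ?_
    have e : ∑ j, dl φ (f j) j z = tau φ η f z - ∑ j, Dm (Rc η) j z * f j z := by
      simp [tau, Finset.sum_add_distrib]
    have h1 := sumsq_cs (fun j => Dm (Rc η) j z) (fun j => f j z)
    have h2 := norm_sub_le (tau φ η f z) (∑ j, Dm (Rc η) j z * f j z)
    simp only
    rw [e]
    have h3 : ‖tau φ η f z - ∑ j, Dm (Rc η) j z * f j z‖ ^ 2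
        ≤ 2 * ‖tau φ η f z‖ ^ 2 + 2 * (N z * V z) := by
      simp only [hN, hV]
      nlinarith [norm_nonneg (tau φ η f z - ∑ j, Dm (Rc η) j z * f j z),
        sq_nonneg (‖tau φ η f z‖ - ‖∑ j, Dm (Rc η) j z * f j z‖)]
    nlinarith [Real.exp_pos (-φ z)]
  have hB : -(1/2) * ∫ z, S z * ex (-φ z) ≤
      ∫ z, (∑ j, ∑ k, wD I (f j) k z * stC (wD I (f k) j z)).re * ex (-φ z) := by
    rw [← integral_const_mul]
    refine integral_mono (I2.const_mul _) I5 fun z => ?_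
    simp only
    rw [cross_ident (fun j k => wD I (f j) k z)]
    have h1 : 0 ≤ ∑ j, ∑ k, ‖wD I (f j) k z‖ ^ 2 :=
      Finset.sum_nonneg fun j _ => Finset.sum_nonneg fun k _ => sq_nonneg _
    simp only [hS]
    nlinarith [Real.exp_pos (-φ z)]
  have e0 : ∫ z, (Lf φ z (fun j => f j z) - 2 * N z * V z) * ex (-φ z)
      = (∫ z, Lf φ z (fun j => f j z) * ex (-φ z)) - 2 * ∫ z, N z * V z * ex (-φ z) := by
    rw [← integral_const_mul, ← integral_sub I4 (I3.const_mul 2)]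
    congr 1; funext z; ring
  rw [e0]
  linarith

def L2T (F : ℝ → Cv n → ℂ) (G : Cv n → ℂ) : Prop :=
  MemLp G 2 ∧ (∀ᶠ ε in 𝓝[>] (0:ℝ), MemLp (F ε) 2) ∧
    Tendsto (fun ε => eLpNorm (fun z => F ε z - G z) 2 volume) (𝓝[>] 0) (𝓝 0)

lemma L2T.congr {F F' : ℝ → Cv n → ℂ} {G : Cv n → ℂ} (h : L2T F G)
    (he : ∀ᶠ ε in 𝓝[>] (0:ℝ), F ε = F' ε) : L2T F' G :=
  ⟨h.1, by filter_upwards [h.2.1, he] with ε h1 h2 using h2 ▸ h1,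
    h.2.2.congr' (by filter_upwards [he] with ε h2; rw [h2])⟩

lemma L2T.add {F F' : ℝ → Cv n → ℂ} {G G' : Cv n → ℂ} (h : L2T F G) (h' : L2T F' G') :
    L2T (fun ε z => F ε z + F' ε z) (fun z => G z + G' z) := by
  refine ⟨h.1.add h'.1, by filter_upwards [h.2.1, h'.2.1] with ε h1 h2 using h1.add h2, ?_⟩
  have h0 := h.2.2.add h'.2.2
  rw [add_zero] at h0
  refine tendsto_of_tendsto_of_tendsto_of_le_of_le' tendsto_const_nhds h0 (Eventually.of_forall fun _ => zero_le) ?_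
  filter_upwards [h.2.1, h'.2.1] with ε h1 h2
  refine le_trans (le_of_eq ?_) (eLpNorm_add_le (h1.1.sub h.1.1) (h2.1.sub h'.1.1) (by norm_num))
  congr 1; funext z; simp only [Pi.add_apply, Pi.sub_apply]; ring

lemma L2T.zero : L2T (fun _ _ => 0 : ℝ → Cv n → ℂ) (fun _ => 0) :=
  ⟨MemLp.zero', Eventually.of_forall fun _ => MemLp.zero', by simp⟩

lemma L2T.sum {ι : Type*} (S : Finset ι) {F : ι → ℝ → Cv n → ℂ} {G : ι → Cv n → ℂ}
    (h : ∀ i, L2T (F i) (G i)) : L2T (fun ε z => ∑ i ∈ S, F i ε z) (fun z => ∑ i ∈ S, G i z) := by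
  classical
  induction S using Finset.induction_on with
  | empty => simpa using L2T.zero
  | insert i S hi ih => simp only [Finset.sum_insert hi]; exact (h i).add ih

lemma L2T.mul {F : ℝ → Cv n → ℂ} {G : Cv n → ℂ} (h : L2T F G) {K : Set (Cv n)}
    (hK : IsCompact K) {W : Cv n → ℂ} (hW : Continuous W)
    (hF : ∀ᶠ ε in 𝓝[>] (0:ℝ), ∀ z ∉ K, F ε z = 0) (hG : ∀ z ∉ K, G z = 0) :
    L2T (fun ε z => W z * F ε z) (fun z => W z * G z) := by
  obtain ⟨C, hC⟩ := hK.exists_bound_of_continuousOn hW.continuousOn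
  have hC' : ∀ z ∈ K, ‖W z‖ ≤ |C| := fun z hz => (hC z hz).trans (le_abs_self C)
  have bd : ∀ (P : Cv n → ℂ), (∀ z ∉ K, P z = 0) → ∀ z, ‖W z * P z‖ ≤ |C| * ‖P z‖ := by
    intro P hP z
    rw [norm_mul]
    by_cases hz : z ∈ K
    · exact mul_le_mul_of_nonneg_right (hC' z hz) (norm_nonneg _)
    · simp [hP z hz]
  have mem : ∀ (P : Cv n → ℂ), (∀ z ∉ K, P z = 0) → MemLp P 2 → MemLp (fun z => W z * P z) 2 :=
    fun P hP hm => hm.of_le_mul (c := |C|) (hW.aestronglyMeasurable.mul hm.1) (Eventually.of_forall (bd P hP))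
  refine ⟨mem G hG h.1, by filter_upwards [h.2.1, hF] with ε h1 h2 using mem _ h2 h1, ?_⟩
  have h0 := ENNReal.Tendsto.const_mul (a := oR |C|) h.2.2 (Or.inr ENNReal.ofReal_ne_top)
  rw [mul_zero] at h0
  refine tendsto_of_tendsto_of_tendsto_of_le_of_le' tendsto_const_nhds h0 (Eventually.of_forall fun _ => zero_le) ?_
  filter_upwards [h.2.1, hF] with ε h1 h2
  refine eLpNorm_le_mul_eLpNorm_of_ae_le_mul (Eventually.of_forall fun z => ?_) 2
  have := bd (fun z => F ε z - G z) (fun z hz => by simp [h2 z hz, hG z hz]) z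
  rwa [mul_sub] at this

lemma L2_inner_eq {F G : Cv n → ℂ} (hF : MemLp F 2) (hG : MemLp G 2) :
    inner ℂ (hG.toLp G) (hF.toLp F) = ∫ z, F z * stC (G z) := by
  rw [L2.inner_def]
  refine integral_congr_ae ?_
  filter_upwards [hF.coeFn_toLp, hG.coeFn_toLp] with z h1 h2
  rw [h1, h2]; simp

lemma L2_mul_int {F G : Cv n → ℂ} (hF : MemLp F 2) (hG : MemLp G 2) :
    Integrable fun z => F z * stC (G z) := hF.integrable_mul hG.star

lemma L2T.inner {F F' : ℝ → Cv n → ℂ} {G G' : Cv n → ℂ} (h : L2T F G) (h' : L2T F' G') :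
    Tendsto (fun ε => ∫ z, F ε z * stC (F' ε z)) (𝓝[>] 0) (𝓝 (∫ z, G z * stC (G' z))) := by
  classical
  have key : ∀ {F : ℝ → Cv n → ℂ} {G : Cv n → ℂ} (h : L2T F G),
      Tendsto (fun ε => if hm : MemLp (F ε) 2 then hm.toLp (F ε) else 0) (𝓝[>] 0) (𝓝 (h.1.toLp G)) := by
    intro F G h
    rw [tendsto_iff_edist_tendsto_0]
    refine h.2.2.congr' ?_
    filter_upwards [h.2.1] with ε h1
    rw [dif_pos h1, Lp.edist_toLp_toLp]; rfl
  have := (key h').inner (𝕜 := ℂ) (key h)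
  rw [L2_inner_eq h.1 h'.1] at this
  refine this.congr' ?_
  filter_upwards [h.2.1, h'.2.1] with ε h1 h2
  rw [dif_pos h1, dif_pos h2, L2_inner_eq h1 h2]

lemma L2T.re_sum {ι : Type*} (S : Finset ι) {F F' : ι → ℝ → Cv n → ℂ} {G G' : ι → Cv n → ℂ}
    (h : ∀ i, L2T (F i) (G i)) (h' : ∀ i, L2T (F' i) (G' i)) :
    Tendsto (fun ε => ∫ z, (∑ i ∈ S, F i ε z * stC (F' i ε z)).re) (𝓝[>] 0)
      (𝓝 (∫ z, (∑ i ∈ S, G i z * stC (G' i z)).re)) := by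
  have e : ∀ {P P' : ι → Cv n → ℂ}, (∀ i ∈ S, MemLp (P i) 2) → (∀ i ∈ S, MemLp (P' i) 2) →
      ∫ z, (∑ i ∈ S, P i z * stC (P' i z)).re = (∑ i ∈ S, ∫ z, P i z * stC (P' i z)).re := by
    intro P P' hP hP'
    have h1 : ∀ i ∈ S, Integrable fun z => P i z * stC (P' i z) := fun i hi => L2_mul_int (hP i hi) (hP' i hi)
    rw [← integral_finsetSum _ h1]
    exact integral_re (integrable_finsetSum _ h1)
  rw [e (fun i _ => (h i).1) (fun i _ => (h' i).1)]
  have h1 := (continuous_re.tendsto _).comp (tendsto_finsetSum S fun i _ => (h i).inner (h' i))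
  refine h1.congr' ?_
  have a1 : ∀ᶠ ε in 𝓝[>] (0:ℝ), ∀ i ∈ S, MemLp (F i ε) 2 := (S.eventually_all).2 fun i _ => (h i).2.1
  have a2 : ∀ᶠ ε in 𝓝[>] (0:ℝ), ∀ i ∈ S, MemLp (F' i ε) 2 := (S.eventually_all).2 fun i _ => (h' i).2.1
  filter_upwards [a1, a2] with ε h2 h3
  rw [e h2 h3]; rfl

lemma moll_L2T {F : Cv n → ℂ} (hF : MemLp F 2) : L2T (fun ε => moll ε F) F := by
  refine ⟨hF, ?_, moll_L2 hF⟩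
  have hFl : LocallyIntegrable F := hF.locallyIntegrable (by norm_num)
  filter_upwards [self_mem_nhdsWithin] with ε hε
  refine ⟨(moll_sm hε hFl).continuous.aestronglyMeasurable, ?_⟩
  rw [eLpNorm_lt_top_iff_lintegral_rpow_enorm_lt_top (by simp) (by simp)]
  have h2 := (eLpNorm_lt_top_iff_lintegral_rpow_enorm_lt_top (by simp) (by simp)).1 hF.2
  simp only [ENNReal.toReal_ofNat, ENNReal.rpow_ofNat] at h2 ⊢
  exact (moll_L2_le hε hF.1).trans_lt h2

lemma moll_off {F : Cv n → ℂ} {K : Set (Cv n)} (hF : ∀ z ∉ K, F z = 0) {ε : ℝ} (hε : 0 < ε)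
    (hε1 : ε ≤ 1) : ∀ z ∉ Metric.cthickening 1 K, moll ε F z = 0 := by
  intro z hz
  have : ∀ y, F y * (mol ε (z - y) : ℂ) = 0 := by
    intro y
    by_cases hy : y ∈ K
    · rw [mol_zero hε, ofReal_zero, mul_zero]
      intro h
      rw [mem_closedBall_zero_iff] at h
      exact hz (Metric.mem_cthickening_of_dist_le z y 1 K hy (by rw [dist_eq_norm]; linarith))
    · rw [hF y hy, zero_mul]
  simp [moll, this]

lemma basic_est_weak {φ η : Cv n → ℝ} (hφ : ContDiff ℝ Tt φ) (hη : ContDiff ℝ Tt η)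
    {K : Set (Cv n)} (hK : IsCompact K)
    {v : Fin n → Cv n → ℂ} (hv : ∀ j, MemLp (v j) 2) (hvK : ∀ j, ∀ z ∉ K, v j z = 0)
    {c : Fin n → Fin n → Cv n → ℂ} (hc : ∀ j k, MemLp (c j k) 2) (hcK : ∀ j k, ∀ z ∉ K, c j k z = 0)
    {d : Cv n → ℂ} (hd : MemLp d 2) (hdK : ∀ z ∉ K, d z = 0)
    (wc : ∀ h, Tst Set.univ h → ∀ j k, ∫ z, (v j z * wD I h k z - v k z * wD I h j z) = - ∫ z, c j k z * h z)
    (wd : ∀ h, Tst Set.univ h → ∫ z, ∑ j, v j z * Dm h j z = - ∫ z, d z * h z) :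
    ∫ z, (Lf φ z (fun j => v j z) - 2 * (∑ j, ‖Dm (Rc η) j z‖ ^ 2)
        * ∑ j, ‖v j z‖ ^ 2) * ex (-φ z)
      ≤ 2 * (∫ z, ‖d z + ∑ j, (Dm (Rc η) j z - Dm (Rc φ) j z) * v j z‖ ^ 2 * ex (-φ z))
        + 1/2 * ∫ z, (∑ j, ∑ k, ‖c j k z‖ ^ 2) * ex (-φ z) := by
  classical
  set K1 := Metric.cthickening 1 K
  have hK1 : IsCompact K1 := hK.cthickening
  have hKK : K ⊆ K1 := Metric.self_subset_cthickening K
  have hvl : ∀ j, LocallyIntegrable (v j) := fun j => (hv j).locallyIntegrable (by norm_num)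
  have hev : ∀ᶠ ε : ℝ in 𝓝[>] 0, 0 < ε ∧ ε ≤ 1 := by
    filter_upwards [self_mem_nhdsWithin,
      nhdsWithin_le_nhds (gt_mem_nhds (zero_lt_one' ℝ))] with ε h1 h3 using ⟨h1, h3.le⟩
  have off : ∀ {F : Cv n → ℂ}, (∀ z ∉ K, F z = 0) → ∀ᶠ ε : ℝ in 𝓝[>] 0, ∀ z ∉ K1, moll ε F z = 0 := by
    intro F hF
    filter_upwards [hev] with ε ⟨h1, h2⟩ using moll_off hF h1 h2
  have off1 : ∀ {F : Cv n → ℂ}, (∀ z ∉ K, F z = 0) → ∀ z ∉ K1, F z = 0 :=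
    fun hF z hz => hF z fun h => hz (hKK h)
  have i1 : ∀ {ε : ℝ}, 0 < ε → ∀ z s j k, Integrable fun y => v j y * wD s (fun y => molC ε (z - y)) k y := by
    intro ε hε z s j k
    have ht := molC_tst hε (D := Set.univ) (z := z) (Set.subset_univ _)
    have := (hvl j).integrable_smul_left_of_hasCompactSupport (Sm.wD ht.1 s k).continuous (hcs_wD ht.2.1)
    simpa [mul_comm] using this
  have app : ∀ᶠ ε : ℝ in 𝓝[>] 0, 
      ∫ z, (Lf φ z (fun j => moll ε (v j) z) - 2 * (∑ j, ‖Dm (Rc η) j z‖ ^ 2)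
        * ∑ j, ‖moll ε (v j) z‖ ^ 2) * ex (-φ z)
      ≤ 2 * (∫ z, ‖moll ε d z + ∑ j, (Dm (Rc η) j z - Dm (Rc φ) j z) * moll ε (v j) z‖ ^ 2 * ex (-φ z))
        + 1/2 * ∫ z, (∑ j, ∑ k, ‖moll ε (c j k) z‖ ^ 2) * ex (-φ z) := by
    filter_upwards [hev] with ε ⟨h1, h2⟩
    have hcs : ∀ j, HasCompactSupport (moll ε (v j)) := fun j =>
      HasCompactSupport.intro hK1 (moll_off (hvK j) h1 h2)
    have := basic_est hφ hη (f := fun j => moll ε (v j)) (fun j => moll_sm h1 (hvl j)) hcs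
    have ec : ∀ j k z, wD I (moll ε (v j)) k z - wD I (moll ε (v k)) j z = moll ε (c j k) z := by
      intro j k z
      rw [moll_wD h1 (hvl j), moll_wD h1 (hvl k)]
      have := wc _ (molC_tst h1 (z := z) (Set.subset_univ _)) j k
      rw [integral_sub (i1 h1 z _ _ _) (i1 h1 z _ _ _)] at this
      simp only [moll]
      simp only [molC] at this ⊢
      linear_combination -this
    have et : ∀ z, tau φ η (fun j => moll ε (v j)) z = moll ε d z + ∑ j, (Dm (Rc η) j z - Dm (Rc φ) j z) * moll ε (v j) z := by
      intro z
      have e1 : ∑ j, Dm (moll ε (v j)) j z = moll ε d z := by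
        simp only [moll_wD h1 (hvl _)]
        have := wd _ (molC_tst h1 (z := z) (Set.subset_univ _))
        rw [integral_finsetSum _ (fun j _ => i1 h1 z _ _ _)] at this
        rw [Finset.sum_neg_distrib, this, neg_neg]; rfl
      rw [← e1, ← Finset.sum_add_distrib, tau]
      refine Finset.sum_congr rfl fun j _ => ?_
      simp only [dl]; ring
    simp only [ec, et] at this
    exact this
  have cφ : ∀ j, Continuous (Dm (Rc φ) j) := fun j => (Sm.wD (phiC hφ) _ j).continuous
  have cη : ∀ j, Continuous (Dm (Rc η) j) := fun j => (Sm.wD (phiC hη) _ j).continuous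
  have cH : ∀ j k, Continuous (fun z => cHessian φ z j k) := fun j k => by
    simp only [cHessian_apply]; exact (Sm.wD (Sm.wD (phiC hφ) _ _) _ _).continuous
  have com : Continuous (om φ) := (om_sm hφ).continuous
  set N := fun z => ∑ j, ‖Dm (Rc η) j z‖ ^ 2 with hN
  have cN : Continuous N := continuous_finsetSum _ fun j _ => (cη j).norm.pow 2
  set Mt := fun (p : Fin n × Fin n) z => (cHessian φ z p.1 p.2 - if p.1 = p.2 then (2 * N z : ℂ) else 0) * om φ z with hMt
  have cM : ∀ p, Continuous (Mt p) := by
    intro p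
    refine Continuous.mul ((cH _ _).sub ?_) com
    split_ifs
    · exact continuous_const.mul (continuous_ofReal.comp cN)
    · exact continuous_const
  have nsq : ∀ a : ℂ, ((‖a‖ ^ 2 : ℝ) : ℂ) = a * stC a := fun a => by
    rw [Complex.mul_conj', ofReal_pow]
  have eL : ∀ (w : Fin n → Cv n → ℂ) z, (Lf φ z (fun j => w j z) - 2 * N z * ∑ j, ‖w j z‖ ^ 2) * ex (-φ z)
      = (∑ p ∈ (Finset.univ : Finset (Fin n × Fin n)), (Mt p z * w p.1 z) * stC (w p.2 z)).re := by
    intro w z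
    have : (∑ p : Fin n × Fin n, (Mt p z * w p.1 z) * stC (w p.2 z))
        = ((∑ j, ∑ k, cHessian φ z j k * w j z * stC (w k z)) - ((2 * N z * ∑ j, ‖w j z‖ ^ 2 : ℝ) : ℂ)) * ((ex (-φ z) : ℝ) : ℂ) := by
      rw [← om_eq, Fintype.sum_prod_type]
      push_cast
      simp only [← ofReal_pow, nsq, hMt, sub_mul, Finset.sum_sub_distrib, ite_mul, zero_mul, Finset.sum_ite_eq,
        Finset.mem_univ, if_true, Finset.sum_mul, Finset.mul_sum]
      congr 1
      · exact Finset.sum_congr rfl fun j _ => Finset.sum_congr rfl fun k _ => by ring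
      · exact Finset.sum_congr rfl fun j _ => by ring
    rw [this, re_mul_ofReal, sub_re, ofReal_re, Lf]
  have T1 : Tendsto (fun ε => ∫ z, (Lf φ z (fun j => moll ε (v j) z) - 2 * N z * ∑ j, ‖moll ε (v j) z‖ ^ 2) * ex (-φ z))
      (𝓝[>] 0) (𝓝 (∫ z, (Lf φ z (fun j => v j z) - 2 * N z * ∑ j, ‖v j z‖ ^ 2) * ex (-φ z))) := by
    simp only [eL v, fun ε => eL (fun j => moll ε (v j))]
    exact L2T.re_sum Finset.univ (fun p => (moll_L2T (hv p.1)).mul hK1 (cM p) (off (hvK _)) (off1 (hvK _)))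
      (fun p => moll_L2T (hv p.2))
  have eR : ∀ (a : Cv n → ℂ) z, ‖a z‖ ^ 2 * ex (-φ z)
      = (∑ i ∈ (Finset.univ : Finset (Fin 1)), (om φ z * a z) * stC (a z)).re := by
    intro a z
    simp only [Finset.univ_unique, Finset.sum_singleton]
    rw [mul_assoc, ← nsq, om_eq, ← ofReal_mul, ofReal_re, mul_comm]
  have offm : ∀ j (W : Cv n → ℂ), ∀ᶠ ε : ℝ in 𝓝[>] 0, ∀ z ∉ K1, W z * moll ε (v j) z = 0 := by
    intro j W
    filter_upwards [off (hvK j)] with ε h z hz; rw [h z hz, mul_zero]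
  have T2 : Tendsto (fun ε => ∫ z, ‖moll ε d z + ∑ j, (Dm (Rc η) j z - Dm (Rc φ) j z) * moll ε (v j) z‖ ^ 2 * ex (-φ z))
      (𝓝[>] 0) (𝓝 (∫ z, ‖d z + ∑ j, (Dm (Rc η) j z - Dm (Rc φ) j z) * v j z‖ ^ 2 * ex (-φ z))) := by
    have hL : L2T (fun ε z => moll ε d z + ∑ j, (Dm (Rc η) j z - Dm (Rc φ) j z) * moll ε (v j) z)
        (fun z => d z + ∑ j, (Dm (Rc η) j z - Dm (Rc φ) j z) * v j z) :=
      (moll_L2T hd).add (L2T.sum Finset.univ fun j => (moll_L2T (hv j)).mul hK1 ((cη j).sub (cφ j)) (off (hvK j)) (off1 (hvK j)))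
    simp only [eR (fun z => d z + ∑ j, (Dm (Rc η) j z - Dm (Rc φ) j z) * v j z),
      fun ε => eR (fun z => moll ε d z + ∑ j, (Dm (Rc η) j z - Dm (Rc φ) j z) * moll ε (v j) z)]
    refine L2T.re_sum Finset.univ (fun _ => hL.mul hK1 com ?_ ?_) fun _ => hL
    · filter_upwards [off hdK, eventually_all.2 fun j => off (hvK j)] with ε h1 h2 z hz
      simp [h1 z hz, h2 _ z hz]
    · intro z hz; simp [off1 hdK z hz, off1 (hvK _) z hz]
  have eC : ∀ (a : Fin n → Fin n → Cv n → ℂ) z, (∑ j, ∑ k, ‖a j k z‖ ^ 2) * ex (-φ z)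
      = (∑ p ∈ (Finset.univ : Finset (Fin n × Fin n)), (om φ z * a p.1 p.2 z) * stC (a p.1 p.2 z)).re := by
    intro a z
    simp only [mul_assoc, ← nsq]
    rw [← Finset.mul_sum, om_eq, ← ofReal_sum, ← ofReal_mul, ofReal_re, mul_comm, Fintype.sum_prod_type]
  have T3 : Tendsto (fun ε => ∫ z, (∑ j, ∑ k, ‖moll ε (c j k) z‖ ^ 2) * ex (-φ z))
      (𝓝[>] 0) (𝓝 (∫ z, (∑ j, ∑ k, ‖c j k z‖ ^ 2) * ex (-φ z))) := by
    simp only [eC c, fun ε => eC (fun j k => moll ε (c j k))]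
    exact L2T.re_sum Finset.univ (fun p => (moll_L2T (hc p.1 p.2)).mul hK1 com (off (hcK _ _)) (off1 (hcK _ _)))
      (fun p => moll_L2T (hc p.1 p.2))
  exact le_of_tendsto_of_tendsto T1 ((T2.const_mul 2).add (T3.const_mul (1/2))) app

section P4b
variable {D : Set (Cv n)}

lemma Tst.smul (hD : IsOpen D) {c h : Cv n → ℂ} (hc : ContDiffOn ℝ Tt c D) (hh : Tst D h) :
    Tst D (fun z => c z * h z) := by
  refine ⟨contDiff_iff_contDiffAt.2 fun z => ?_, hh.2.1.mul_left, (tsupport_mul_subset_right).trans hh.2.2⟩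
  by_cases hz : z ∈ D
  · exact (hc.contDiffAt (hD.mem_nhds hz)).mul hh.1.contDiffAt
  · have h0 : h =ᶠ[𝓝 z] 0 := notMem_tsupport_iff_eventuallyEq.1 fun h => hz (hh.2.2 h)
    refine (contDiffAt_const (c := (0:ℂ))).congr_of_eventuallyEq ?_
    filter_upwards [h0] with x hx; simp [hx]

lemma Tst.memLp {h : Cv n → ℂ} (hh : Tst D h) : MemLp h 2 :=
  hh.1.continuous.memLp_of_hasCompactSupport hh.2.1

lemma Tst.conj {h : Cv n → ℂ} (hh : Tst D h) : Tst D (fun z => stC (h z)) :=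
  ⟨conj_sm hh.1, hh.2.1.comp_left (map_zero _), (closure_mono (fun z hz => by
    simp only [Function.mem_support] at hz ⊢; intro h0; simp [h0] at hz)).trans hh.2.2⟩

lemma Tst.mulL2 {h F : Cv n → ℂ} (hh : Tst D h) (hF : MemLp F 2) : MemLp (fun z => h z * F z) 2 := by
  obtain ⟨C, hC⟩ := hh.2.1.exists_bound_of_continuous hh.1.continuous
  refine hF.of_le_mul (c := C) (hh.1.continuous.aestronglyMeasurable.mul hF.1) (Eventually.of_forall fun z => ?_)
  rw [norm_mul]; exact mul_le_mul_of_nonneg_right (hC z) (norm_nonneg _)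

lemma expC {φ : Cv n → ℝ} (hθ : ContDiffOn ℝ Tt φ D) (c : ℝ) :
    ContDiffOn ℝ Tt (fun z => ((ex (c * φ z) : ℝ) : ℂ)) D :=
  ofRealCLM.contDiff.comp_contDiffOn (contDiffOn_const.mul hθ).exp

lemma cutoff (hD : IsOpen D) {K : Set (Cv n)} (hK : IsCompact K) (hKD : K ⊆ D) :
    ∃ χ : Cv n → ℝ, ContDiff ℝ Tt χ ∧ HasCompactSupport χ ∧ tsupport χ ⊆ D ∧
      (∀ z, χ z ∈ Set.Icc 0 1) ∧ ∃ U, IsOpen U ∧ K ⊆ U ∧ U ⊆ D ∧ ∀ z ∈ U, χ z = 1 := by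
  obtain ⟨L, hL, hKL, hLD⟩ := exists_compact_between hK hD hKD
  obtain ⟨M, hM, hLM, hMD⟩ := exists_compact_between hL hD hLD
  obtain ⟨f, h0, h1, h2⟩ := exists_contMDiffMap_zero_one_of_isClosed (n := Tt)
    (modelWithCornersSelf ℝ (Cv n))
    (isOpen_interior (s := M)).isClosed_compl hL.isClosed
    (Set.disjoint_left.2 fun x hx hx' => hx (hLM hx'))
  have hs : tsupport f ⊆ M := closure_minimal (fun x hx => by
    by_contra h; exact hx (h0 fun h' => h (interior_subset h'))) hM.isClosed
  exact ⟨f, f.contMDiff.contDiff, hM.of_isClosed_subset (isClosed_tsupport _) hs, hs.trans hMD, h2,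
    interior L, isOpen_interior, hKL, interior_subset.trans hLD, fun z hz => h1 (interior_subset hz)⟩

lemma ofReal_tst {χ : Cv n → ℝ} (h1 : ContDiff ℝ Tt χ) (h2 : HasCompactSupport χ) (h3 : tsupport χ ⊆ D) :
    Tst D (Rc χ) :=
  ⟨ofRealCLM.contDiff.comp h1, h2.comp_left ofReal_zero, (closure_mono (fun z hz => by
    simp only [Function.mem_support] at hz ⊢; intro h0; simp [h0] at hz)).trans h3⟩

lemma extend (hD : IsOpen D) {K : Set (Cv n)} (hK : IsCompact K) (hKD : K ⊆ D) {φ : Cv n → ℝ}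
    (hφ : ContDiffOn ℝ Tt φ D) : ∃ φ', ContDiff ℝ Tt φ' ∧ ∃ U, IsOpen U ∧ K ⊆ U ∧ ∀ z ∈ U, φ' z = φ z := by
  obtain ⟨χ, h1, h2, h3, -, U, hU, hKU, -, h4⟩ := cutoff hD hK hKD
  refine ⟨fun z => φ z * χ z, ?_, U, hU, hKU, fun z hz => by simp [h4 z hz]⟩
  have h := reCLM.contDiff.comp
    (Tst.smul hD (c := fun z => (φ z : ℂ)) (ofRealCLM.contDiff.comp_contDiffOn hφ) (ofReal_tst h1 h2 h3)).1
  convert h using 2 with z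
  simp [← ofReal_mul]

abbrev HH (n : ℕ) := PiLp 2 (fun _ : Fin n => Lp ℂ 2 (volume : Measure (Cv n)))

def VV (f : Fin n → Cv n → ℂ) (hf : ∀ j, MemLp (f j) 2) : HH n :=
  WithLp.toLp 2 (fun j => (hf j).toLp (f j))

lemma VV_inner {f g : Fin n → Cv n → ℂ} (hf : ∀ j, MemLp (f j) 2) (hg : ∀ j, MemLp (g j) 2) :
    inner ℂ (VV g hg) (VV f hf) = ∫ z, ∑ j, f j z * stC (g j z) := by
  rw [integral_finsetSum _ fun j _ => L2_mul_int (hf j) (hg j), PiLp.inner_apply]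
  exact Finset.sum_congr rfl fun j _ => L2_inner_eq (hf j) (hg j)

lemma VV_self (x : HH n) : VV (fun j => (x j : Cv n → ℂ)) (fun j => Lp.memLp _) = x := by
  ext1 j; exact Lp.toLp_coeFn (x j) (Lp.memLp _)

lemma sgl_sum (f : Cv n) (A B : ℂ) (j k : Fin n) : ∑ i, f i * stC ((if i = j then A else 0) - (if i = k then B else 0))
    = f j * stC A - f k * stC B := by
  simp [mul_sub, Finset.sum_sub_distrib, apply_ite stC]

lemma decomp (hD : IsOpen D) {θ : Cv n → ℝ} (hθ : ContDiffOn ℝ Tt θ D) {α : Fin n → Cv n → ℂ}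
    (hα : ∀ j, Tst D (α j)) : ∃ u : Fin n → Cv n → ℂ, (∀ j, MemLp (u j) 2) ∧
    (∀ h, Tst D h → ∀ j k, ∫ z, (u j z * (ex (1/2 * θ z) * wD I h k z) - u k z * (ex (1/2 * θ z) * wD I h j z)) = 0) ∧
    (∀ h, Tst D h → ∫ z, ∑ j, u j z * stC (ex (-1/2 * θ z) * wD I h j z)
      = ∫ z, ∑ j, (ex (-1/2 * θ z) * α j z) * stC (ex (-1/2 * θ z) * wD I h j z)) := by
  classical
  have e1 := expC hθ (1/2)
  have e2 := expC hθ (-1/2)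
  have A1 : ∀ {h}, Tst D h → ∀ k, Tst D (fun z => stC (ex (1/2 * θ z) * wD I h k z)) :=
    fun hh k => (Tst.smul hD e1 (Tst.wD hh I k)).conj
  have A2 : ∀ {h}, Tst D h → ∀ k, MemLp (fun z => ex (-1/2 * θ z) * wD I h k z) 2 :=
    fun hh k => (Tst.smul hD e2 (Tst.wD hh I k)).memLp
  let sf : (Cv n → ℂ) → Fin n → Fin n → Fin n → Cv n → ℂ := fun h j k i z =>
    (if i = j then stC (ex (1/2 * θ z) * wD I h k z) else 0)
      - (if i = k then stC (ex (1/2 * θ z) * wD I h j z) else 0)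
  have hsf : ∀ {h}, Tst D h → ∀ j k i, MemLp (sf h j k i) 2 := by
    intro h hh j k i
    refine MemLp.sub ?_ ?_
    · by_cases e : i = j
      · simp only [e, if_true]; exact (A1 hh k).memLp
      · simp only [e, if_false]; exact MemLp.zero'
    · by_cases e : i = k
      · simp only [e, if_true]; exact (A1 hh j).memLp
      · simp only [e, if_false]; exact MemLp.zero'
  let S : Submodule ℂ (HH n) := Submodule.span ℂ {x | ∃ (h : Cv n → ℂ) (hh : Tst D h) (j k : Fin n),
    x = VV (sf h j k) (hsf hh j k)}
  let K := S.topologicalClosure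
  haveI : CompleteSpace K := S.isClosed_topologicalClosure.completeSpace_coe
  have hα' : ∀ j, MemLp (fun z => ex (-1/2 * θ z) * α j z) 2 := fun j => (Tst.smul hD e2 (hα j)).memLp
  let a := VV _ hα'
  let w := K.starProjection a
  let x := a - w
  have hx : x ∈ Kᗮ := K.sub_starProjection_mem_orthogonal a
  have hw : w ∈ K := Submodule.starProjection_apply_mem K a
  refine ⟨fun j => x j, fun j => Lp.memLp _, fun h hh j k => ?_, fun h hh => ?_⟩
  · have h1 : inner ℂ (VV (sf h j k) (hsf hh j k)) x = 0 :=
      hx _ (S.le_topologicalClosure (Submodule.subset_span ⟨h, hh, j, k, rfl⟩))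
    rw [← VV_self x, VV_inner] at h1
    rw [← h1]
    refine integral_congr_ae (Eventually.of_forall fun z => ?_)
    simp only [sf, sgl_sum, conj_conj]
  · have h2 : inner ℂ (VV _ (A2 hh)) w = 0 := by
      have hz : VV _ (A2 hh) ∈ Sᗮ := by
        rw [Submodule.mem_orthogonal]
        intro y hy
        induction hy using Submodule.span_induction with
        | zero => simp
        | add a b _ _ ha hb => rw [inner_add_left, ha, hb, add_zero]
        | smul c a _ ha => rw [inner_smul_left, ha, mul_zero]
        | mem y hy =>
          obtain ⟨g, hg, j, k, rfl⟩ := hy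
          rw [VV_inner]
          have e : ∀ z, ∑ i, (ex (-1/2 * θ z) * wD I h i z) * stC (sf g j k i z)
              = wD I h j z * wD I g k z - wD I h k z * wD I g j z := by
            intro z
            simp only [sf, sgl_sum, conj_conj]
            have : ((ex (-1/2 * θ z) : ℝ) : ℂ) * (ex (1/2 * θ z) : ℝ) = 1 := by
              rw [← ofReal_mul, ← Real.exp_add]; simp; ring_nf; simp
            linear_combination (wD I h j z * wD I g k z - wD I h k z * wD I g j z) * this
          simp only [e]
          have i1 : ∀ a b, Integrable (fun z => wD I h a z * wD I g b z) := fun a b =>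
            Sm.integrable ((Sm.wD hh.1 I a).mul (Sm.wD hg.1 I b)) (hcs_wD hh.2.1).mul_right
          rw [integral_sub (i1 j k) (i1 k j), ibp hh.1 (Sm.wD hg.1 I k) hh.2.1, ibp hh.1 (Sm.wD hg.1 I j) hh.2.1]
          simp only [wD_comm (s := I) (t := I) (j := k) (k := j) hg.1.contDiffAt, sub_self]
      have : w ∈ Sᗮᗮ := by rw [Submodule.orthogonal_orthogonal_eq_closure]; exact hw
      exact this _ hz
    have h3 : inner ℂ (VV _ (A2 hh)) x = inner ℂ (VV _ (A2 hh)) a := by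
      rw [inner_sub_right, h2, sub_zero]
    rwa [← VV_self x, VV_inner, VV_inner] at h3

end P4b

section P4c
variable {D : Set (Cv n)}

lemma VV_norm {f : Fin n → Cv n → ℂ} (hf : ∀ j, MemLp (f j) 2) :
    ‖VV f hf‖ ^ 2 = ∫ z, ∑ j, ‖f j z‖ ^ 2 := by
  have h := VV_inner hf hf
  rw [inner_self_eq_norm_sq_to_K] at h
  have e : ∀ z, ∑ j, f j z * stC (f j z) = ((∑ j, ‖f j z‖ ^ 2 : ℝ) : ℂ) := fun z => by
    push_cast; exact Finset.sum_congr rfl fun j _ => mul_conj' _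
  simp only [e, integral_complex_ofReal] at h
  exact ofReal_injective (by simpa using h)

lemma sq_int {F : Cv n → ℂ} (hF : MemLp F 2) : Integrable fun z => ‖F z‖ ^ 2 := by
  have := hF.integrable_norm_pow (by norm_num)
  simpa using this

lemma wD_on (hD : IsOpen D) {f : Cv n → ℂ} (hf : ContDiffOn ℝ Tt f D) (s j) :
    ContDiffOn ℝ Tt (wD s f j) D := fun z hz =>
  (SmAt.wD (hf.contDiffAt (hD.mem_nhds hz)) s j).contDiffWithinAt

lemma Tst.mono {U : Set (Cv n)} (h : U ⊆ D) {f : Cv n → ℂ} (hf : Tst U f) : Tst D f :=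
  ⟨hf.1, hf.2.1, hf.2.2.trans h⟩

lemma Tst.off {f : Cv n → ℂ} (hf : Tst D f) {z} (hz : z ∉ D) : f z = 0 :=
  image_eq_zero_of_notMem_tsupport fun h => hz (hf.2.2 h)

lemma Tst.sub {f g : Cv n → ℂ} (hf : Tst D f) (hg : Tst D g) : Tst D (fun z => f z - g z) :=
  ⟨hf.1.sub hg.1, hf.2.1.sub hg.2.1, (tsupport_sub f g).trans (Set.union_subset hf.2.2 hg.2.2)⟩

lemma Tst.mulS {f g : Cv n → ℂ} (hf : Tst D f) (hg : Sm g) : Tst D (fun z => f z * g z) :=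
  ⟨hf.1.mul hg, hf.2.1.mul_right, (tsupport_mul_subset_left).trans hf.2.2⟩

lemma Tst.sum {ι : Type*} (S : Finset ι) {f : ι → Cv n → ℂ} (hf : ∀ i, Tst D (f i)) :
    Tst D (fun z => ∑ i ∈ S, f i z) := by
  classical
  induction S using Finset.induction_on with
  | empty => exact ⟨by simpa using contDiff_const, (HasCompactSupport.zero : HasCompactSupport (0 : Cv n → ℂ)), by simp [tsupport, Function.support]⟩
  | insert i S hi ih =>
    simp only [Finset.sum_insert hi]
    exact ⟨(hf i).1.add ih.1, (hf i).2.1.add ih.2.1, (tsupport_add _ _).trans (Set.union_subset (hf i).2.2 ih.2.2)⟩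

lemma cmulL2 {W F : Cv n → ℂ} {K : Set (Cv n)} (hW : Continuous W) (hK : IsCompact K) (hF : MemLp F 2)
    (h0 : ∀ z ∉ K, F z = 0) : MemLp (fun z => W z * F z) 2 := by
  have h : L2T (fun _ => F) F := ⟨hF, Eventually.of_forall fun _ => hF, by simp⟩
  exact (h.mul hK hW (Eventually.of_forall fun _ => h0) h0).1

lemma Lf_congr {φ φ' : Cv n → ℝ} {z} (h : φ' =ᶠ[𝓝 z] φ) (v) : Lf φ' z v = Lf φ z v := by
  have h' : (Rc φ') =ᶠ[𝓝 z] fun x => (φ x : ℂ) := h.fun_comp ofReal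
  simp only [Lf, cHessian_apply, wD_congr (wD_congr' h')]

lemma key_est (hD : IsOpen D) {φ η : Cv n → ℝ} (hφ : ContDiffOn ℝ Tt φ D)
    (hη : ContDiffOn ℝ Tt η D) {U : Set (Cv n)} (hU : IsOpen U) (hUD : U ⊆ D) (hηU : ∀ z ∈ U, η z = 0)
    {κ : Cv n → ℝ} (hκ : ∀ z, 0 ≤ κ z) (hκU : ∀ z ∉ U, κ z = 0)
    (hL : ∀ z ∈ D, ∀ v : Cv n, (κ z + 2 * ∑ j, ‖Dm (Rc η) j z‖ ^ 2) * ∑ j, ‖v j‖ ^ 2 ≤ Lf φ z v)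
    {ε : ℝ} (hε0 : 0 ≤ ε) {χ : Cv n → ℝ} (hχ : Tst D (Rc χ)) (hχU : ∀ z ∈ U, χ z = 1)
    (hχε : ∀ z ∈ D, ∑ j, ‖Dm (Rc χ) j z‖ ^ 2 ≤ ε * ex (η z))
    {α : Fin n → Cv n → ℂ} (hα : ∀ j, Tst U (α j)) {u : Fin n → Cv n → ℂ} (hu : ∀ j, MemLp (u j) 2)
    (hu1 : ∀ h, Tst D h → ∀ j k, ∫ z, (u j z * (ex (1/2 * (φ z - η z)) * wD I h k z)
      - u k z * (ex (1/2 * (φ z - η z)) * wD I h j z)) = 0)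
    (hu2 : ∀ h, Tst D h → ∫ z, ∑ j, u j z * stC (ex (-1/2 * (φ z - η z)) * wD I h j z)
      = ∫ z, ∑ j, (ex (-1/2 * (φ z - η z)) * α j z) * stC (ex (-1/2 * (φ z - η z)) * wD I h j z)) :
    ∫ z, κ z * ∑ j, ‖u j z‖ ^ 2 ≤ 4 * (∫ z, ‖∑ j, dl φ (α j) j z‖ ^ 2 * ex (-φ z)) + 6 * ε * ∫ z, ∑ j, ‖u j z‖ ^ 2 := by
  set K := tsupport (Rc χ) with hKdef
  have hK : IsCompact K := hχ.2.1
  have hKD : K ⊆ D := hχ.2.2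
  have hUK : U ⊆ K := fun z hz => subset_closure (by simp [hχU z hz])
  obtain ⟨φ', hφ', U1, hU1, hKU1, he1⟩ := extend hD hK hKD hφ
  obtain ⟨η', hη', U2, hU2, hKU2, he2⟩ := extend hD hK hKD hη
  have ev1 : ∀ z ∈ K, φ' =ᶠ[𝓝 z] φ := fun z hz => by
    filter_upwards [hU1.mem_nhds (hKU1 hz)] with x hx using he1 x hx
  have ev2 : ∀ z ∈ K, η' =ᶠ[𝓝 z] η := fun z hz => by
    filter_upwards [hU2.mem_nhds (hKU2 hz)] with x hx using he2 x hx
  have cv : ∀ {p q : Cv n → ℝ} {z}, p =ᶠ[𝓝 z] q → (Rc p) =ᶠ[𝓝 z] fun x => (q x : ℂ) :=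
    fun h => h.fun_comp ofReal
  have hθ := hφ.sub hη
  have hφD : ∀ z ∈ D, DifferentiableAt ℝ (Rc φ) z := fun z hz =>
    SmAt.diff (ofRealCLM.contDiff.contDiffAt.comp z (hφ.contDiffAt (hD.mem_nhds hz)))
  have hηD : ∀ z ∈ D, DifferentiableAt ℝ (Rc η) z := fun z hz =>
    SmAt.diff (ofRealCLM.contDiff.contDiffAt.comp z (hη.contDiffAt (hD.mem_nhds hz)))
  set θ : Cv n → ℝ := fun z => φ z - η z with hθdef
  have hθC : ContDiffOn ℝ Tt (Rc θ) D := ofRealCLM.contDiff.comp_contDiffOn hθ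
  have hθj : ∀ z ∈ D, ∀ s j, wD s (Rc θ) j z = wD s (Rc φ) j z - wD s (Rc η) j z := by
    intro z hz s j
    rw [← wD_sub (hφD z hz) (hηD z hz)]; simp [hθdef]
  have hηUj : ∀ z ∈ U, ∀ s j, wD s (Rc η) j z = 0 := fun z hz s j => by
    rw [wD_congr (g := fun _ => 0), wD_const]
    filter_upwards [hU.mem_nhds hz] with x hx; simp [hηU x hx]
  set E : Cv n → ℂ := fun z => ((ex (1/2 * θ z) : ℝ) : ℂ) with hE
  have hEs := expC hθ (1/2)
  have hP : Tst D (fun z => E z * χ z) := Tst.smul hD hEs hχ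
  have hQ : ∀ s j, Tst D (fun z => E z * wD s (Rc χ) j z) := fun s j => Tst.smul hD hEs (Tst.wD hχ s j)
  have hR : ∀ j, Tst D (fun z => Dm (Rc θ) j z * (E z * χ z)) :=
    fun j => Tst.smul hD (wD_on hD hθC _ _) hP
  set Y : Cv n → ℂ := fun z => ∑ j, dl φ (α j) j z with hY
  have hYT : Tst U Y := Tst.sum _ fun j => (Tst.wD (hα j) _ _).sub
    (Tst.smul hU ((wD_on hD (ofRealCLM.contDiff.comp_contDiffOn hφ) _ _).mono hUD) (hα j))
  have iu : ∀ {t : Cv n → ℂ}, Tst D t → ∀ j, Integrable (fun z => t z * u j z) :=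
    fun ht j => ht.memLp.integrable_mul (hu j)
  have off0 : ∀ {t : Cv n → ℂ} {z}, (∀ w ∉ K, t w = 0) → z ∉ K → ∀ x, t z * x = 0 := fun h hz x => by
    rw [h _ hz, zero_mul]
  have Koff : ∀ z ∉ K, (χ z : ℂ) = 0 := fun z hz => image_eq_zero_of_notMem_tsupport (f := fun z => (χ z : ℂ)) hz
  have Koff' : ∀ s j, ∀ z ∉ K, wD s (Rc χ) j z = 0 := fun s j z hz => wD_eq_zero_of_notMem hz
  have main := basic_est_weak hφ' hη' hK (v := fun j z => (E z * χ z) * u j z) (fun j => hP.mulL2 (hu j))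
    (fun j z hz => by simp [Koff z hz])
    (c := fun j k z => (E z * wD I (Rc χ) k z) * u j z - (E z * wD I (Rc χ) j z) * u k z)
    (fun j k => ((hQ I k).mulL2 (hu j)).sub ((hQ I j).mulL2 (hu k)))
    (fun j k z hz => by simp [Koff' _ _ z hz])
    (d := fun z => ∑ j, ((E z * Dm (Rc χ) j z) * u j z
      + (Dm (Rc θ) j z * (E z * χ z)) * u j z) + Y z)
    ((memLp_finsetSum _ fun j _ => ((hQ _ j).mulL2 (hu j)).add ((hR j).mulL2 (hu j))).add hYT.memLp)
    (fun z hz => by simp [Koff' _ _ z hz, Koff z hz, hYT.off (fun h => hz (hUK h))])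
    ?_ ?_
  · have hPU : ∀ z, κ z * ∑ j, ‖u j z‖ ^ 2 ≤ (Lf φ' z (fun j => (E z * χ z) * u j z) - 2 * (∑ j, ‖Dm (Rc η') j z‖ ^ 2)
        * ∑ j, ‖(E z * χ z) * u j z‖ ^ 2) * ex (-φ' z) := by
      intro z
      by_cases hz : z ∈ K
      · have h1 := hL z (hKD hz) (fun j => (E z * χ z) * u j z)
        rw [Lf_congr (ev1 z hz), he1 z (hKU1 hz)]
        simp only [wD_congr (cv (ev2 z hz))]
        have h2 : κ z * ∑ j, ‖u j z‖ ^ 2 = κ z * (∑ j, ‖(E z * χ z) * u j z‖ ^ 2) * ex (-φ z) := by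
          by_cases hzU : z ∈ U
          · have h3 : ‖E z * χ z‖ ^ 2 * ex (-φ z) = 1 := by
              rw [hχU z hzU, hE]
              simp only [ofReal_one, mul_one, norm_real, Real.norm_eq_abs, Real.abs_exp, hθdef, hηU z hzU]
              rw [← Real.exp_nat_mul, ← Real.exp_add]; simp
            simp only [norm_mul (E z * χ z), mul_pow, ← Finset.mul_sum]
            linear_combination -(κ z * ∑ j, ‖u j z‖ ^ 2) * h3
          · simp [hκU z hzU]
        rw [h2]
        refine mul_le_mul_of_nonneg_right ?_ (Real.exp_nonneg _)
        linarith
      · rw [hκU z (fun h => hz (hUK h)), Koff z hz]; simp [Lf]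
    have hvL : ∀ j, MemLp (fun z => (E z * χ z) * u j z) 2 := fun j => hP.mulL2 (hu j)
    have hv0 : ∀ j, ∀ z ∉ K, (E z * χ z) * u j z = 0 := fun j z hz => by simp [Koff z hz]
    have hint : Integrable fun z => (Lf φ' z (fun j => (E z * χ z) * u j z) - 2 * (∑ j, ‖Dm (Rc η') j z‖ ^ 2)
        * ∑ j, ‖(E z * χ z) * u j z‖ ^ 2) * ex (-φ' z) := by
      have i1 : Integrable fun z => ∑ j, ∑ k, (ex (-φ' z) * cHessian φ' z j k * ((E z * χ z) * u j z)) * stC ((E z * χ z) * u k z) :=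
        integrable_finsetSum _ fun j _ => integrable_finsetSum _ fun k _ => L2_mul_int (cmulL2 (by
          simp only [cHessian_apply]
          exact (continuous_ofReal.comp hφ'.continuous.neg.rexp).mul (Sm.wD (Sm.wD (phiC hφ') _ _) _ _).continuous) hK (hvL j) (hv0 j)) (hvL k)
      have i2 : Integrable fun z => ∑ j, ((ex (-φ' z) * (2 * ∑ j, ‖Dm (Rc η') j z‖ ^ 2) : ℝ) * ((E z * χ z) * u j z)) * stC ((E z * χ z) * u j z) :=
        integrable_finsetSum _ fun j _ => L2_mul_int (cmulL2 (continuous_ofReal.comp (hφ'.continuous.neg.rexp.mul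
          (continuous_const.mul (continuous_finsetSum _ fun j _ => (Sm.wD (phiC hη') (-I) j).continuous.norm.pow 2)))) hK (hvL j) (hv0 j)) (hvL j)
      refine (i1.re.sub i2.re).congr (Eventually.of_forall fun z => ?_)
      have a1 : ∑ j, ∑ k, (ex (-φ' z) * cHessian φ' z j k * ((E z * χ z) * u j z)) * stC ((E z * χ z) * u k z)
        = (ex (-φ' z) : ℝ) * ∑ j, ∑ k, cHessian φ' z j k * ((E z * χ z) * u j z) * stC ((E z * χ z) * u k z) := by
          simp only [Finset.mul_sum, mul_assoc]
      have a2 : ∑ j, ((ex (-φ' z) * (2 * ∑ j, ‖Dm (Rc η') j z‖ ^ 2) : ℝ) * ((E z * χ z) * u j z)) * stC ((E z * χ z) * u j z)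
        = ((ex (-φ' z) * (2 * ∑ j, ‖Dm (Rc η') j z‖ ^ 2) * ∑ j, ‖(E z * χ z) * u j z‖ ^ 2 : ℝ) : ℂ) := by
          rw [Finset.mul_sum (Finset.univ : Finset (Fin n)) (fun j => ‖(E z * χ z) * u j z‖ ^ 2), ofReal_sum]
          exact Finset.sum_congr rfl fun j _ => by rw [mul_assoc, mul_conj', ofReal_mul _ (‖_‖ ^ 2), ofReal_pow]
      simp only [RCLike.re_to_complex, a1, a2, Pi.sub_apply, re_ofReal_mul, ofReal_re, Lf]
      ring
    have hQn : ∀ z, ∀ s, (s = I ∨ s = -I) → (∑ j, ‖E z * wD s (Rc χ) j z‖ ^ 2) * ex (-φ' z) ≤ ε := by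
      intro z s hs
      by_cases hz : z ∈ K
      · have h1 := hχε z (hKD hz)
        have h2 : ∀ j, ‖wD s (Rc χ) j z‖ = ‖Dm (Rc χ) j z‖ := fun j => by
          rcases hs with rfl | rfl
          · rw [← RCLike.norm_conj, wD_ofReal, conj_I]
          · rfl
        have h3 : ‖E z‖ ^ 2 * ex (-φ' z) * ex (η z) = 1 := by
          rw [he1 z (hKU1 hz)]
          simp only [hE, norm_real, Real.norm_eq_abs, Real.abs_exp, hθdef]
          rw [← Real.exp_nat_mul, ← Real.exp_add, ← Real.exp_add, Real.exp_eq_one_iff]; push_cast; ring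
        simp only [norm_mul, mul_pow, ← Finset.mul_sum, h2]
        calc _ = (‖E z‖ ^ 2 * ex (-φ' z)) * ∑ j, ‖Dm (Rc χ) j z‖ ^ 2 := by ring
          _ ≤ (‖E z‖ ^ 2 * ex (-φ' z)) * (ε * ex (η z)) := mul_le_mul_of_nonneg_left h1 (by positivity)
          _ = ε := by linear_combination ε * h3
      · simp [Koff' _ _ z hz, hε0]
    have hN : Integrable fun z => ∑ j, ‖u j z‖ ^ 2 := integrable_finsetSum _ fun j _ => sq_int (hu j)
    have hT : Integrable fun z => ‖Y z‖ ^ 2 * ex (-φ z) := by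
      have := sq_int (Tst.smul hU ((expC hφ (-1/2)).mono hUD) hYT).memLp
      refine this.congr (Eventually.of_forall fun z => ?_)
      simp only [norm_mul, norm_real, Real.norm_eq_abs, Real.abs_exp, mul_pow]
      rw [← Real.exp_nat_mul, mul_comm]; congr 2; push_cast; ring
    have hb1 : ∫ z, ‖(∑ j, ((E z * Dm (Rc χ) j z) * u j z
      + (Dm (Rc θ) j z * (E z * χ z)) * u j z) + Y z) + ∑ j, (Dm (Rc η') j z - Dm (Rc φ') j z) * ((E z * χ z) * u j z)‖ ^ 2 * ex (-φ' z)
        ≤ ∫ z, (2 * ε * ∑ j, ‖u j z‖ ^ 2 + 2 * (‖Y z‖ ^ 2 * ex (-φ z))) := by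
      refine integral_mono_of_nonneg (Eventually.of_forall fun z => by positivity) ((hN.const_mul _).add (hT.const_mul _)) (Eventually.of_forall fun z => ?_)
      have a1 : (∑ j, ((E z * Dm (Rc χ) j z) * u j z
        + (Dm (Rc θ) j z * (E z * χ z)) * u j z) + Y z) + ∑ j, (Dm (Rc η') j z - Dm (Rc φ') j z) * ((E z * χ z) * u j z)
          = (∑ j, (E z * Dm (Rc χ) j z) * u j z) + Y z := by
        rw [add_right_comm, ← Finset.sum_add_distrib]
        congr 1
        refine Finset.sum_congr rfl fun j _ => ?_
        by_cases hz : z ∈ K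
        · rw [wD_congr (cv (ev1 z hz)), wD_congr (cv (ev2 z hz)), hθj z (hKD hz)]; ring
        · rw [Koff z hz]; ring
      have a2 : ‖Y z‖ ^ 2 * ex (-φ' z) = ‖Y z‖ ^ 2 * ex (-φ z) := by
        by_cases hz : z ∈ K
        · rw [he1 z (hKU1 hz)]
        · rw [hYT.off (fun h => hz (hUK h))]; simp
      have a3 := sumsq_cs (fun j => E z * Dm (Rc χ) j z) (fun j => u j z)
      have a4 := hQn z (-I) (Or.inr rfl)
      have a5 : ∀ x y : ℂ, ‖x + y‖ ^ 2 ≤ 2 * ‖x‖ ^ 2 + 2 * ‖y‖ ^ 2 := fun x y => by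
        nlinarith [norm_add_le x y, norm_nonneg (x + y), sq_nonneg (‖x‖ - ‖y‖)]
      have a6 : 0 ≤ ∑ j, ‖u j z‖ ^ 2 := by positivity
      simp only [a1]
      have a7 := a5 (∑ j, (E z * Dm (Rc χ) j z) * u j z) (Y z)
      have a8 := mul_le_mul_of_nonneg_right (a7.trans (add_le_add_left (mul_le_mul_of_nonneg_left a3 zero_le_two) _)) (Real.exp_nonneg (-φ' z))
      refine a8.trans ?_
      have a9 := mul_le_mul_of_nonneg_right a4 a6
      linarith
    have hb2 : ∫ z, (∑ j, ∑ k, ‖(E z * wD I (Rc χ) k z) * u j z - (E z * wD I (Rc χ) j z) * u k z‖ ^ 2) * ex (-φ' z)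
        ≤ ∫ z, 4 * ε * ∑ j, ‖u j z‖ ^ 2 := by
      refine integral_mono_of_nonneg (Eventually.of_forall fun z => by positivity) (hN.const_mul _) (Eventually.of_forall fun z => ?_)
      have a4 := hQn z I (Or.inl rfl)
      have a5 : ∀ x y : ℂ, ‖x - y‖ ^ 2 ≤ 2 * ‖x‖ ^ 2 + 2 * ‖y‖ ^ 2 := fun x y => by
        nlinarith [norm_sub_le x y, norm_nonneg (x - y), sq_nonneg (‖x‖ - ‖y‖)]
      have a6 : 0 ≤ ∑ j, ‖u j z‖ ^ 2 := by positivity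
      have a7 : (∑ j, ∑ k, ‖(E z * wD I (Rc χ) k z) * u j z - (E z * wD I (Rc χ) j z) * u k z‖ ^ 2)
          ≤ 4 * (∑ j, ‖E z * wD I (Rc χ) j z‖ ^ 2) * ∑ j, ‖u j z‖ ^ 2 := by
        refine (Finset.sum_le_sum fun j _ => Finset.sum_le_sum fun k _ => a5 _ _).trans (le_of_eq ?_)
        simp only [norm_mul _ (u _ z), mul_pow, Finset.sum_add_distrib, ← Finset.mul_sum, ← Finset.sum_mul]
        ring
      refine (mul_le_mul_of_nonneg_right a7 (Real.exp_nonneg _)).trans ?_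
      have a9 := mul_le_mul_of_nonneg_right a4 a6
      linarith
    rw [integral_add (hN.const_mul _) (hT.const_mul _), integral_const_mul, integral_const_mul] at hb1
    rw [integral_const_mul] at hb2
    have hb0 := integral_mono_of_nonneg (Eventually.of_forall fun z => mul_nonneg (hκ z) (by positivity)) hint (Eventually.of_forall hPU)
    linarith
  · intro h hh j k
    have h1 := hu1 (fun z => χ z * h z) (hχ.mulS hh.1) j k
    have h2 : ∀ k z, wD I (fun z => χ z * h z) k z = χ z * wD I h k z + wD I (Rc χ) k z * h z :=
      fun k z => wD_mul (Sm.diff hχ.1 z) (Sm.diff hh.1 z)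
    rw [← add_eq_zero_iff_eq_neg, ← integral_add, ← h1]
    · refine integral_congr_ae (Eventually.of_forall fun z => ?_)
      simp only [h2, hE]; ring
    · exact (((iu (hP.mulS (Sm.wD hh.1 I k)) j)).sub (iu (hP.mulS (Sm.wD hh.1 I j)) k)).congr
        (Eventually.of_forall fun z => by simp only [Pi.sub_apply]; ring)
    · exact (((iu ((hQ I k).mulS hh.1) j)).sub (iu ((hQ I j).mulS hh.1) k)).congr
        (Eventually.of_forall fun z => by simp only [Pi.sub_apply]; ring)
  · intro h hh
    have hp : Tst D (fun z => ((ex (1 * θ z) : ℝ) : ℂ) * (χ z * h z)) := Tst.smul hD (expC hθ 1) (hχ.mulS hh.1)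
    set p : Cv n → ℂ := fun z => ((ex (1 * θ z) : ℝ) : ℂ) * (χ z * h z) with hpd
    have de : ∀ (c : ℝ) z, z ∈ D → ∀ j, Dm (fun x => ((ex (c * θ x) : ℝ) : ℂ)) j z
        = (ex (c * θ z) * c : ℝ) * Dm (Rc θ) j z := fun c z hz j => by
      refine wD_chain (F := fun x => ex (c * x)) ?_ ((hθ.contDiffAt (hD.mem_nhds hz)).differentiableAt (by simp))
      simpa using ((hasDerivAt_id (θ z)).const_mul c).exp
    have dd : ∀ (c : ℝ) z, z ∈ D → DifferentiableAt ℝ (fun x => ((ex (c * θ x) : ℝ) : ℂ)) z := fun c z hz =>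
      SmAt.diff ((expC hθ c).contDiffAt (hD.mem_nhds hz))
    have dp : ∀ z j, ((ex (-1/2 * θ z) : ℝ) : ℂ) * Dm p j z = (E z * Dm (Rc χ) j z) * h z
        + (Dm (Rc θ) j z * (E z * χ z)) * h z + (E z * χ z) * Dm h j z := by
      intro z j
      by_cases hz : z ∈ D
      · have ee : ((ex (-1/2 * θ z) : ℝ) : ℂ) * (ex (1 * θ z) : ℝ) = E z := by
          rw [hE, ← ofReal_mul, ← Real.exp_add]; congr 2; ring
        rw [hpd, wD_mul (dd 1 z hz) (Sm.diff (ContDiff.mul hχ.1 hh.1) z), de 1 z hz,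
          wD_mul (Sm.diff hχ.1 z) (Sm.diff hh.1 z), ← ee]
        push_cast; ring
      · rw [(Tst.wD hp _ _).off hz, (Tst.wD hχ _ _).off hz, Koff z fun h => hz (hKD h)]; ring
    have h2 := hu2 _ hp.conj
    have cj : ∀ j z, stC (ex (-1/2 * θ z) * wD I (fun x => stC (p x)) j z)
        = (ex (-1/2 * θ z) : ℝ) * Dm p j z := fun j z => by
      rw [wD_conj, map_mul, conj_conj, conj_ofReal, conj_I]
    simp only [hθdef] at cj
    simp only [cj] at h2
    have hq : ∀ j, Tst U (fun z => ((ex (-1 * θ z) : ℝ) : ℂ) * α j z) := fun j =>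
      Tst.smul hU ((expC hθ (-1)).mono hUD) (hα j)
    have r1 : ∫ z, ∑ j, (ex (-1/2 * (φ z - η z)) * α j z) * ((ex (-1/2 * (φ z - η z)) : ℝ) * Dm p j z)
        = - ∫ z, Y z * h z := by
      have b1 : ∀ z, ∑ j, (ex (-1/2 * (φ z - η z)) * α j z) * ((ex (-1/2 * (φ z - η z)) : ℝ) * Dm p j z)
          = ∑ j, (ex (-1 * θ z) * α j z) * Dm p j z := fun z => Finset.sum_congr rfl fun j _ => by
        have : ((ex (-1 * θ z) : ℝ) : ℂ) = (ex (-1/2 * θ z) : ℝ) * (ex (-1/2 * θ z) : ℝ) := by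
          rw [← ofReal_mul, ← Real.exp_add]; congr 2; ring
        rw [this]; ring
      have b2 : ∀ z, Y z * h z = ∑ j, Dm (fun x => ((ex (-1 * θ x) : ℝ) : ℂ) * α j x) j z * p z := by
        intro z
        by_cases hz : z ∈ U
        · have ee : ((ex (-1 * θ z) : ℝ) : ℂ) * (ex (1 * θ z) : ℝ) = 1 := by
            rw [← ofReal_mul, ← Real.exp_add]; simp
          rw [hY, Finset.sum_mul]
          refine Finset.sum_congr rfl fun j _ => ?_
          rw [wD_mul (dd (-1) z (hUD hz)) (Sm.diff (hα j).1 z), de (-1) z (hUD hz), hpd, dl, hθj z (hUD hz), hηUj z hz]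
          simp only [hχU z hz]
          push_cast at ee ⊢
          linear_combination -(Dm (α j) j z - Dm (Rc φ) j z * α j z) * h z * ee
        · rw [hYT.off hz]
          simp only [(Tst.wD (hq _) _ _).off hz, zero_mul, Finset.sum_const_zero]
      simp only [b1, b2]
      rw [integral_finsetSum _ fun j _ => Sm.integrable ((hq j).1.mul (Sm.wD hp.1 _ _)) (hq j).2.1.mul_right,
        integral_finsetSum _ fun j _ => Sm.integrable ((Sm.wD (hq j).1 _ _).mul hp.1) (hp.2.1.mul_left), ← Finset.sum_neg_distrib]
      refine Finset.sum_congr rfl fun j _ => ?_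
      rw [ibp (hq j).1 hp.1 (hq j).2.1, neg_neg]
    rw [r1] at h2
    have i1 : ∀ j, Integrable fun z => (E z * χ z) * u j z * Dm h j z := fun j =>
      (iu (hP.mulS (Sm.wD hh.1 (-I) j)) j).congr (Eventually.of_forall fun z => by ring_nf)
    have i2 : ∀ j, Integrable fun z => ((E z * Dm (Rc χ) j z) * u j z
      + (Dm (Rc θ) j z * (E z * χ z)) * u j z) * h z := fun j =>
      ((iu ((hQ (-I) j).mulS hh.1) j).add (iu ((hR j).mulS hh.1) j)).congr (Eventually.of_forall fun z => by
        simp only [Pi.add_apply]; ring)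
    have i3 : Integrable fun z => Y z * h z := Sm.integrable (hYT.1.mul hh.1) hYT.2.1.mul_right
    rw [← add_eq_zero_iff_eq_neg] at h2 ⊢
    simp only [add_mul _ _ (h _), Finset.sum_mul]
    rw [integral_add, ← add_assoc, ← integral_add, ← h2]
    · congr 2
      funext z
      rw [← Finset.sum_add_distrib]
      refine Finset.sum_congr rfl fun j _ => ?_
      have := dp z j
      simp only [hθdef] at this ⊢
      rw [this]; ring
    · exact integrable_finsetSum _ fun j _ => i1 j
    · refine integrable_finsetSum _ fun j _ => ?_
      simpa only [add_mul] using i2 j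
    · refine integrable_finsetSum _ fun j _ => ?_
      simpa only [add_mul] using i2 j
    · exact i3

theorem duality (hD : IsOpen D) {φ η : Cv n → ℝ} (hφ : ContDiffOn ℝ Tt φ D)
    (hη : ContDiffOn ℝ Tt η D) {U : Set (Cv n)} (hU : IsOpen U) (hUD : U ⊆ D) (hηU : ∀ z ∈ U, η z = 0)
    {α : Fin n → Cv n → ℂ} (hα : ∀ j, Tst U (α j)) {g : Cv n → ℂ} (hg : Tst U g) {κ : ℝ} (hκ : 0 < κ)
    (hL : ∀ z ∈ D, ∀ v : Cv n, ((tsupport g).indicator (fun _ => κ) z + 2 * ∑ j, ‖Dm (Rc η) j z‖ ^ 2) * ∑ j, ‖v j‖ ^ 2 ≤ Lf φ z v)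
    (hχ : ∀ ε > 0, ∃ χ : Cv n → ℝ, Tst D (Rc χ) ∧ (∀ z ∈ U, χ z = 1) ∧
      ∀ z ∈ D, ∑ j, ‖Dm (Rc χ) j z‖ ^ 2 ≤ ε * ex (η z)) :
    ‖∫ z, ∑ j, α j z * stC (wD I g j z) * om φ z‖ ^ 2
      ≤ 4 / κ * (∫ z, (∑ j, ‖wD I g j z‖ ^ 2) * ex (-φ z)) * ∫ z, ‖∑ j, dl φ (α j) j z‖ ^ 2 * ex (-φ z) := by
  obtain ⟨u, hu, hu1, hu2⟩ := decomp hD (hφ.sub hη) (fun j => (hα j).mono hUD)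
  set T := ∫ z, ‖∑ j, dl φ (α j) j z‖ ^ 2 * ex (-φ z)
  set N := ∫ z, ∑ j, ‖u j z‖ ^ 2
  have hG : IsClosed (tsupport g) := isClosed_tsupport g
  have k1 : ∫ z, (tsupport g).indicator (fun _ => κ) z * ∑ j, ‖u j z‖ ^ 2 ≤ 4 * T := by
    have hN : 0 ≤ N := integral_nonneg fun z => by positivity
    refine le_of_forall_pos_le_add fun e he => ?_
    obtain ⟨χ, h1, h2, h3⟩ := hχ (e / (6 * (N + 1))) (by positivity)
    refine (key_est hD hφ hη hU hUD hηU (fun z => Set.indicator_nonneg (fun _ _ => hκ.le) z)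
      (fun z hz => Set.indicator_of_notMem (fun h => hz (hg.2.2 h)) _)
      hL (by positivity) h1 h2 h3 hα hu hu1 hu2).trans ?_
    have : 6 * (e / (6 * (N + 1))) * N ≤ e := by
      rw [show 6 * (e / (6 * (N + 1))) * N = e * (N / (N + 1)) by field_simp]
      exact mul_le_of_le_one_right he.le (by rw [div_le_one (by positivity)]; linarith)
    change 4 * T + 6 * (e / (6 * (N + 1))) * N ≤ _
    linarith
  have hw : ∀ j, Tst D (fun z => (ex (-1/2 * (φ z - η z)) : ℝ) * wD I g j z) :=
    fun j => Tst.smul hD (expC (hφ.sub hη) (-1/2)) (Tst.wD (hg.mono hUD) I j)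
  have hv : ∀ j, MemLp ((tsupport g).indicator (u j)) 2 := fun j => (hu j).indicator hG.measurableSet
  have e1 : ∫ z, ∑ j, α j z * stC (wD I g j z) * om φ z = inner ℂ (VV _ (fun j => (hw j).memLp)) (VV _ hv) := by
    rw [VV_inner]
    have : ∀ z, ∑ j, (tsupport g).indicator (u j) z * stC ((ex (-1/2 * (φ z - η z)) : ℝ) * wD I g j z)
      = ∑ j, u j z * stC ((ex (-1/2 * (φ z - η z)) : ℝ) * wD I g j z) := fun z =>
        Finset.sum_congr rfl fun j _ => by
        by_cases hz : z ∈ tsupport g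
        · rw [Set.indicator_of_mem hz]
        · rw [wD_eq_zero_of_notMem hz]; simp
    simp only [this]
    refine Eq.trans ?_ (hu2 g (hg.mono hUD)).symm
    refine integral_congr_ae (Eventually.of_forall fun z => Finset.sum_congr rfl fun j _ => ?_)
    by_cases hz : z ∈ U
    · have : om φ z = ((ex (-1/2 * (φ z - η z)) : ℝ) : ℂ) * (ex (-1/2 * (φ z - η z)) : ℝ) := by
        rw [← ofReal_mul, ← Real.exp_add, om_eq, hηU z hz]; congr 2; ring
      rw [this, map_mul, conj_ofReal]
      ring
    · rw [(hα j).off hz]; simp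
  have e2 : ‖VV _ hv‖ ^ 2 ≤ 4 * T / κ := by
    rw [VV_norm, le_div_iff₀ hκ, mul_comm, ← integral_const_mul]
    refine le_trans (le_of_eq (integral_congr_ae (Eventually.of_forall fun z => ?_))) k1
    by_cases hz : z ∈ tsupport g
    · simp [Set.indicator_of_mem hz]
    · simp [Set.indicator_of_notMem hz]
  have e3 : ‖VV _ (fun j => (hw j).memLp)‖ ^ 2 = ∫ z, (∑ j, ‖wD I g j z‖ ^ 2) * ex (-φ z) := by
    rw [VV_norm]
    refine integral_congr_ae (Eventually.of_forall fun z => ?_)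
    simp only
    by_cases hz : z ∈ U
    · simp only [norm_mul, norm_real, Real.norm_eq_abs, Real.abs_exp, mul_pow, ← Finset.mul_sum, hηU z hz]
      rw [← Real.exp_nat_mul, mul_comm]; congr 2; push_cast; ring
    · simp [(Tst.wD hg _ _).off hz]
  rw [e1]
  calc _ ≤ (‖VV _ (fun j => (hw j).memLp)‖ * ‖VV _ hv‖) ^ 2 := by gcongr; exact norm_inner_le_norm _ _
    _ = ‖VV _ (fun j => (hw j).memLp)‖ ^ 2 * ‖VV _ hv‖ ^ 2 := mul_pow _ _ _
    _ ≤ (∫ z, (∑ j, ‖wD I g j z‖ ^ 2) * ex (-φ z)) * (4 * T / κ) := by rw [← e3]; gcongr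
    _ = _ := by ring

end P4c

section P5

def P2 (f : Cv n → ℝ) (z w : Cv n) : ℂ :=
  ∑ j, Dm (Rc f) j z * w j
    + 1 / 2 * ∑ j, ∑ k, Dm (Dm (Rc f) j) k z * w j * w k

lemma D1 (f : Cv n → ℝ) (z w : Cv n) :
    fderiv ℝ (Rc f) z w = ((2 * (∑ j, Dm (Rc f) j z * w j).re : ℝ) : ℂ) := by
  have : ∀ a : ℂ, ((2 * a.re : ℝ) : ℂ) = a + stC a := fun a => by
    rw [add_conj]
  rw [fderiv_eq_sum, this, map_sum, ← Finset.sum_add_distrib]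
  refine Finset.sum_congr rfl fun j _ => ?_
  rw [map_mul, wD_ofReal]; simp; ring

lemma D2 {f : Cv n → ℝ} {z : Cv n} (hf : ContDiffAt ℝ Tt f z) (w : Cv n) :
    fderiv ℝ (fderiv ℝ (Rc f)) z w w
      = ((2 * (∑ j, ∑ k, Dm (Dm (Rc f) j) k z * w j * w k).re + 2 * Lf f z w : ℝ) : ℂ) := by
  have h := smAt_ofReal hf
  set F := fun x => (f x : ℂ) with hF
  have h1 : DifferentiableAt ℝ (fderiv ℝ F) z :=
    (ContDiffAt.fderiv_right (m := 1) h (by norm_cast)).differentiableAt (by simp)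
  have h2 : fderiv ℝ (fun x => fderiv ℝ F x w) z = (fderiv ℝ (fderiv ℝ F) z).flip w :=
    HasFDerivAt.fderiv (by simpa using h1.hasFDerivAt.clm_apply (hasFDerivAt_const w z))
  have e : fderiv ℝ (fderiv ℝ F) z w w = fderiv ℝ (fun x => fderiv ℝ F x w) z w := by rw [h2]; rfl
  have d : ∀ s j, DifferentiableAt ℝ (wD s F j) z := fun s j => (h.wD s j).diff
  rw [e]
  simp only [fderiv_eq_sum F]
  rw [fderiv_fun_sum fun j _ => ((d _ j).const_mul _).fun_add ((d _ j).const_mul _)]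
  rw [_root_.sum_apply]
  have : ∀ a b : ℂ, ((2 * a.re + 2 * b.re : ℝ) : ℂ) = a + b + stC (a + b) := fun a b => by
    rw [add_conj]; simp; ring
  rw [Lf, this, map_add, map_sum, map_sum, ← Finset.sum_add_distrib, ← Finset.sum_add_distrib, ← Finset.sum_add_distrib]
  refine Finset.sum_congr rfl fun j _ => ?_
  rw [fderiv_fun_add ((d _ j).const_mul _) ((d _ j).const_mul _), fderiv_const_mul (d _ j), fderiv_const_mul (d _ j)]
  simp only [_root_.add_apply, _root_.smul_apply, fderiv_eq_sum (wD _ _ _), smul_eq_mul, cHessian_apply, ← hF]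
  rw [map_sum, map_sum, Finset.mul_sum, Finset.mul_sum, ← Finset.sum_add_distrib, ← Finset.sum_add_distrib,
    ← Finset.sum_add_distrib, ← Finset.sum_add_distrib]
  refine Finset.sum_congr rfl fun k _ => ?_
  have c : ∀ s t, stC (wD s (wD t F j) k z) = wD (stC s) (wD (stC t) F j) k z := by
    intro s t
    have e1 : (fun x => stC (wD t F j x)) = wD (stC t) F j := by
      funext x; rw [wD_ofReal]
    rw [← e1, wD_conj]; simp
  simp only [map_mul, c, map_neg, conj_I, neg_neg, conj_conj]
  ring

lemma taylor2 {f : Cv n → ℝ} {z : Cv n} (hf : ContDiffAt ℝ Tt f z) {ε : ℝ} (hε : 0 < ε) :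
    ∀ᶠ w in 𝓝 (0 : Cv n), |f (z + w) - f z - 2 * (P2 f z w).re - Lf f z w| ≤ ε * ‖w‖ ^ 2 := by
  have h := smAt_ofReal hf
  have h1 : DifferentiableAt ℝ (fderiv ℝ (Rc f)) z :=
    (ContDiffAt.fderiv_right (m := 1) h (by norm_cast)).differentiableAt (by simp)
  have hs : IsSymmSndFDerivAt ℝ (Rc f) z :=
    h.isSymmSndFDerivAt (by simp; exact WithTop.coe_le_coe.2 (le_top : (2:ℕ∞) ≤ ⊤))
  set F := fun x => (f x : ℂ) with hF
  set B := fderiv ℝ (fderiv ℝ F) z with hB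
  have h2 := (h1.hasFDerivAt.isLittleO.def hε).and h.ev
  obtain ⟨r, hr, h3⟩ := Metric.eventually_nhds_iff_ball.1 h2
  filter_upwards [Metric.ball_mem_nhds 0 hr] with w hw
  rw [mem_ball_zero_iff] at hw
  set G : Cv n → ℂ := fun x => F x - fderiv ℝ F z x - (1/2 : ℝ) • B (x - z) (x - z) with hG
  have hd : ∀ x ∈ mB z r, HasFDerivAt G (fderiv ℝ F x - fderiv ℝ F z - B (x - z)) x := by
    intro x hx
    have i1 : HasFDerivAt (fun x : Cv n => x - z) (ContinuousLinearMap.id ℝ _) x := (hasFDerivAt_id x).sub_const z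
    have i2 : HasFDerivAt (fun x : Cv n => B (x - z)) B x := by
      exact (B.hasFDerivAt.comp x i1).congr_fderiv (by ext; simp)
    have i3 := (((h3 x hx).2.hasFDerivAt).sub (fderiv ℝ F z).hasFDerivAt).sub ((i2.clm_apply i1).const_smul (1/2 : ℝ))
    refine i3.congr_fderiv ?_
    ext v
    have := hs.eq v (x - z)
    rw [← hB] at this
    simp only [map_sub, _root_.sub_apply] at this
    simp; linear_combination (1/2) * this
  have hm := (convex_closedBall z ‖w‖).norm_image_sub_le_of_norm_hasFDerivWithin_le (f := G) (C := ε * ‖w‖)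
    (f' := fun x => fderiv ℝ F x - fderiv ℝ F z - B (x - z)) (x := z) (y := z + w)
    (fun x hx => (hd x (Metric.closedBall_subset_ball hw hx)).hasFDerivWithinAt)
    (fun x hx => ((h3 x (Metric.closedBall_subset_ball hw hx)).1).trans (by
      rw [Metric.mem_closedBall, dist_eq_norm] at hx; gcongr)) (by simp) (by simp)
  have e : G (z + w) - G z = ((f (z + w) - f z - 2 * (P2 f z w).re - Lf f z w : ℝ) : ℂ) := by
    have e0 : G (z + w) - G z = F (z + w) - F z - fderiv ℝ F z w - (1/2 : ℝ) • B w w := by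
      simp [hG]; ring
    rw [e0, hB, D1, D2 hf]
    simp only [hF, P2, add_re]
    have : ∀ a : ℂ, (1 / 2 * a).re = 1 / 2 * a.re := fun a => by simp
    rw [this, real_smul]; push_cast; ring
  rw [e, norm_real, Real.norm_eq_abs] at hm
  simpa [pow_two, mul_assoc] using hm

lemma taylor1 {Ω K : Set (Cv n)} (hΩ : IsOpen Ω) (hK : IsCompact K) (hKΩ : K ⊆ Ω) {f : Cv n → ℝ}
    (hf : ContDiffOn ℝ Tt f Ω) : ∃ C r : ℝ, 0 < r ∧ 0 ≤ C ∧ ∀ z ∈ K, ∀ w : Cv n, ‖w‖ ≤ r →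
      z + w ∈ Ω ∧ |f (z + w) - f z - 2 * (∑ j, Dm (Rc f) j z * w j).re| ≤ C * ‖w‖ ^ 2 := by
  obtain ⟨r, hr, hrΩ⟩ := hK.exists_cthickening_subset_open hΩ hKΩ
  have hc : IsCompact (Metric.cthickening r K) := hK.cthickening
  set F := fun x => (f x : ℂ) with hF
  have hs : ∀ x ∈ Ω, SmAt F x := fun x hx => smAt_ofReal (hf.contDiffAt (hΩ.mem_nhds hx))
  have h1 : ContinuousOn (fderiv ℝ (fderiv ℝ F)) (Metric.cthickening r K) := fun x hx => by
    have : ContDiffAt ℝ 1 (fderiv ℝ F) x := ContDiffAt.fderiv_right (m := 1) (hs x (hrΩ hx)) (by norm_cast)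
    exact (ContDiffAt.fderiv_right (m := 0) this (by simp)).continuousAt.continuousWithinAt
  obtain ⟨C, hC⟩ := hc.exists_bound_of_continuousOn (f := fderiv ℝ (fderiv ℝ F)) h1
  have hb : ∀ z ∈ K, ∀ s ≤ r, cB z s ⊆ Metric.cthickening r K := fun z hz s hs' =>
    (Metric.closedBall_subset_closedBall hs').trans (Metric.closedBall_subset_cthickening hz r)
  refine ⟨max C 0, r, hr, le_max_right _ _, fun z hz w hw => ?_⟩
  have hzw : z + w ∈ cB z ‖w‖ := by simp
  refine ⟨hrΩ (hb z hz _ hw hzw), ?_⟩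
  have d1 : ∀ x ∈ cB z ‖w‖, ‖fderiv ℝ F x - fderiv ℝ F z‖ ≤ max C 0 * ‖w‖ := by
    intro x hx
    have := (convex_closedBall z ‖w‖).norm_image_sub_le_of_norm_fderiv_le (𝕜 := ℝ) (f := fderiv ℝ F) (C := max C 0)
      (x := z) (y := x) (fun y hy => (ContDiffAt.fderiv_right (m := 1) (hs y (hrΩ (hb z hz _ hw hy)))
        (by norm_cast)).differentiableAt (by simp))
      (fun y hy => (hC y (hb z hz _ hw hy)).trans (le_max_left _ _)) (by simp) hx
    refine this.trans ?_
    rw [Metric.mem_closedBall, dist_eq_norm] at hx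
    gcongr
  have hm := (convex_closedBall z ‖w‖).norm_image_sub_le_of_norm_hasFDerivWithin_le (f := fun x => F x - fderiv ℝ F z x)
    (C := max C 0 * ‖w‖) (f' := fun x => fderiv ℝ F x - fderiv ℝ F z) (x := z) (y := z + w)
    (fun x hx => (((hs x (hrΩ (hb z hz _ hw hx))).diff.hasFDerivAt).sub (fderiv ℝ F z).hasFDerivAt).hasFDerivWithinAt)
    d1 (by simp) hzw
  have e : F (z + w) - fderiv ℝ F z (z + w) - (F z - fderiv ℝ F z z)
      = ((f (z + w) - f z - 2 * (∑ j, Dm F j z * w j).re : ℝ) : ℂ) := by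
    rw [map_add, D1 f z w]; simp only [hF]; push_cast; ring
  rw [e, norm_real, Real.norm_eq_abs] at hm
  simpa [pow_two, mul_assoc] using hm

end P5

section P5a

lemma Lf_smul (f : Cv n → ℝ) (z v : Cv n) (c : ℂ) : Lf f z (c • v) = ‖c‖ ^ 2 * Lf f z v := by
  have : ∑ j, ∑ k, cHessian f z j k * (c • v) j * stC ((c • v) k)
      = ((‖c‖ ^ 2 : ℝ) : ℂ) * ∑ j, ∑ k, cHessian f z j k * v j * stC (v k) := by
    push_cast
    rw [← mul_conj']; simp only [Finset.mul_sum]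
    refine Finset.sum_congr rfl fun j _ => Finset.sum_congr rfl fun k _ => ?_
    simp; ring
  rw [Lf, this, re_ofReal_mul, Lf]

lemma P2_diff (f : Cv n → ℝ) (z : Cv n) : Differentiable ℂ (P2 f z) := by
  unfold P2; fun_prop

lemma P2_zero (f : Cv n → ℝ) (z : Cv n) : P2 f z 0 = 0 := by simp [P2]

lemma Lf_nonneg {f : Cv n → ℝ} (hf : ContDiff ℝ Tt f) {z b : Cv n}
    (h : ∀ᶠ r : ℝ in 𝓝[>] 0, f z ≤ (2 * π)⁻¹ * ∫ θ in (0:ℝ)..(2*π), f (z + exp (θ * I) • ((r : ℂ) • b))) :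
    0 ≤ Lf f z b := by
  by_contra hneg
  push Not at hneg
  set ε := -Lf f z b / (2 * (‖b‖ ^ 2 + 1)) with hε
  have hε0 : 0 < ε := by have := neg_pos.2 hneg; positivity
  have hεb : ε * ‖b‖ ^ 2 ≤ - Lf f z b / 2 := by
    have : ε * (‖b‖ ^ 2 + 1) = - Lf f z b / 2 := by rw [hε]; field_simp
    nlinarith
  obtain ⟨δ, hδ, ht⟩ := Metric.eventually_nhds_iff_ball.1 (taylor2 (z := z) hf.contDiffAt hε0)
  have h2 : ∀ᶠ r : ℝ in 𝓝[>] 0, r * (‖b‖ + 1) < δ := by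
    have : Tendsto (fun r : ℝ => r * (‖b‖ + 1)) (𝓝[>] 0) (𝓝 0) := by
      have : Tendsto (fun r : ℝ => r * (‖b‖ + 1)) (𝓝 0) (𝓝 (0 * (‖b‖ + 1))) := by
        exact (continuous_id.mul continuous_const).tendsto 0
      rw [zero_mul] at this; exact this.mono_left nhdsWithin_le_nhds
    exact this.eventually (gt_mem_nhds hδ)
  obtain ⟨r, hr, hrδ, hr0⟩ := (h.and (h2.and self_mem_nhdsWithin)).exists
  have hr0 : 0 < r := hr0
  set w : ℝ → Cv n := fun θ => exp (θ * I) • ((r : ℂ) • b) with hw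
  have hwc : Continuous w := by fun_prop
  have hwn : ∀ θ, ‖w θ‖ = r * ‖b‖ := fun θ => by
    simp [hw, norm_smul, norm_exp_ofReal_mul_I, abs_of_pos hr0]
  have hwL : ∀ θ, Lf f z (w θ) = r ^ 2 * Lf f z b := fun θ => by
    simp only [hw]; rw [Lf_smul, Lf_smul, norm_exp_ofReal_mul_I, norm_real, Real.norm_eq_abs, sq_abs]; ring
  have hP : ∫ θ in (0:ℝ)..(2*π), (P2 f z (w θ)).re = 0 := by
    have := mv_circle (G := P2 f z) (r := δ) (w := (r : ℂ) • b) ((P2_diff f z).differentiableOn) (by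
      rw [norm_smul, norm_real, Real.norm_of_nonneg hr0.le]; nlinarith)
    rw [P2_zero, mul_zero] at this
    have hc : Continuous fun θ => P2 f z (w θ) := (P2_diff f z).continuous.comp hwc
    have e := (reCLM.intervalIntegral_comp_comm (hc.intervalIntegrable (μ := volume) 0 (2*π)))
    simp only [reCLM_apply] at e
    rw [e, this, zero_re]
  have hc2 : Continuous fun θ => (P2 f z (w θ)).re := continuous_re.comp ((P2_diff f z).continuous.comp hwc)
  have hle : ∫ θ in (0:ℝ)..(2*π), f (z + w θ) ≤
      ∫ θ in (0:ℝ)..(2*π), (f z + r ^ 2 * (Lf f z b / 2)) + 2 * (P2 f z (w θ)).re := by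
    refine intervalIntegral.integral_mono_on (by positivity)
      ((hf.continuous.comp (continuous_const.add hwc)).intervalIntegrable _ _)
      ((continuous_const.add (continuous_const.mul hc2)).intervalIntegrable _ _) fun θ _ => ?_
    have := ht (w θ) (by rw [mem_ball_zero_iff, hwn]; nlinarith)
    rw [hwL, hwn] at this
    have := (abs_le.1 this).2
    have : ε * (r * ‖b‖) ^ 2 ≤ r ^ 2 * (- Lf f z b / 2) := by
      rw [mul_pow, mul_left_comm]; gcongr
    linarith
  rw [intervalIntegral.integral_add (by simp) ((continuous_const.fun_mul hc2).intervalIntegrable _ _),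
    intervalIntegral.integral_const_mul, hP] at hle
  simp only [intervalIntegral.integral_const, sub_zero, smul_eq_mul, mul_zero, add_zero] at hle
  have hp : (0:ℝ) < 2 * π := by positivity
  have h3 := hr.trans (mul_le_mul_of_nonneg_left hle (by positivity))
  rw [inv_mul_cancel_left₀ hp.ne'] at h3
  nlinarith [mul_pos_of_neg_of_neg hneg (by nlinarith : -(r^2) < 0)]

lemma Lf_chain {F F' : ℝ → ℝ} {F'' : ℝ} {ρ : Cv n → ℝ} (hρ : ContDiff ℝ Tt ρ) {z : Cv n}
    (h1 : ∀ᶠ x in 𝓝 z, HasDerivAt F (F' (ρ x)) (ρ x)) (h2 : HasDerivAt F' F'' (ρ z)) (v : Cv n) :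
    Lf (fun x => F (ρ x)) z v = F' (ρ z) * Lf ρ z v
      + F'' * ‖∑ j, Dm (Rc ρ) j z * v j‖ ^ 2 := by
  have hd : ∀ x, DifferentiableAt ℝ ρ x := fun x => hρ.contDiffAt.differentiableAt (by simp)
  have e : ∀ j k, cHessian (fun x => F (ρ x)) z j k = (F' (ρ z) : ℂ) * cHessian ρ z j k
      + F'' * (Dm (Rc ρ) j z * stC (Dm (Rc ρ) k z)) := by
    intro j k
    have e1 : Dm (fun x => ((F (ρ x) : ℝ) : ℂ)) j =ᶠ[𝓝 z]
        fun x => ((F' (ρ x) : ℝ) : ℂ) * Dm (Rc ρ) j x := by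
      filter_upwards [h1] with x hx using wD_chain hx (hd x)
    have d1 : DifferentiableAt ℝ (fun x => ((F' (ρ x) : ℝ) : ℂ)) z :=
      ofRealCLM.differentiableAt.comp z (h2.differentiableAt.comp z (hd z))
    rw [cHessian_apply, wD_congr e1, wD_mul d1 (Sm.diff (Sm.wD (phiC hρ) _ _) z), wD_chain h2 (hd z),
      cHessian_apply, wD_ofReal]
    simp; ring
  have e2 : ∑ j, ∑ k, cHessian (fun x => F (ρ x)) z j k * v j * stC (v k)
      = (F' (ρ z) : ℂ) * ∑ j, ∑ k, cHessian ρ z j k * v j * stC (v k)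
        + ((F'' * ‖∑ j, Dm (Rc ρ) j z * v j‖ ^ 2 : ℝ) : ℂ) := by
    push_cast
    rw [← mul_conj', map_sum, Finset.sum_mul_sum]
    simp only [Finset.mul_sum, ← Finset.sum_add_distrib, e]
    refine Finset.sum_congr rfl fun j _ => Finset.sum_congr rfl fun k _ => ?_
    rw [map_mul]; ring
  rw [Lf, e2, add_re, ofReal_re, re_ofReal_mul, Lf]

lemma wD_coord (s : ℂ) (i j : Fin n) (z : Cv n) :
    wD s (fun x : Cv n => x i) j z = if i = j then (1 + s * I) / 2 else 0 := by
  have : fderiv ℝ (fun x : Cv n => x i) z = ContinuousLinearMap.proj i :=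
    (ContinuousLinearMap.proj (R := ℝ) (φ := fun _ : Fin n => ℂ) i).fderiv
  rw [wD, this]
  by_cases h : i = j
  · subst h; simp; ring
  · simp [h]

def nsq (z : Cv n) : ℝ := ∑ j, ‖z j‖ ^ 2

lemma nsq_smooth : ContDiff ℝ Tt (nsq : Cv n → ℝ) := by
  unfold nsq; exact ContDiff.sum fun j _ => (contDiff_apply ℝ ℂ j).norm_sq ℝ

lemma Lf_nsq (z v : Cv n) : Lf nsq z v = ∑ j, ‖v j‖ ^ 2 := by
  have e0 : (fun x : Cv n => (nsq x : ℂ)) = fun x => ∑ i, x i * stC (x i) := by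
    funext x; simp only [nsq]; push_cast; exact Finset.sum_congr rfl fun i _ => (mul_conj' _).symm
  have d1 : ∀ i (x : Cv n), DifferentiableAt ℝ (fun x : Cv n => x i) x := fun i x => by fun_prop
  have d2 : ∀ i (x : Cv n), DifferentiableAt ℝ (fun x : Cv n => stC (x i)) x := fun i x =>
    conjCLE.differentiableAt.comp x (d1 i x)
  have e1 : ∀ j, Dm (fun x : Cv n => (nsq x : ℂ)) j = fun x => stC (x j) := by
    intro j; funext x
    rw [e0, wD_sum _ _ fun i _ => (d1 i x).fun_mul (d2 i x)]
    simp only [wD_mul (d1 _ x) (d2 _ x), wD_conj, wD_coord]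
    simp
  have e2 : ∀ j k, cHessian nsq z j k = if j = k then 1 else 0 := by
    intro j k
    rw [cHessian_apply, e1, wD_conj, wD_coord]
    split_ifs <;> simp
  rw [Lf]; simp only [e2]; simp [mul_conj, normSq_eq_norm_sq, ← ofReal_pow]

end P5a

section P5b

lemma log_lip {a b c : ℝ} (hc : 0 < c) (hb : c ≤ b) (ha : c ≤ a) : Real.log a - Real.log b ≤ |a - b| / c := by
  have hb' := hc.trans_le hb
  have ha' := hc.trans_le ha
  rw [← Real.log_div ha'.ne' hb'.ne']
  refine (Real.log_le_sub_one_of_pos (by positivity)).trans ?_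
  rw [div_sub_one hb'.ne']
  calc (a - b) / b ≤ |a - b| / b := by gcongr; exact le_abs_self _
    _ ≤ _ := by gcongr

lemma submean_moll {V : Cv n → ℝ} {c ε : ℝ} (hc : 0 < c) (hε : 0 < ε)
    (hV : ∀ x y, |V x - V y| ≤ ‖x - y‖ / c) {z b : Cv n}
    (h : ∀ w : Cv n, ‖w‖ ≤ ε → V (z - w) ≤ (2 * π)⁻¹ * ∫ θ in (0:ℝ)..(2*π), V (z - w + exp (θ * I) • b)) :
    ∫ w, V (z - w) * mol ε w ≤ (2 * π)⁻¹ * ∫ θ in (0:ℝ)..(2*π), ∫ w, V (z + exp (θ * I) • b - w) * mol ε w := by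
  have hVc : Continuous V := by
    refine Metric.continuous_iff.2 fun x e he => ⟨e * c, by positivity, fun y hy => ?_⟩
    rw [Real.dist_eq]
    refine (hV y x).trans_lt ?_
    rw [← dist_eq_norm, div_lt_iff₀ hc]; exact hy
  have hmi : Integrable (mol ε : Cv n → ℝ) := (mol_contDiff ε).continuous.integrable_of_hasCompactSupport (mol_hcs hε)
  set R : ℝ → Cv n → ℝ := fun θ w => V (z + exp (θ * I) • b - w) * mol ε w with hR
  have hRc : Continuous (Function.uncurry R) := by
    have := (mol_contDiff (n := n) ε).continuous
    simp only [hR]; unfold Function.uncurry; fun_prop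
  have hprod : Integrable (Function.uncurry R) ((volume.restrict (Set.uIoc 0 (2*π))).prod volume) := by
    have h1 : Integrable (fun _ : ℝ => |V z| + (‖b‖ + ε) / c) (volume.restrict (Set.uIoc 0 (2*π))) := by
      rw [Set.uIoc_of_le (by positivity)]; exact integrable_const _
    refine (h1.mul_prod hmi).mono' hRc.aestronglyMeasurable (Eventually.of_forall fun p => ?_)
    simp only [Function.uncurry, hR]
    rw [norm_mul, Real.norm_of_nonneg (mol_nonneg ε _)]
    by_cases hw : p.2 ∈ cB (0 : Cv n) ε
    · refine mul_le_mul_of_nonneg_right ?_ (mol_nonneg ε _)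
      rw [mem_closedBall_zero_iff] at hw
      have h2 := hV (z + exp (p.1 * I) • b - p.2) z
      have h3 : ‖z + exp (p.1 * I) • b - p.2 - z‖ / c ≤ (‖b‖ + ε) / c := by
        gcongr
        have : z + exp (p.1 * I) • b - p.2 - z = exp (p.1 * I) • b - p.2 := by abel
        rw [this]
        refine (norm_sub_le _ _).trans ?_
        rw [norm_smul, norm_exp_ofReal_mul_I, one_mul]; gcongr
      have := abs_sub_abs_le_abs_sub (V (z + exp (p.1 * I) • b - p.2)) (V z)
      rw [Real.norm_eq_abs]; linarith
    · rw [mol_zero hε hw]; simp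
  have hsw := intervalIntegral_integral_swap (f := R) hprod
  simp only [hR] at hsw
  rw [hsw, ← integral_const_mul]
  have hm : ∀ F : Cv n → ℝ, Continuous F → Integrable fun w => F w * mol ε w := fun F hF =>
    (hF.mul (mol_contDiff ε).continuous).integrable_of_hasCompactSupport (mol_hcs hε).mul_left
  have e : ∀ w, ∫ θ in (0:ℝ)..(2*π), V (z + exp (θ * I) • b - w) * mol ε w
      = (∫ θ in (0:ℝ)..(2*π), V (z - w + exp (θ * I) • b)) * mol ε w := fun w => by
    rw [← intervalIntegral.integral_mul_const]; congr 1; funext θ; congr 2; abel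
  simp only [e]
  refine integral_mono (hm _ (by fun_prop)) ?_ fun w => ?_
  · refine ((hm _ ?_).const_mul _)
    exact intervalIntegral.continuous_parametric_intervalIntegral_of_continuous' (by unfold Function.uncurry; fun_prop) _ _
  · simp only
    rw [← mul_assoc]
    by_cases hw : w ∈ cB (0 : Cv n) ε
    · exact mul_le_mul_of_nonneg_right (h w (mem_closedBall_zero_iff.1 hw)) (mol_nonneg ε _)
    · rw [mol_zero hε hw]; simp

lemma Lf_add {f g : Cv n → ℝ} {z : Cv n} (hf : ContDiffAt ℝ Tt f z) (hg : ContDiffAt ℝ Tt g z) (v) :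
    Lf (fun x => f x + g x) z v = Lf f z v + Lf g z v := by
  have := cHess_add 1 hf hg
  simp only [one_mul, ofReal_one, one_smul] at this
  simp only [Lf, this, Matrix.add_apply, ← add_re, ← Finset.sum_add_distrib]
  congr 1
  exact Finset.sum_congr rfl fun j _ => Finset.sum_congr rfl fun k _ => by ring

lemma Lf_const (a : ℝ) (z v : Cv n) : Lf (fun _ => a) z v = 0 := by
  have h : ∀ j, Dm (fun _ : Cv n => (a : ℂ)) j = fun _ => 0 := fun j => by funext x; exact wD_const _
  simp [Lf, cHessian_apply, h, wD_const]

lemma exh_rho {Ω K : Set (Cv n)} (hΩ : IsOpen Ω) (hb : Bornology.IsBounded Ω) (hp : Pseudoconvex Ω)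
    (hK : IsCompact K) (hKΩ : K ⊆ Ω) : ∃ ρ : Cv n → ℝ, ContDiff ℝ Tt ρ ∧ (∀ z ∈ K, ρ z < 0) ∧
      IsCompact {z | ρ z ≤ 1/2} ∧ {z | ρ z ≤ 1/2} ⊆ Ω ∧ ∀ z, ρ z ≤ 1/2 → ∀ v, ∑ j, ‖v j‖ ^ 2 ≤ Lf ρ z v := by
  rcases Set.eq_empty_or_nonempty Ωᶜ with he | hne
  · have hu : Ω = Set.univ := Set.compl_empty_iff.1 he
    subst hu
    obtain ⟨a, ha⟩ := hK.exists_bound_of_continuousOn (f := nsq) nsq_smooth.continuous.continuousOn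
    have hs : ContDiff ℝ Tt fun z : Cv n => nsq z + -(a + 1) := nsq_smooth.add contDiff_const
    refine ⟨_, hs, fun z hz => ?_, ?_, Set.subset_univ _, fun z _ v => ?_⟩
    · have := (abs_le.1 (ha z hz)).2; linarith
    · exact Metric.isCompact_of_isClosed_isBounded (isClosed_le hs.continuous continuous_const) (hb.subset (Set.subset_univ _))
    · rw [Lf_add nsq_smooth.contDiffAt contDiffAt_const, Lf_const, Lf_nsq, add_zero]
  set d : Cv n → ℝ := fun z => Metric.infDist z Ωᶜ with hd
  have hd0 : ∀ z ∈ Ω, 0 < d z := fun z hz =>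
    (hΩ.isClosed_compl.notMem_iff_infDist_pos hne).1 (by simpa using hz)
  have hd1 : ∀ z, 0 < d z → z ∈ Ω := fun z hz => by
    by_contra h
    have : d z = 0 := Metric.infDist_zero_of_mem h
    linarith
  have hdl : ∀ x y, d x ≤ d y + ‖x - y‖ := fun x y => by
    rw [← dist_eq_norm]; exact Metric.infDist_le_infDist_add_dist
  have hdc : Continuous d := Metric.continuous_infDist_pt _
  obtain ⟨a, ha⟩ := hK.exists_bound_of_continuousOn (f := fun z => -Real.log (d z) + nsq z)
    (fun z hz => ((hdc.continuousAt.log (hd0 z (hKΩ hz)).ne').neg.add nsq_smooth.continuous.continuousAt).continuousWithinAt)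
  set c := ex (-(a + 2)) / 2 with hc
  have hc0 : 0 < c := by positivity
  set V : Cv n → ℝ := fun z => - Real.log (max (d z) c) with hV
  have hVl : ∀ x y, |V x - V y| ≤ ‖x - y‖ / c := by
    have key : ∀ x y, V x - V y ≤ ‖x - y‖ / c := fun x y => by
      have h1 := log_lip (a := max (d y) c) (b := max (d x) c) hc0 (le_max_right _ _) (le_max_right _ _)
      have h2 : |max (d y) c - max (d x) c| ≤ ‖x - y‖ := by
        refine (abs_max_sub_max_le_abs _ _ _).trans (abs_le.2 ⟨?_, ?_⟩)
        · linarith [hdl x y]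
        · have := hdl y x; rw [norm_sub_rev] at this; linarith
      have h3 : |max (d y) c - max (d x) c| / c ≤ ‖x - y‖ / c := by gcongr
      simp only [hV]; linarith
    intro x y
    refine abs_le.2 ⟨?_, key x y⟩
    have := key y x; rw [norm_sub_rev] at this; linarith
  have hVc : Continuous V := ((hdc.max continuous_const).log fun x => (lt_max_of_lt_right hc0).ne').neg
  set ε := c / 4 with hε
  have hε0 : 0 < ε := by positivity
  set W : Cv n → ℝ := fun z => ∫ w, V (z - w) * mol ε w with hW
  have hli : LocallyIntegrable (Rc V) := (continuous_ofReal.comp hVc).locallyIntegrable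
  have hWm : ∀ z, (W z : ℂ) = moll ε (Rc V) z := fun z => by
    rw [moll_swap, hW]; simp only; rw [← integral_complex_ofReal]; simp
  have hWs : ContDiff ℝ Tt W := by
    have e : W = fun z => (moll ε (Rc V) z).re := by funext z; rw [← hWm, ofReal_re]
    rw [e]; exact reCLM.contDiff.comp (moll_sm hε0 hli)
  have hWV : ∀ z, |W z - V z| ≤ 1/2 := fun z => by
    have := moll_close hε0 hli (z := z) (c := (V z : ℂ)) (δ := 1/2) fun y hy => by
      rw [← ofReal_sub, norm_real, Real.norm_eq_abs]
      refine (hVl y z).trans ?_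
      rw [div_le_iff₀ hc0]; linarith
    rwa [← hWm, ← ofReal_sub, norm_real, Real.norm_eq_abs] at this
  have hs : ContDiff ℝ Tt fun z : Cv n => W z + (nsq z + -(a + 1)) := hWs.add (nsq_smooth.add contDiff_const)
  have hns : ∀ z : Cv n, 0 ≤ nsq z := fun z => Finset.sum_nonneg fun _ _ => by positivity
  have hlow : ∀ z, W z + (nsq z + -(a + 1)) ≤ 1/2 → 2 * c ≤ d z := by
    intro z hz
    have h1 := (abs_le.1 (hWV z)).1
    have h2 : V z ≤ a + 2 := by linarith [hns z]
    have h3 : ex (-(a+2)) ≤ max (d z) c := by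
      rw [← Real.exp_log (lt_max_of_lt_right hc0 : 0 < max (d z) c)]
      exact Real.exp_le_exp.2 (by simp only [hV] at h2; linarith)
    have h4 : 2 * c = ex (-(a+2)) := by rw [hc]; ring
    rw [h4]
    rcases le_max_iff.1 h3 with h | h
    · exact h
    · linarith
  have hsub : {z : Cv n | W z + (nsq z + -(a + 1)) ≤ 1/2} ⊆ Ω := fun z hz => hd1 z (by linarith [hlow z hz])
  refine ⟨_, hs, fun z hz => ?_, ?_, hsub, fun z hz v => ?_⟩
  · have h1 := (abs_le.1 (ha z hz)).2
    have h2 := (abs_le.1 (hWV z)).2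
    have h3 : V z ≤ -Real.log (d z) := neg_le_neg (Real.log_le_log (hd0 z (hKΩ hz)) (le_max_left _ _))
    linarith
  · exact Metric.isCompact_of_isClosed_isBounded (isClosed_le hs.continuous continuous_const) (hb.subset hsub)
  · rw [Lf_add hWs.contDiffAt (nsq_smooth.add contDiff_const).contDiffAt, Lf_add nsq_smooth.contDiffAt contDiffAt_const,
      Lf_const, Lf_nsq, add_zero]
    suffices 0 ≤ Lf W z v by linarith
    refine Lf_nonneg hWs ?_
    have h2 : ∀ᶠ r : ℝ in 𝓝[>] 0, r * ‖v‖ < ε := by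
      have : Tendsto (fun r : ℝ => r * ‖v‖) (𝓝[>] 0) (𝓝 0) := by
        have : Tendsto (fun r : ℝ => r * ‖v‖) (𝓝 0) (𝓝 (0 * ‖v‖)) := (continuous_id.mul continuous_const).tendsto 0
        rw [zero_mul] at this; exact this.mono_left nhdsWithin_le_nhds
      exact this.eventually (gt_mem_nhds hε0)
    filter_upwards [h2, self_mem_nhdsWithin] with r hr hr0
    have hr0 : 0 < r := hr0
    refine submean_moll hc0 hε0 hVl fun w hw => ?_
    have hdz := hlow z hz
    have hbig : ∀ ζ : ℂ, ‖ζ‖ ≤ 1 → c ≤ d (z - w + ζ • ((r : ℂ) • v)) := fun ζ hζ => by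
      have := hdl z (z - w + ζ • ((r : ℂ) • v))
      have e : z - (z - w + ζ • ((r : ℂ) • v)) = w - ζ • ((r : ℂ) • v) := by abel
      rw [e] at this
      have h5 := norm_sub_le w (ζ • ((r : ℂ) • v))
      have h6 : ‖ζ • ((r : ℂ) • v)‖ ≤ ε := by
        rw [norm_smul, norm_smul, norm_real, Real.norm_of_nonneg hr0.le]
        calc _ ≤ 1 * (r * ‖v‖) := by gcongr
          _ ≤ ε := by linarith
      linarith
    have hVe : ∀ ζ : ℂ, ‖ζ‖ ≤ 1 → V (z - w + ζ • ((r : ℂ) • v)) = - Real.log (d (z - w + ζ • ((r : ℂ) • v))) :=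
      fun ζ hζ => by simp only [hV]; rw [max_eq_left (hbig ζ hζ)]
    have := hp.2 (z - w) ((r : ℂ) • v) fun ζ hζ => hd1 _ (hc0.trans_le (hbig ζ hζ))
    have h0 := hVe 0 (by simp)
    rw [zero_smul, add_zero] at h0
    rw [h0]
    refine this.trans_eq ?_
    congr 2; funext θ
    exact (hVe _ (by rw [norm_exp_ofReal_mul_I])).symm

end P5b

section P5c

lemma exists_q : ∃ (q p p' : ℝ → ℝ) (Q : ℝ), ContDiff ℝ Tt q ∧ (∀ t, HasDerivAt q (p t) t) ∧
    (∀ t, HasDerivAt p (p' t) t) ∧ (∀ t ≤ 0, q t = 0) ∧ (∀ t, 0 ≤ q t) ∧ (∀ t, 0 ≤ p t ∧ p t ≤ Q) ∧ (∀ t, 0 ≤ p' t) ∧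
    ∀ t, 1/2 ≤ t → 1 ≤ q t := by
  set S := sT with hS
  have hSc : Continuous S := Real.smoothTransition.continuous
  have hSs : ContDiff ℝ Tt S := Real.smoothTransition.contDiff
  have hSi : ∀ a b, IntervalIntegrable S volume a b := fun a b => hSc.intervalIntegrable a b
  have hI : 0 < ∫ t in (0:ℝ)..(1/2), S t := by
    refine intervalIntegral.intervalIntegral_pos_of_pos_on (hSi _ _) (fun x hx => Real.smoothTransition.pos_of_pos hx.1) (by norm_num)
  set C := (∫ t in (0:ℝ)..(1/2), S t)⁻¹ with hC
  have hC0 : 0 < C := inv_pos.2 hI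
  have hd : ∀ t, HasDerivAt (fun t => C * ∫ x in (0:ℝ)..t, S x) (C * S t) t := fun t =>
    (intervalIntegral.integral_hasDerivAt_right (hSi _ _) (hSc.stronglyMeasurableAtFilter _ _) hSc.continuousAt).const_mul C
  have hm : Monotone fun t => C * ∫ x in (0:ℝ)..t, S x := by
    refine monotone_of_deriv_nonneg (fun t => (hd t).differentiableAt) fun t => ?_
    rw [(hd t).deriv]; exact mul_nonneg hC0.le (Real.smoothTransition.nonneg t)
  have h0 : ∀ t ≤ 0, C * ∫ x in (0:ℝ)..t, S x = 0 := fun t ht => by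
    rw [intervalIntegral.integral_symm, intervalIntegral.integral_congr (g := fun _ => 0)]
    · simp
    · intro x hx; rw [Set.uIcc_of_le ht] at hx; exact Real.smoothTransition.zero_of_nonpos hx.2
  refine ⟨_, _, fun t => C * deriv S t, C, ?_, hd, fun t => ?_, h0, fun t => ?_, fun t => ⟨?_, ?_⟩, fun t => ?_, fun t ht => ?_⟩
  · refine contDiff_infty_iff_deriv.2 ⟨fun t => (hd t).differentiableAt, ?_⟩
    have : deriv (fun t => C * ∫ x in (0:ℝ)..t, S x) = fun t => C * S t := funext fun t => (hd t).deriv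
    rw [this]; exact contDiff_const.mul hSs
  · exact ((hSs.differentiable (by simp)) t).hasDerivAt.const_mul C
  · rcases le_total t 0 with h | h
    · rw [h0 t h]
    · simpa using hm h
  · exact mul_nonneg hC0.le (Real.smoothTransition.nonneg t)
  · exact mul_le_of_le_one_right hC0.le (Real.smoothTransition.le_one t)
  · exact mul_nonneg hC0.le Real.smoothTransition.monotone.deriv_nonneg
  · have := hm ht
    have h1 : C * ∫ x in (0:ℝ)..(1/2), S x = 1 := inv_mul_cancel₀ hI.ne'
    exact h1 ▸ this

lemma exists_dS : ∃ B : ℝ, ∀ x, |deriv sT x| ≤ B ∧ (1 < x → deriv sT x = 0) := by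
  have hSs : ContDiff ℝ Tt sT := Real.smoothTransition.contDiff
  obtain ⟨B, hB⟩ := (isCompact_Icc (a := (0:ℝ)) (b := 1)).exists_bound_of_continuousOn
    ((hSs.continuous_deriv (by simp)).continuousOn)
  have h1 : ∀ x, 1 < x → deriv sT x = 0 := fun x hx => by
    have : sT =ᶠ[𝓝 x] fun _ => 1 := by
      filter_upwards [lt_mem_nhds hx] with y hy using Real.smoothTransition.one_of_one_le hy.le
    rw [this.deriv_eq]; simp
  have h2 : ∀ x, x < 0 → deriv sT x = 0 := fun x hx => by
    have : sT =ᶠ[𝓝 x] fun _ => 0 := by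
      filter_upwards [gt_mem_nhds hx] with y hy using Real.smoothTransition.zero_of_nonpos hy.le
    rw [this.deriv_eq]; simp
  have hB0 : 0 ≤ B := (norm_nonneg _).trans (hB 0 (by simp))
  refine ⟨B, fun x => ⟨?_, h1 x⟩⟩
  rcases lt_or_ge x 0 with h | h
  · rw [h2 x h]; simpa
  rcases lt_or_ge 1 x with h' | h'
  · rw [h1 x h']; simpa
  · exact hB x ⟨h, h'⟩

lemma exhaust {Ω K : Set (Cv n)} (hΩ : IsOpen Ω) (hb : Bornology.IsBounded Ω) (hp : Pseudoconvex Ω)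
    (hK : IsCompact K) (hKΩ : K ⊆ Ω) : ∃ (D U : Set (Cv n)) (η l : Cv n → ℝ), IsOpen D ∧ D ⊆ Ω ∧
      IsOpen U ∧ K ⊆ U ∧ U ⊆ D ∧ ContDiffOn ℝ Tt η D ∧ ContDiffOn ℝ Tt l D ∧ (∀ z ∈ U, η z = 0) ∧
      (∀ z ∈ U, l z = 0) ∧ (∀ z ∈ D, ∀ v : Cv n, 2 * (∑ j, ‖Dm (Rc η) j z‖ ^ 2) * ∑ j, ‖v j‖ ^ 2 ≤ Lf l z v) ∧
      ∀ ε > 0, ∃ χ : Cv n → ℝ, Tst D (Rc χ) ∧ (∀ z ∈ U, χ z = 1) ∧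
        ∀ z ∈ D, ∑ j, ‖Dm (Rc χ) j z‖ ^ 2 ≤ ε * ex (η z) := by
  obtain ⟨ρ, hρ, hρK, hρc, hρΩ, hρL⟩ := exh_rho hΩ hb hp hK hKΩ
  obtain ⟨q, p, p', Q, hq, hqp, hpp, hq0, hqn, hpn, hpp0, hq1⟩ := exists_q
  obtain ⟨B, hB⟩ := exists_dS
  obtain ⟨A, hA⟩ := hρc.exists_bound_of_continuousOn (f := fun z => ∑ j, ‖Dm (Rc ρ) j z‖ ^ 2)
    (Continuous.continuousOn (continuous_finsetSum _ fun j _ => (Sm.wD (phiC hρ) _ _).continuous.norm.pow 2))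
  have hA' : ∀ z, ρ z ≤ 1/2 → ∑ j, ‖Dm (Rc ρ) j z‖ ^ 2 ≤ max A 0 := fun z hz =>
    ((le_abs_self _).trans (hA z hz)).trans (le_max_left _ _)
  generalize max A 0 = A' at hA'
  have hρd : ∀ z, DifferentiableAt ℝ ρ z := fun z => hρ.contDiffAt.differentiableAt (by simp)
  have hQ0 : 0 ≤ Q := (hpn 0).1.trans (hpn 0).2
  set L := 32 * Q * max A' 0 with hL
  have hL0 : 0 ≤ L := by positivity
  set D := {z | q (ρ z) < 1} with hD
  have hqρ : ContDiff ℝ Tt fun z => 1 - q (ρ z) := contDiff_const.sub (hq.comp hρ)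
  have hDh : ∀ z ∈ D, ρ z ≤ 1/2 := fun z hz => by
    by_contra h
    push Not at h
    exact absurd (hq1 _ h.le) (not_le.2 hz)
  have hw : ∀ z ∈ D, 0 < 1 - q (ρ z) := fun z hz => sub_pos.2 hz
  have hUq : ∀ z ∈ {z | ρ z < 0}, q (ρ z) = 0 := fun z hz => hq0 _ (le_of_lt hz)
  refine ⟨D, {z | ρ z < 0}, fun z => -4 * Real.log (1 - q (ρ z)), fun z => L * ((1 - q (ρ z))⁻¹ - 1),
    isOpen_lt (hq.comp hρ).continuous continuous_const, fun z hz => hρΩ (hDh z hz),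
    isOpen_lt hρ.continuous continuous_const, hρK, fun z hz => ?_, ?_, ?_, fun z hz => ?_, fun z hz => ?_,
    fun z hz v => ?_, fun ε hε => ?_⟩
  · change q (ρ z) < 1
    rw [hUq z hz]; exact one_pos
  · exact contDiffOn_const.mul (hqρ.contDiffOn.log fun z hz => (hw z hz).ne')
  · exact contDiffOn_const.mul ((hqρ.contDiffOn.inv fun z hz => (hw z hz).ne').sub contDiffOn_const)
  · simp only [hUq z hz]; simp
  · simp only [hUq z hz]; simp
  · have hDo : IsOpen D := isOpen_lt (hq.comp hρ).continuous continuous_const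
    have h1 : ∀ j, Dm (fun x => ((-4 * Real.log (1 - q (ρ x)) : ℝ) : ℂ)) j z
        = ((4 * p (ρ z) / (1 - q (ρ z)) : ℝ) : ℂ) * Dm (Rc ρ) j z := fun j => by
      refine wD_chain (F := fun t => -4 * Real.log (1 - q t)) ?_ (hρd z)
      have := (((hqp (ρ z)).const_sub 1).log (hw z hz).ne').const_mul (-4)
      exact this.congr_deriv (by ring)
    have h2 := Lf_chain (F := fun t => L * ((1 - q t)⁻¹ - 1)) (F' := fun t => L * (p t / (1 - q t) ^ 2))
      (F'' := L * ((p' (ρ z) * (1 - q (ρ z)) ^ 2 + p (ρ z) * (2 * (1 - q (ρ z)) * p (ρ z))) / ((1 - q (ρ z)) ^ 2) ^ 2)) hρ (z := z) (by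
      filter_upwards [hDo.mem_nhds hz] with x hx
      have := (((((hqp (ρ x)).const_sub 1).fun_inv (hw x hx).ne').sub_const 1).const_mul L)
      simpa using this) (by
      have := ((hpp (ρ z)).fun_div (((hqp (ρ z)).const_sub 1).fun_pow 2) (pow_ne_zero 2 (hw z hz).ne')).const_mul L
      exact this.congr_deriv (by push_cast; ring)) v
    rw [h2]
    set w := 1 - q (ρ z) with hwd
    have hw0 : 0 < w := hw z hz
    have hp0 := hpn (ρ z)
    have hpp' := hpp0 (ρ z)
    have hv : 0 ≤ ∑ j, ‖v j‖ ^ 2 := Finset.sum_nonneg fun _ _ => by positivity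
    have h3 : 0 ≤ L * ((p' (ρ z) * w ^ 2 + p (ρ z) * (2 * w * p (ρ z))) / (w ^ 2) ^ 2) *
        ‖∑ j, Dm (Rc ρ) j z * v j‖ ^ 2 := by
      have := hp0.1; positivity
    have h4 : L * (p (ρ z) / w ^ 2) * ∑ j, ‖v j‖ ^ 2 ≤ L * (p (ρ z) / w ^ 2) * Lf ρ z v := by
      have := hp0.1
      exact mul_le_mul_of_nonneg_left (hρL z (hDh z hz) v) (by positivity)
    refine le_trans ?_ ((h4.trans (le_add_of_nonneg_right h3)))
    refine mul_le_mul_of_nonneg_right ?_ hv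
    simp only [h1, norm_mul, mul_pow, norm_real, Real.norm_eq_abs, sq_abs]
    rw [← Finset.mul_sum]
    calc 2 * ((4 * p (ρ z) / w) ^ 2 * ∑ j, ‖Dm (Rc ρ) j z‖ ^ 2)
        ≤ 2 * ((4 * p (ρ z) / w) ^ 2 * max A' 0) := by
          gcongr; exact (hA' z (hDh z hz)).trans (le_max_left _ _)
      _ = 32 * p (ρ z) * max A' 0 * (p (ρ z) / w ^ 2) := by ring
      _ ≤ _ := by
          have := hp0.1
          rw [hL]; gcongr; exact hp0.2
  · set T := (B * Q) ^ 2 * max A' 0 with hT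
    have hT0 : 0 ≤ T := by positivity
    obtain ⟨δ, hδ0, hδ1, hδ2⟩ : ∃ δ : ℝ, 0 < δ ∧ δ ≤ 1/2 ∧ T * 16 * δ ^ 2 ≤ ε := by
      refine ⟨min (1/2) (ε / (16 * T + 1)), by positivity, min_le_left _ _, ?_⟩
      set δ := min (1/2) (ε / (16 * T + 1)) with hδ
      have h0 : 0 < δ := by positivity
      have h1 : δ ≤ 1/2 := min_le_left _ _
      have h2 : δ * (16 * T + 1) ≤ ε := by
        rw [← le_div_iff₀ (by positivity)]; exact min_le_right _ _
      nlinarith [mul_nonneg hT0 h0.le]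
    have hχs : ContDiff ℝ Tt fun z => sT ((1 - q (ρ z)) / δ - 1) :=
      Real.smoothTransition.contDiff.comp ((hqρ.div_const δ).sub contDiff_const)
    have hsub : tsupport (fun z => ((sT ((1 - q (ρ z)) / δ - 1) : ℝ) : ℂ)) ⊆ {z | δ ≤ 1 - q (ρ z)} := by
      refine closure_minimal (fun z hz => ?_) (isClosed_le continuous_const hqρ.continuous)
      by_contra h
      simp only [Set.mem_ofPred_eq, not_le] at h
      refine hz ?_
      simp only
      rw [Real.smoothTransition.zero_of_nonpos, ofReal_zero]
      rw [sub_nonpos, div_le_one hδ0]; exact h.le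
    have hDD : {z | δ ≤ 1 - q (ρ z)} ⊆ D := fun z hz => by
      have : δ ≤ 1 - q (ρ z) := hz
      change q (ρ z) < 1; linarith
    refine ⟨_, ⟨phiC hχs, ?_, hsub.trans hDD⟩, fun z hz => ?_, fun z hz => ?_⟩
    · exact hρc.of_isClosed_subset (isClosed_tsupport _) fun z hz => hDh z (hDD (hsub hz))
    · simp only [hUq z hz, sub_zero]
      apply Real.smoothTransition.one_of_one_le
      have : 2 ≤ 1 / δ := by rw [le_div_iff₀ hδ0]; linarith
      linarith
    · have h1 : ∀ j, Dm (fun x => ((sT ((1 - q (ρ x)) / δ - 1) : ℝ) : ℂ)) j z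
        = ((deriv sT ((1 - q (ρ z)) / δ - 1) * (-p (ρ z) / δ) : ℝ) : ℂ) *
            Dm (Rc ρ) j z := fun j => by
        refine wD_chain (F := fun t => sT ((1 - q t) / δ - 1)) ?_ (hρd z)
        have hs : Differentiable ℝ sT := Real.smoothTransition.contDiff.differentiable (n := 1) (by simp)
        exact HasDerivAt.comp (ρ z) (hs _).hasDerivAt ((((hqp (ρ z)).const_sub 1).div_const δ).sub_const 1)
      simp only [h1, norm_mul, mul_pow, norm_real, Real.norm_eq_abs, sq_abs]
      rw [← Finset.mul_sum]
      set w := 1 - q (ρ z) with hwd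
      have hw0 : 0 < w := hw z hz
      have he : ex (-4 * Real.log w) = (w ^ 4)⁻¹ := by
        rw [show -4 * Real.log w = -(Real.log (w ^ 4)) by rw [Real.log_pow]; push_cast; ring, Real.exp_neg, Real.exp_log (by positivity)]
      rw [he]
      rcases lt_or_ge (2 * δ) w with h | h
      · rw [(hB (w / δ - 1)).2 (by rw [lt_sub_iff_add_lt, lt_div_iff₀ hδ0]; linarith)]
        simp only [zero_pow two_ne_zero, zero_mul]; positivity
      · have hp0 := hpn (ρ z)
        calc _ ≤ B ^ 2 * (-p (ρ z) / δ) ^ 2 * max A' 0 := by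
              have h2 := sq_le_sq' (by linarith [(abs_le.1 (hB (w / δ - 1)).1).1]) (abs_le.1 (hB (w / δ - 1)).1).2
              have h3 := (hA' z (hDh z hz)).trans (le_max_left _ 0)
              exact mul_le_mul (mul_le_mul_of_nonneg_right h2 (sq_nonneg _)) h3
                (Finset.sum_nonneg fun _ _ => by positivity) (by positivity)
          _ ≤ B ^ 2 * (Q / δ) ^ 2 * max A' 0 := by
              rw [neg_div, neg_sq]
              have := hp0.1; have := hp0.2
              gcongr
          _ = T * 16 * δ ^ 2 * ((2 * δ) ^ 4)⁻¹ := by rw [hT]; field_simp; ring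
          _ ≤ ε * (w ^ 4)⁻¹ := by gcongr

end P5c

section P6
variable {Ω : Set (Cv n)} {ψ : Cv n → ℝ} {g : Cv n → ℂ}

lemma dual_A (hΩ : IsOpen Ω) (hb : Bornology.IsBounded Ω) (hp : Pseudoconvex Ω) (hψ : ContDiffOn ℝ Tt ψ Ω)
    (hL : ∀ z ∈ Ω, ∀ v, 0 ≤ Lf ψ z v) (hg : Tst Ω g) {κ : ℝ} (hκ : 0 < κ)
    (hgL : ∀ z ∈ tsupport g, ∀ v : Cv n, κ * ∑ j, ‖v j‖ ^ 2 ≤ Lf ψ z v) {α : Fin n → Cv n → ℂ} (hα : ∀ j, Tst Ω (α j)) :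
    ‖∫ z, ∑ j, α j z * stC (wD I g j z) * om ψ z‖ ^ 2
      ≤ 4 / κ * (∫ z, (∑ j, ‖wD I g j z‖ ^ 2) * ex (-ψ z)) * ∫ z, ‖∑ j, dl ψ (α j) j z‖ ^ 2 * ex (-ψ z) := by
  obtain ⟨D, U, η, l, hD, hDΩ, hU, hKU, hUD, hη, hl, hηU, hlU, hLl, hχ⟩ := exhaust hΩ hb hp
    (K := (⋃ j, tsupport (α j)) ∪ tsupport g) ((isCompact_iUnion fun j => (hα j).2.1.isCompact).union hg.2.1.isCompact)
    (Set.union_subset (Set.iUnion_subset fun j => (hα j).2.2) hg.2.2)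
  have hαU : ∀ j, Tst U (α j) := fun j => ⟨(hα j).1, (hα j).2.1, fun z hz => hKU (Or.inl (Set.mem_iUnion.2 ⟨j, hz⟩))⟩
  have hgU : Tst U g := ⟨hg.1, hg.2.1, fun z hz => hKU (Or.inr hz)⟩
  have h := duality hD (φ := fun z => ψ z + l z) ((hψ.mono hDΩ).add hl) hη hU hUD hηU hαU hgU hκ (fun z hz v => by
    rw [Lf_add (hψ.contDiffAt (hΩ.mem_nhds (hDΩ hz))) (hl.contDiffAt (hD.mem_nhds hz)), add_mul]
    refine add_le_add ?_ (hLl z hz v)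
    by_cases h : z ∈ tsupport g
    · rw [Set.indicator_of_mem h]; exact hgL z h v
    · rw [Set.indicator_of_notMem h, zero_mul]; exact hL z (hDΩ hz) v) hχ
  have ev : ∀ z ∈ U, (fun z => ((ψ z + l z : ℝ) : ℂ)) =ᶠ[𝓝 z] fun z => (ψ z : ℂ) := fun z hz => by
    filter_upwards [hU.mem_nhds hz] with x hx
    rw [hlU x hx, add_zero]
  have e1 : ∀ z, ∑ j, α j z * stC (wD I g j z) * om (fun z => ψ z + l z) z
      = ∑ j, α j z * stC (wD I g j z) * om ψ z := fun z => Finset.sum_congr rfl fun j _ => by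
    by_cases hz : z ∈ U
    · simp only [om, hlU z hz, add_zero]
    · rw [(hαU j).off hz]; simp
  have e2 : ∀ z, (∑ j, ‖wD I g j z‖ ^ 2) * ex (-(ψ z + l z)) = (∑ j, ‖wD I g j z‖ ^ 2) * ex (-ψ z) := fun z => by
    by_cases hz : z ∈ U
    · rw [hlU z hz, add_zero]
    · simp [(Tst.wD hgU I _).off hz]
  have e3 : ∀ z, ‖∑ j, dl (fun z => ψ z + l z) (α j) j z‖ ^ 2 * ex (-(ψ z + l z))
      = ‖∑ j, dl ψ (α j) j z‖ ^ 2 * ex (-ψ z) := fun z => by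
    by_cases hz : z ∈ U
    · simp only [dl, wD_congr (ev z hz), hlU z hz, add_zero]
    · simp [dl, (Tst.wD (hαU _) (-I) _).off hz, (hαU _).off hz]
  simp only [e1, e2, e3] at h
  exact h

lemma dual_B (hΩ : IsOpen Ω) (hb : Bornology.IsBounded Ω) (hp : Pseudoconvex Ω) (hψ : ContDiffOn ℝ Tt ψ Ω)
    (hL : ∀ z ∈ Ω, ∀ v, 0 ≤ Lf ψ z v) (hg : Tst Ω g) {κ : ℝ} (hκ : 0 < κ)
    (hgL : ∀ z ∈ tsupport g, ∀ v : Cv n, κ * ∑ j, ‖v j‖ ^ 2 ≤ Lf ψ z v) {h : Fin n → Cv n → ℂ} (hh : ∀ j, Tst Ω (h j)) :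
    ‖∫ z, g z * ∑ j, wD I (h j) j z‖ ^ 2
      ≤ 4 / κ * (∫ z, (∑ j, ‖wD I g j z‖ ^ 2) * ex (-ψ z)) * ∫ z, ‖∑ j, wD I (h j) j z‖ ^ 2 * ex (ψ z) := by
  have hα : ∀ j, Tst Ω (fun z => ((ex (1 * ψ z) : ℝ) : ℂ) * stC (h j z)) := fun j =>
    Tst.smul hΩ (expC hψ 1) (hh j).conj
  have hA := dual_A hΩ hb hp hψ hL hg hκ hgL hα
  have e1 : ∀ z, ∑ j, ((ex (1 * ψ z) : ℝ) : ℂ) * stC (h j z) * stC (wD I g j z) * om ψ z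
      = stC (∑ j, h j z * wD I g j z) := fun z => by
    rw [map_sum]
    refine Finset.sum_congr rfl fun j _ => ?_
    have : ((ex (1 * ψ z) : ℝ) : ℂ) * om ψ z = 1 := by
      rw [om_eq, ← ofReal_mul, ← Real.exp_add]; simp
    rw [map_mul]; linear_combination stC (h j z) * stC (wD I g j z) * this
  have e2 : ∀ j z, dl ψ (fun z => ((ex (1 * ψ z) : ℝ) : ℂ) * stC (h j z)) j z
      = ((ex (ψ z) : ℝ) : ℂ) * stC (wD I (h j) j z) := fun j z => by
    by_cases hz : z ∈ Ω
    · have d0 : DifferentiableAt ℝ ψ z := (hψ.contDiffAt (hΩ.mem_nhds hz)).differentiableAt (by simp)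
      have d1 : DifferentiableAt ℝ (fun z => ((ex (1 * ψ z) : ℝ) : ℂ)) z := by
        exact ofRealCLM.differentiableAt.comp z ((d0.const_mul 1).exp)
      rw [dl, wD_mul d1 (Sm.diff (hh j).conj.1 z), wD_conj,
        wD_chain (F := fun t => ex (1 * t)) (F' := ex (ψ z)) (by
          simpa using Real.hasDerivAt_exp (ψ z)) d0]
      simp only [one_mul, map_neg, conj_I, neg_neg]; ring
    · rw [dl, (Tst.wD (hα j) (-I) j).off hz, (hα j).off hz, (Tst.wD (hh j) I j).off hz]; simp
  have e3 : ∀ z, ‖∑ j, ((ex (ψ z) : ℝ) : ℂ) * stC (wD I (h j) j z)‖ ^ 2 * ex (-ψ z)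
      = ‖∑ j, wD I (h j) j z‖ ^ 2 * ex (ψ z) := fun z => by
    rw [← Finset.mul_sum, ← map_sum, norm_mul, RCLike.norm_conj, norm_real, Real.norm_of_nonneg (Real.exp_pos _).le,
      mul_pow, Real.exp_neg]
    field_simp
  simp only [e1, e2, e3] at hA
  refine le_trans (le_of_eq ?_) hA
  rw [integral_conj, RCLike.norm_conj]
  congr 1
  have i1 : ∀ j, Integrable fun z => h j z * wD I g j z := fun j =>
    (ContDiff.mul (hh j).1 (Sm.wD hg.1 I j)).continuous.integrable_of_hasCompactSupport (hh j).2.1.mul_right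
  have i2 : ∀ j, Integrable fun z => g z * wD I (h j) j z := fun j =>
    (ContDiff.mul hg.1 (Sm.wD (hh j).1 I j)).continuous.integrable_of_hasCompactSupport hg.2.1.mul_right
  simp only [Finset.mul_sum]
  rw [integral_finsetSum _ fun j _ => i1 j, integral_finsetSum _ fun j _ => i2 j, ← norm_neg, ← Finset.sum_neg_distrib]
  congr 1
  refine Finset.sum_congr rfl fun j _ => ?_
  have := ibp (s := I) (j := j) hg.1 (hh j).1 hg.2.1
  rw [← this]
  exact integral_congr_ae (Eventually.of_forall fun z => mul_comm _ _)

end P6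

section P6b
variable {Ω : Set (Cv n)} {ψ : Cv n → ℝ} {g : Cv n → ℂ}

lemma L2_norm {F : Cv n → ℂ} (hF : MemLp F 2) : ‖hF.toLp F‖ ^ 2 = ∫ z, ‖F z‖ ^ 2 := by
  have h := L2_inner_eq hF hF
  rw [inner_self_eq_norm_sq_to_K] at h
  simp only [mul_conj', ← ofReal_pow, integral_complex_ofReal] at h
  exact ofReal_injective (by simpa using h)

theorem hormander (hΩ : IsOpen Ω) (hb : Bornology.IsBounded Ω) (hp : Pseudoconvex Ω) (hψ : ContDiffOn ℝ Tt ψ Ω)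
    (hL : ∀ z ∈ Ω, ∀ v, 0 ≤ Lf ψ z v) (hg : Tst Ω g) {κ : ℝ} (hκ : 0 < κ)
    (hgL : ∀ z ∈ tsupport g, ∀ v : Cv n, κ * ∑ j, ‖v j‖ ^ 2 ≤ Lf ψ z v) :
    ∃ f, DifferentiableOn ℂ f Ω ∧ wnorm2 Ω ψ (fun z => f z - g z)
      ≤ oR (4 / κ * ∫ z, (∑ j, ‖wD I g j z‖ ^ 2) * ex (-ψ z)) := by
  classical
  set C := 4 / κ * ∫ z, (∑ j, ‖wD I g j z‖ ^ 2) * ex (-ψ z) with hC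
  have hC0 : 0 ≤ C := mul_nonneg (by positivity) (integral_nonneg fun z => by positivity)
  let s : (Fin n → Cv n → ℂ) → Cv n → ℂ := fun h z => ∑ j, wD I (h j) j z
  let X : (Fin n → Cv n → ℂ) → Cv n → ℂ := fun h z => stC (ex (1/2 * ψ z) * s h z)
  have hX : ∀ {h}, (∀ j, Tst Ω (h j)) → MemLp (X h) 2 := fun hh =>
    (Tst.smul hΩ (expC hψ (1/2)) (Tst.sum _ fun j => Tst.wD (hh j) I j)).conj.memLp
  have ee : ∀ z, ((ex (-1/2 * ψ z) : ℝ) : ℂ) * (ex (1/2 * ψ z) : ℝ) = 1 := fun z => by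
    rw [← ofReal_mul, ← Real.exp_add]; simp; ring_nf; simp
  have ha : MemLp (fun z => (ex (-1/2 * ψ z) : ℝ) * g z) 2 := (Tst.smul hΩ (expC hψ (-1/2)) hg).memLp
  let a := ha.toLp _
  let S : Submodule ℂ (Lp ℂ 2 (volume : Measure (Cv n))) :=
    { carrier := {x | ∃ (h : Fin n → Cv n → ℂ) (hh : ∀ j, Tst Ω (h j)), x = (hX hh).toLp _}
      zero_mem' := ⟨fun _ _ => 0, fun j => ⟨contDiff_const, HasCompactSupport.zero, by simp [tsupport]⟩, by
        symm; rw [Lp.eq_zero_iff_ae_eq_zero]; filter_upwards [MemLp.coeFn_toLp (hX (h := fun _ _ => 0) fun j => ⟨contDiff_const, HasCompactSupport.zero, by simp [tsupport]⟩)] with z hz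
        rw [hz]; simp [X, s, wD_const]⟩
      add_mem' := by
        rintro _ _ ⟨h, hh, rfl⟩ ⟨h', hh', rfl⟩
        have h2 : ∀ j, Tst Ω (fun z => h j z + h' j z) := fun j =>
          ⟨(hh j).1.add (hh' j).1, (hh j).2.1.add (hh' j).2.1, (tsupport_add _ _).trans (Set.union_subset (hh j).2.2 (hh' j).2.2)⟩
        refine ⟨_, h2, ?_⟩
        rw [← MemLp.toLp_add]
        congr 1
        ext z
        simp only [X, s, Pi.add_apply, wD_add (Sm.diff (hh _).1 z) (Sm.diff (hh' _).1 z), Finset.sum_add_distrib, mul_add, map_add]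
      smul_mem' := by
        rintro c _ ⟨h, hh, rfl⟩
        refine ⟨fun j z => stC c * h j z, fun j => Tst.smul hΩ contDiffOn_const (hh j), ?_⟩
        rw [← MemLp.toLp_const_smul]
        congr 1
        ext z
        simp only [X, s, Pi.smul_apply, wD_const_mul _ (Sm.diff (hh _).1 z), ← Finset.mul_sum, map_mul, conj_conj, smul_eq_mul]
        ring }
  let K := S.topologicalClosure
  haveI : CompleteSpace K := S.isClosed_topologicalClosure.completeSpace_coe
  let w := K.starProjection a
  let x := a - w
  have hx : x ∈ Kᗮ := K.sub_starProjection_mem_orthogonal a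
  have hw : w ∈ K := Submodule.starProjection_apply_mem K a
  have hK : ∀ y ∈ K, ‖inner ℂ y a‖ ^ 2 ≤ C * ‖y‖ ^ 2 := by
    intro y hy
    have hcl : IsClosed {y : Lp ℂ 2 (volume : Measure (Cv n)) | ‖inner ℂ y a‖ ^ 2 ≤ C * ‖y‖ ^ 2} :=
      isClosed_le (by fun_prop) (by fun_prop)
    refine closure_minimal ?_ hcl hy
    rintro _ ⟨h, hh, rfl⟩
    simp only [Set.mem_ofPred_eq]
    rw [L2_inner_eq ha (hX hh), L2_norm]
    convert dual_B hΩ hb hp hψ hL hg hκ hgL hh using 4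
    · ext z; simp only [X, conj_conj]; linear_combination (g z * s h z) * ee z
    · simp only [X]; rw [RCLike.norm_conj, norm_mul, norm_real, Real.norm_of_nonneg (Real.exp_pos _).le, mul_pow,
        ← Real.exp_nat_mul, mul_comm]; congr 2; push_cast; ring
  have hwn : ‖w‖ ^ 2 ≤ C := by
    have h1 : inner ℂ w a = ((‖w‖ ^ 2 : ℝ) : ℂ) := by
      have h2 : inner ℂ w x = 0 := hx w hw
      have h3 : a = x + w := by simp [x]
      rw [h3, inner_add_right, h2, zero_add, inner_self_eq_norm_sq_to_K]; norm_cast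
    have h2 := hK w hw
    rw [h1, norm_real, Real.norm_of_nonneg (by positivity)] at h2
    by_contra h; push Not at h
    nlinarith
  obtain ⟨f, hf, hfF⟩ := weyl hΩ (F := fun z => (ex (1/2 * ψ z) : ℝ) * x z) (fun L hLΩ hLc => by
      obtain ⟨ψ', hψ', U, hU, hLU, he⟩ := extend hΩ hLc hLΩ hψ
      obtain ⟨M, hM⟩ := hLc.exists_bound_of_continuousOn (f := fun z => ((ex (1/2 * ψ z) : ℝ) : ℂ))
        ((expC hψ (1/2)).continuousOn.mono hLΩ)
      refine ((Lp.memLp x).restrict L).of_le_mul (c := M) ?_ ?_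
      · exact (((expC hψ (1/2)).continuousOn.mono hLΩ).aestronglyMeasurable hLc.measurableSet).mul
          (Lp.aestronglyMeasurable x).restrict
      · filter_upwards [ae_restrict_mem hLc.measurableSet] with z hz
        rw [norm_mul]; exact mul_le_mul_of_nonneg_right (hM z hz) (norm_nonneg _)) (fun h hh j => by
      have hh' : ∀ i, Tst Ω ((fun i => if i = j then h else fun _ => 0) i) := fun i => by
        by_cases e : i = j
        · simp only [e, if_true]; exact hh
        · simp only [e, if_false]; exact ⟨contDiff_const, HasCompactSupport.zero, by simp [tsupport]⟩
      have h1 : inner ℂ ((hX hh').toLp _) x = 0 := hx _ (S.le_topologicalClosure ⟨_, hh', rfl⟩)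
      rw [← Lp.toLp_coeFn x (Lp.memLp x), L2_inner_eq] at h1
      rw [← h1]
      refine integral_congr_ae (Eventually.of_forall fun z => ?_)
      have : s (fun i => if i = j then h else fun _ => 0) z = wD I h j z := by
        simp only [s]
        rw [Finset.sum_eq_single j (fun i _ e => by simp [e, wD_const]) (by simp)]; simp
      simp only [X, this, conj_conj]; ring)
  refine ⟨f, hf, ?_⟩
  have e1 : ∀ᵐ z, z ∈ Ω → ‖f z - g z‖ ^ 2 * ex (-ψ z) = ‖w z‖ ^ 2 := by
    filter_upwards [hfF, Lp.coeFn_sub a w, ha.coeFn_toLp] with z h1 h2 h3 hz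
    have h2' : x z = a z - w z := h2
    have h3' : a z = (ex (-1/2 * ψ z) : ℝ) * g z := h3
    have : f z - g z = -((ex (1/2 * ψ z) : ℝ) * w z) := by
      rw [h1 hz, h2', h3']; linear_combination g z * ee z
    rw [this, norm_neg, norm_mul, norm_real, Real.norm_of_nonneg (Real.exp_pos _).le, mul_pow, ← Real.exp_nat_mul,
      mul_right_comm, ← Real.exp_add]
    have : ((2:ℕ):ℝ) * (1/2 * ψ z) + -ψ z = 0 := by push_cast; ring
    rw [this]; simp
  have e2 : ‖w‖ ^ 2 = ∫ z, ‖w z‖ ^ 2 := by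
    rw [← L2_norm (Lp.memLp w), Lp.toLp_coeFn]
  calc wnorm2 Ω ψ (fun z => f z - g z) = ∫⁻ z in Ω, oR (‖w z‖ ^ 2) := by
        refine lintegral_congr_ae ?_
        rw [EventuallyEq, ae_restrict_iff' hΩ.measurableSet]
        filter_upwards [e1] with z hz hz'
        rw [hz hz']
    _ ≤ ∫⁻ z, oR (‖w z‖ ^ 2) := setLIntegral_le_lintegral _ _
    _ = oR (‖w‖ ^ 2) := by
        rw [e2, ofReal_integral_eq_lintegral_ofReal (sq_int (Lp.memLp w)) (Eventually.of_forall fun z => by positivity)]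
    _ ≤ _ := ENNReal.ofReal_le_ofReal hwn

end P6b

section P7

lemma Lf_quad (φ : Cv n → ℝ) (z v : Cv n) :
    Lf φ z v = (star v ⬝ᵥ ((cHessian φ z).transpose.mulVec v)).re := by
  rw [Lf, Finset.sum_comm]
  congr 1
  simp only [dotProduct, Matrix.mulVec, Matrix.transpose_apply, Finset.mul_sum]
  refine Finset.sum_congr rfl fun j _ => Finset.sum_congr rfl fun k _ => ?_
  simp only [Pi.star_apply, RCLike.star_def]; ring

lemma Lf_pos {φ : Cv n → ℝ} {z v : Cv n} (h : (cHessian φ z).PosDef) (hv : v ≠ 0) : 0 < Lf φ z v := by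
  rw [Lf_quad]
  exact (Complex.pos_iff.1 (h.transpose.dotProduct_mulVec_pos hv)).1

lemma gauss0 : ∫ v : Cv n, ex (-∑ j, ‖v j‖ ^ 2) = π ^ n := by
  have h := integral_fintype_prod_volume_eq_pow (ι := Fin n) (fun w : ℂ => ex (-‖w‖ ^ 2))
  have h2 := GaussianFourier.integral_rexp_neg_mul_sq_norm (V := ℂ) (b := 1) one_pos
  simp at h2
  simp only [← Real.exp_sum, Finset.sum_neg_distrib, h2] at h
  simpa using h

open scoped MatrixOrder Matrix.Norms.L2Operator in
lemma psd_fac {M : Matrix (Fin n) (Fin n) ℂ} (h : M.PosSemidef) : ∃ A : Matrix (Fin n) (Fin n) ℂ, M = A.conjTranspose * A :=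
  CStarAlgebra.nonneg_iff_eq_star_mul_self.mp h.nonneg

lemma gauss {φ : Cv n → ℝ} {z : Cv n} (h : (cHessian φ z).PosDef) :
    0 < (cHessian φ z).det.re ∧ Integrable (fun v => ex (-Lf φ z v)) ∧
      ∫ v, ex (-Lf φ z v) = π ^ n / (cHessian φ z).det.re := by
  have hd := (Complex.pos_iff.1 h.det_pos).1
  obtain ⟨A, hA⟩ := psd_fac h.transpose.posSemidef
  have hdet : (cHessian φ z).det.re = ‖A.det‖ ^ 2 := by
    rw [← Matrix.det_transpose, hA, Matrix.det_mul, Matrix.det_conjTranspose]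
    simp only [RCLike.star_def]
    rw [conj_mul', ← ofReal_pow, ofReal_re]
  have e : ∀ v, Lf φ z v = ∑ j, ‖(A.mulVec v) j‖ ^ 2 := fun v => by
    rw [Lf_quad, hA, ← Matrix.mulVec_mulVec, Matrix.dotProduct_mulVec, ← Matrix.star_mulVec]
    simp only [dotProduct, Pi.star_apply, RCLike.star_def, conj_mul', ← ofReal_pow, ← ofReal_sum, ofReal_re]
  let L : Cv n →ₗ[ℝ] (Cv n) := (Matrix.toLin' A).restrictScalars ℝ
  have hL : LinearMap.det L = ‖A.det‖ ^ 2 := by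
    simp only [L]
    rw [LinearMap.det_restrictScalars, LinearMap.det_toLin', Algebra.norm_complex_eq]; exact normSq_eq_norm_sq _
  have hI : ∫ v, ex (-Lf φ z v) = π ^ n / (cHessian φ z).det.re := by
    have hLc : Continuous L := L.continuous_of_finiteDimensional
    have hm := Measure.map_linearMap_addHaar_eq_smul_addHaar (volume : Measure (Cv n)) (f := L) (by rw [hL, ← hdet]; exact hd.ne')
    have h1 := integral_map (μ := (volume : Measure (Cv n))) hLc.aemeasurable (f := fun v => ex (-∑ j, ‖v j‖ ^ 2))
      (by exact Continuous.aestronglyMeasurable (by fun_prop))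
    rw [hm, integral_smul_measure, gauss0, hL, ← hdet] at h1
    simp only [e]
    refine Eq.trans h1.symm ?_
    rw [ENNReal.toReal_ofReal (by positivity), abs_of_pos (by positivity), smul_eq_mul]; field_simp
  refine ⟨hd, ?_, hI⟩
  by_contra hn
  rw [integral_undef hn] at hI
  exact absurd hI (by positivity)

lemma Lf_cont (φ : Cv n → ℝ) (z : Cv n) : Continuous (Lf φ z) := by
  unfold Lf; fun_prop

lemma Lf_lower {Ω K : Set (Cv n)} (hΩ : IsOpen Ω) (hK : IsCompact K) (hKΩ : K ⊆ Ω) {φ : Cv n → ℝ}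
    (hφ : SPSHOn Ω φ) : ∃ c > 0, ∀ z ∈ K, ∀ v, c * ‖v‖ ^ 2 ≤ Lf φ z v := by
  have hc : ContinuousOn (fun p : (Cv n) × (Cv n) => Lf φ p.1 p.2) (K ×ˢ Metric.sphere 0 1) := by
    intro p hp
    refine ContinuousAt.continuousWithinAt ?_
    have h1 := cHess_continuousAt (hφ.1.contDiffAt (hΩ.mem_nhds (hKΩ hp.1)))
    have h2 : ∀ j k, ContinuousAt (fun p : (Cv n) × (Cv n) => cHessian φ p.1 j k) p := fun j k =>
      ContinuousAt.comp (f := Prod.fst) (g := fun z => cHessian φ z j k) (continuousAt_pi.1 (continuousAt_pi.1 h1 j) k) continuousAt_fst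
    unfold Lf
    fun_prop
  have hcomp := hK.prod (isCompact_sphere (0 : Cv n) 1)
  obtain he | hne := (K ×ˢ Metric.sphere (0 : Cv n) 1).eq_empty_or_nonempty
  · refine ⟨1, one_pos, fun z hz v => ?_⟩
    by_cases hv : v = 0
    · subst hv; simp [Lf]
    · exfalso
      have : (z, ((‖v‖⁻¹ : ℝ) : ℂ) • v) ∈ K ×ˢ Metric.sphere (0 : Cv n) 1 := ⟨hz, by
        simp [norm_smul, norm_ne_zero_iff.2 hv]⟩
      rw [he] at this; exact this
  · obtain ⟨p, hp, hmin⟩ := hcomp.exists_isMinOn hne hc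
    refine ⟨Lf φ p.1 p.2, Lf_pos (hφ.2 _ (hKΩ hp.1)) (fun h => by have := hp.2; simp [h] at this), fun z hz v => ?_⟩
    by_cases hv : v = 0
    · subst hv; simp [Lf]
    · have hv' : 0 < ‖v‖ := norm_pos_iff.2 hv
      have h1 : Lf φ p.1 p.2 ≤ Lf φ z (((‖v‖⁻¹ : ℝ) : ℂ) • v) := hmin (a := (z, ((‖v‖⁻¹ : ℝ) : ℂ) • v)) ⟨hz, by
        simp [norm_smul, norm_ne_zero_iff.2 hv]⟩
      rw [Lf_smul, norm_real, Real.norm_of_nonneg (by positivity), inv_pow, inv_mul_eq_div, le_div_iff₀ (by positivity)] at h1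
      exact h1

end P7

section P7b

lemma scaleI {h : Cv n → ℝ} (h2 : ∀ (c : ℂ) w, h (c • w) = ‖c‖ ^ 2 * h w) {k : ℝ} (hk : 0 < k) (δ : ℝ) :
    ∫ w in cB 0 δ, ex (-(k * h w)) = (k ^ n)⁻¹ * ∫ w in cB 0 (√k * δ), ex (-h w) := by
  have hs : 0 < √k := Real.sqrt_pos.2 hk
  have := Measure.setIntegral_comp_smul_of_pos (volume : Measure (Cv n)) (fun w => ex (-h w)) (cB 0 δ) hs
  rw [smul_closedBall' hs.ne', smul_zero, Real.norm_of_nonneg hs.le] at this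
  rw [show Module.finrank ℝ (Cv n) = 2 * n by
    rw [Module.finrank_pi_fintype]; simp [mul_comm], pow_mul, Real.sq_sqrt hk.le, smul_eq_mul] at this
  rw [← this]
  congr 1
  ext w
  rw [← coe_smul, h2, norm_real, Real.norm_of_nonneg hs.le, Real.sq_sqrt hk.le]

lemma scaleI' {h : Cv n → ℝ} (h2 : ∀ (c : ℂ) w, h (c • w) = ‖c‖ ^ 2 * h w) {k : ℝ} (hk : 0 < k) :
    ∫ w, ex (-(k * h w)) = (k ^ n)⁻¹ * ∫ w, ex (-h w) := by
  have hs : 0 < √k := Real.sqrt_pos.2 hk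
  have := Measure.integral_comp_smul_of_nonneg (volume : Measure (Cv n)) (fun w => ex (-h w)) (√k) (hR := hs.le)
  rw [show Module.finrank ℝ (Cv n) = 2 * n by
    rw [Module.finrank_pi_fintype]; simp [mul_comm], pow_mul, Real.sq_sqrt hk.le, smul_eq_mul] at this
  rw [← this]
  congr 1
  ext w
  rw [← coe_smul, h2, norm_real, Real.norm_of_nonneg hs.le, Real.sq_sqrt hk.le]

lemma scaleInt {h : Cv n → ℝ} (h2 : ∀ (c : ℂ) w, h (c • w) = ‖c‖ ^ 2 * h w) {k : ℝ} (hk : 0 < k)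
    (hi : Integrable fun w => ex (-h w)) : Integrable fun w => ex (-(k * h w)) := by
  have hs : 0 < √k := Real.sqrt_pos.2 hk
  refine (hi.comp_smul hs.ne').congr (Eventually.of_forall fun w => ?_)
  simp only
  rw [← coe_smul, h2, norm_real, Real.norm_of_nonneg hs.le, Real.sq_sqrt hk.le]

lemma lemU {z : Cv n} {r δ : ℝ} (hδ : δ < r) {f : Cv n → ℂ} (hf : DifferentiableOn ℂ f (mB z r))
    {θ : Cv n → ℝ} {k : ℝ} (hk : 0 < k) {N : ℝ} (hN0 : 0 ≤ N)
    (hN : ∫⁻ x in mB z r, oR (‖f x‖ ^ 2 * ex (-(k * θ x))) ≤ oR N)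
    {Q : Cv n → ℂ} (hQ : Differentiable ℂ Q) (hQ0 : Q 0 = 0) {h : Cv n → ℝ} (hh : Continuous h)
    (h2 : ∀ (c : ℂ) w, h (c • w) = ‖c‖ ^ 2 * h w)
    (hT : ∀ w, ‖w‖ ≤ δ → θ (z + w) ≤ θ z + 2 * (Q w).re + h w) :
    (k ^ n)⁻¹ * ‖f z‖ ^ 2 * ex (-(k * θ z)) * ∫ w in cB 0 (√k * δ), ex (-h w) ≤ N := by
  set c : Cv n → ℝ := (cB (0 : Cv n) δ).indicator fun w => ex (-(k * h w)) with hc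
  have hcm : Measurable c := (by fun_prop : Continuous fun w => ex (-(k * h w))).measurable.indicator measurableSet_closedBall
  have hci : Integrable c := by
    rw [hc, integrable_indicator_iff measurableSet_closedBall]
    exact (by fun_prop : Continuous fun w => ex (-(k * h w))).continuousOn.integrableOn_compact (isCompact_closedBall _ _)
  set G : Cv n → ℂ := fun w => (f (z + w) * cexp (-(k * Q w))) ^ 2 with hG
  have hGd : DifferentiableOn ℂ G (mB 0 r) := by
    have h1 : DifferentiableOn ℂ (fun w => f (z + w)) (mB 0 r) :=
      hf.comp (by fun_prop) fun w hw => by simpa [Metric.mem_ball, dist_eq_norm] using hw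
    have h2 : Differentiable ℂ fun w => cexp (-(k * Q w)) := by fun_prop
    exact (h1.mul h2.differentiableOn).pow 2
  have hmv := mv hGd hδ hcm hci (fun w hw => by simp [hc, hw]) (fun t w => by
    have e1 : ‖cexp (t * I)‖ = 1 := norm_exp_ofReal_mul_I t
    simp only [hc, Set.indicator, Metric.mem_closedBall, dist_zero_right, norm_smul, e1, one_mul, h2, one_pow])
  have hc0 : ∀ w, 0 ≤ c w := fun w => Set.indicator_nonneg (fun _ _ => (Real.exp_pos _).le) w
  have hI : ∫ w, c w = (k ^ n)⁻¹ * ∫ w in cB 0 (√k * δ), ex (-h w) := by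
    rw [hc, integral_indicator measurableSet_closedBall, scaleI h2 hk]
  have key : ∀ w, oR (c w * ‖G w‖) ≤ (mB (0 : Cv n) r).indicator (fun w => oR (ex (k * θ z)) * oR (‖f (z + w)‖ ^ 2 * ex (-(k * θ (z + w))))) w := by
    intro w
    by_cases hw : w ∈ cB (0 : Cv n) δ
    · rw [Set.indicator_of_mem (Metric.closedBall_subset_ball hδ hw), ← ENNReal.ofReal_mul (Real.exp_pos _).le]
      refine ENNReal.ofReal_le_ofReal ?_
      have hT' := hT w (by simpa using hw)
      have e : ‖G w‖ = ‖f (z + w)‖ ^ 2 * ex (-(2 * (k * (Q w).re))) := by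
        rw [hG]; simp only [norm_pow, norm_mul, norm_exp, mul_pow, ← Real.exp_nat_mul]
        simp
      rw [e, hc, Set.indicator_of_mem hw]
      have : ex (-(k * h w)) * ex (-(2 * (k * (Q w).re))) ≤ ex (k * θ z) * ex (-(k * θ (z + w))) := by
        rw [← Real.exp_add, ← Real.exp_add, Real.exp_le_exp]
        nlinarith
      nlinarith [mul_le_mul_of_nonneg_left this (sq_nonneg ‖f (z + w)‖)]
    · simp [hc, hw]
  have hle : ‖G 0‖ * ∫ w, c w ≤ ex (k * θ z) * N := by
    have e0 : ‖G 0‖ * ∫ w, c w = ‖∫ w, c w * G w‖ := by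
      rw [hmv, norm_mul, integral_complex_ofReal, norm_real, Real.norm_of_nonneg (integral_nonneg hc0)]
    rw [e0]
    refine (norm_integral_le_lintegral_norm _).trans ?_
    refine ENNReal.toReal_le_of_le_ofReal (by positivity) ?_
    calc _ ≤ ∫⁻ w, (mB (0 : Cv n) r).indicator (fun w => oR (ex (k * θ z)) * oR (‖f (z + w)‖ ^ 2 * ex (-(k * θ (z + w))))) w := by
          refine lintegral_mono fun w => ?_
          refine le_trans (le_of_eq ?_) (key w)
          rw [norm_mul, norm_real, Real.norm_of_nonneg (hc0 w)]
      _ = ∫⁻ x, (mB z r).indicator (fun x => oR (ex (k * θ z)) * oR (‖f x‖ ^ 2 * ex (-(k * θ x)))) x := by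
          refine Eq.trans ?_ (lintegral_add_left_eq_self _ z)
          refine lintegral_congr fun w => ?_
          simp only [Set.indicator, Metric.mem_ball, dist_eq_norm, sub_zero, add_sub_cancel_left]
      _ ≤ _ := by
          rw [lintegral_indicator Metric.isOpen_ball.measurableSet, lintegral_const_mul' _ _ ENNReal.ofReal_ne_top,
            ENNReal.ofReal_mul (Real.exp_pos _).le]
          gcongr
  have eG : ‖G 0‖ = ‖f z‖ ^ 2 := by simp [hG, hQ0]
  rw [eG, hI] at hle
  have e : ex (-(k * θ z)) * ex (k * θ z) = 1 := by rw [← Real.exp_add]; simp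
  calc _ = ex (-(k * θ z)) * (‖f z‖ ^ 2 * ((k ^ n)⁻¹ * ∫ w in cB 0 (√k * δ), ex (-h w))) := by ring
    _ ≤ ex (-(k * θ z)) * (ex (k * θ z) * N) := by gcongr
    _ = N := by rw [← mul_assoc, e, one_mul]

end P7b

section P7c
variable {Ω : Set (Cv n)}

lemma posI {h : Cv n → ℝ} (hh : Continuous h) {δ : ℝ} (hδ : 0 < δ) :
    0 < ∫ w in cB 0 δ, ex (-h w) := by
  rw [setIntegral_pos_iff_support_of_nonneg_ae (Eventually.of_forall fun w => (Real.exp_pos _).le)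
    ((by fun_prop : Continuous fun w => ex (-h w)).continuousOn.integrableOn_compact (isCompact_closedBall _ _))]
  rw [show Function.support (fun w => ex (-h w)) = Set.univ from Set.eq_univ_of_forall fun w => (Real.exp_pos _).ne', Set.univ_inter]
  exact Metric.measure_closedBall_pos _ _ hδ

lemma monoI {h : Cv n → ℝ} (hh : Continuous h) {δ k : ℝ} (hδ : 0 < δ) (hk : 1 ≤ k) :
    ∫ w in cB 0 δ, ex (-h w) ≤ ∫ w in cB 0 (√k * δ), ex (-h w) := by
  refine setIntegral_mono_set ((by fun_prop : Continuous fun w => ex (-h w)).continuousOn.integrableOn_compact (isCompact_closedBall _ _))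
    (Eventually.of_forall fun w => (Real.exp_pos _).le) ?_
  refine (Metric.closedBall_subset_closedBall ?_).eventuallyLE
  have : 1 ≤ √k := by rw [Real.one_le_sqrt]; exact hk
  nlinarith

lemma dom {K : Set (Cv n)} (hΩ : IsOpen Ω) (hK : IsCompact K) (hKΩ : K ⊆ Ω) {φ u : Cv n → ℝ}
    (hφ : ContDiffOn ℝ Tt φ Ω) (hu : ContDiffOn ℝ Tt u Ω) :
    ∃ A : ℝ, 0 ≤ A ∧ ∀ z ∈ K, ∀ t ∈ Set.Icc (0:ℝ) 1, ∀ k : ℝ, 1 ≤ k → ∀ f, DifferentiableOn ℂ f Ω →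
      wnorm2 Ω (fun w => k * (φ w + t * u w)) f ≤ 1 → (k ^ n)⁻¹ * ‖f z‖ ^ 2 * ex (-(k * (φ z + t * u z))) ≤ A := by
  obtain ⟨C₁, r₁, hr₁, hC₁, h₁⟩ := taylor1 hΩ hK hKΩ hφ
  obtain ⟨C₂, r₂, hr₂, hC₂, h₂⟩ := taylor1 hΩ hK hKΩ hu
  set r := min r₁ r₂ with hr
  have hr0 : 0 < r := lt_min hr₁ hr₂
  set h : Cv n → ℝ := fun w => (C₁ + C₂) * ‖w‖ ^ 2 with hh
  have hhc : Continuous h := by fun_prop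
  have hI := posI hhc (half_pos hr0)
  refine ⟨(∫ w in cB 0 (r / 2), ex (-h w))⁻¹, by positivity, fun z hz t ht k hk f hf hN => ?_⟩
  have hsub : mB z r ⊆ Ω := fun x hx => by
    have := (h₁ z hz (x - z) ((le_of_lt (by rw [← dist_eq_norm]; exact hx : ‖x - z‖ < r)).trans (min_le_left _ _))).1
    simpa using this
  have hU := lemU (θ := fun w => φ w + t * u w) (half_lt_self hr0) (hf.mono hsub) (by linarith : 0 < k) zero_le_one
    (by rw [ENNReal.ofReal_one]; exact (lintegral_mono_set hsub).trans hN)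
    (Q := fun w => ∑ j, Dm (Rc φ) j z * w j + t * ∑ j, Dm (Rc u) j z * w j)
    (by fun_prop) (by simp) hhc (fun c w => by simp only [hh, norm_smul]; ring) (fun w hw => by
      have hw' : ‖w‖ ≤ r := hw.trans (by linarith)
      have a1 := (abs_le.1 (h₁ z hz w (hw'.trans (min_le_left _ _))).2).2
      have a2 := (abs_le.1 (h₂ z hz w (hw'.trans (min_le_right _ _))).2).2
      simp only [hh, add_re, re_ofReal_mul]
      have a3 := mul_le_mul_of_nonneg_left a2 ht.1
      have a4 : t * (C₂ * ‖w‖ ^ 2) ≤ 1 * (C₂ * ‖w‖ ^ 2) := mul_le_mul_of_nonneg_right ht.2 (by positivity)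
      nlinarith)
  refine ((le_div_iff₀ hI).2 (le_trans ?_ hU)).trans_eq (one_div _)
  have hm := monoI hhc (half_pos hr0) hk
  have hk0 : (0:ℝ) < k := by linarith
  gcongr

lemma berg_le {ψ : Cv n → ℝ} {z : Cv n} {A : ℝ}
    (h : ∀ f, DifferentiableOn ℂ f Ω → wnorm2 Ω ψ f ≤ 1 → ‖f z‖ ^ 2 ≤ A) : bergmanDiag Ω ψ z ≤ A :=
  csSup_le ⟨0, fun _ => 0, differentiableOn_const _, by simp [wnorm2], by simp⟩ (by rintro _ ⟨f, hf, hN, rfl⟩; exact h f hf hN)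

lemma berg_nonneg (ψ : Cv n → ℝ) (z : Cv n) : 0 ≤ bergmanDiag Ω ψ z :=
  Real.sSup_nonneg (by rintro _ ⟨f, _, _, rfl⟩; positivity)

lemma berg_ge {ψ : Cv n → ℝ} {z : Cv n} {A T : ℝ}
    (h : ∀ f, DifferentiableOn ℂ f Ω → wnorm2 Ω ψ f ≤ 1 → ‖f z‖ ^ 2 ≤ A) (hT : 0 < T) {f : Cv n → ℂ}
    (hf : DifferentiableOn ℂ f Ω) (hN : wnorm2 Ω ψ f ≤ oR T) : ‖f z‖ ^ 2 / T ≤ bergmanDiag Ω ψ z := by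
  refine le_csSup ⟨A, by rintro _ ⟨f, hf, hN, rfl⟩; exact h f hf hN⟩ ⟨fun x => ((√T)⁻¹ : ℝ) * f x, hf.const_mul _, ?_, ?_⟩
  · have e : ∀ x, ‖(((√T)⁻¹ : ℝ) : ℂ) * f x‖ ^ 2 = T⁻¹ * ‖f x‖ ^ 2 := fun x => by
      rw [norm_mul, norm_real, Real.norm_of_nonneg (by positivity), mul_pow, inv_pow, Real.sq_sqrt hT.le]
    unfold wnorm2 at hN ⊢
    simp only [e, mul_assoc]
    simp only [ENNReal.ofReal_mul (inv_nonneg.2 hT.le)]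
    rw [lintegral_const_mul' _ _ ENNReal.ofReal_ne_top]
    calc _ ≤ oR T⁻¹ * oR T := by gcongr
      _ = 1 := by rw [← ENNReal.ofReal_mul (by positivity), inv_mul_cancel₀ hT.ne', ENNReal.ofReal_one]
  · rw [norm_mul, norm_real, Real.norm_of_nonneg (by positivity), mul_pow, inv_pow, Real.sq_sqrt hT.le]; ring

lemma taylorH (hΩ : IsOpen Ω) {θ : Cv n → ℝ} (hθ : SPSHOn Ω θ) {z : Cv n} (hz : z ∈ Ω) {ε : ℝ} (hε : 0 < ε) :
    ∃ δ > 0, mB z δ ⊆ Ω ∧ ∀ w, ‖w‖ < δ →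
      |θ (z + w) - θ z - 2 * (P2 θ z w).re - Lf θ z w| ≤ ε * Lf θ z w := by
  obtain ⟨c, hc, hcL⟩ := Lf_lower hΩ (isCompact_singleton (x := z)) (by simpa using hz) hθ
  obtain ⟨δ₁, hδ₁, h1⟩ := Metric.isOpen_iff.1 hΩ z hz
  obtain ⟨δ₂, hδ₂, h2⟩ := Metric.eventually_nhds_iff.1 (taylor2 (hθ.1.contDiffAt (hΩ.mem_nhds hz)) (mul_pos hε hc))
  refine ⟨min δ₁ δ₂, lt_min hδ₁ hδ₂, (Metric.ball_subset_ball (min_le_left _ _)).trans h1, fun w hw => ?_⟩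
  refine (h2 (by simpa using lt_of_lt_of_le hw (min_le_right _ _))).trans ?_
  rw [mul_assoc]
  exact mul_le_mul_of_nonneg_left (hcL z rfl w) hε.le

lemma berg_upper (hΩ : IsOpen Ω) {θ : Cv n → ℝ} (hθ : SPSHOn Ω θ) {z : Cv n} (hz : z ∈ Ω) {a : ℝ}
    (ha : (π ^ n)⁻¹ * (cHessian θ z).det.re < a) :
    ∀ᶠ k : ℕ in atTop, ((k:ℝ) ^ n)⁻¹ * bergmanDiag Ω (fun w => k * θ w) z * ex (-(k * θ z)) < a := by
  obtain ⟨hd, hJi, hJ⟩ := gauss (hθ.2 z hz)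
  set d := (cHessian θ z).det.re with hdd
  obtain ⟨ε, hε, hεa⟩ : ∃ ε > 0, (1 + ε) ^ n * ((π ^ n)⁻¹ * d) < a := by
    have h1 : Tendsto (fun ε : ℝ => (1 + ε) ^ n * ((π ^ n)⁻¹ * d)) (𝓝[>] 0) (𝓝 ((1 + 0) ^ n * ((π ^ n)⁻¹ * d))) :=
      ((by fun_prop : Continuous fun ε : ℝ => (1 + ε) ^ n * ((π ^ n)⁻¹ * d)).tendsto 0).mono_left nhdsWithin_le_nhds
    obtain ⟨ε, h2, h3⟩ := ((h1.eventually_lt_const (u := a) (by simpa using ha)).and self_mem_nhdsWithin).exists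
    exact ⟨ε, h3, h2⟩
  obtain ⟨δ, hδ, hsub, hT⟩ := taylorH hΩ hθ hz hε
  set h : Cv n → ℝ := fun w => (1 + ε) * Lf θ z w with hh
  have hhc : Continuous h := continuous_const.mul (Lf_cont θ z)
  have hε1 : 0 < 1 + ε := by linarith
  have hint : Integrable fun w => ex (-h w) := scaleInt (fun c w => Lf_smul θ z w c) hε1 hJi
  have hval : ∫ w, ex (-h w) = ((1 + ε) ^ n * ((π ^ n)⁻¹ * d))⁻¹ := by
    rw [hh, scaleI' (fun c w => Lf_smul θ z w c) hε1, hJ]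
    have := Real.pi_pos
    field_simp
  have hlim : Tendsto (fun k : ℕ => (∫ w in cB 0 (√(k:ℝ) * (δ / 2)), ex (-h w))⁻¹) atTop
      (𝓝 ((1 + ε) ^ n * ((π ^ n)⁻¹ * d))) := by
    have hcov : AECover (volume : Measure (Cv n)) atTop fun k : ℕ => cB 0 (√(k:ℝ) * (δ / 2)) :=
      aecover_closedBall ((Real.tendsto_sqrt_atTop.comp tendsto_natCast_atTop_atTop).atTop_mul_const (half_pos hδ))
    have h1 := hcov.integral_tendsto_of_countably_generated hint
    rw [hval] at h1
    have h2 := h1.inv₀ (by have := Real.pi_pos; positivity)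
    rwa [inv_inv] at h2
  filter_upwards [hlim.eventually_lt_const hεa, eventually_ge_atTop 1] with k hk hk1
  have hk1' : (1:ℝ) ≤ k := by exact_mod_cast hk1
  have hk0 : (0:ℝ) < k := by linarith
  refine lt_of_le_of_lt ?_ hk
  have hI := posI hhc (half_pos hδ)
  have hI' := hI.trans_le (monoI hhc (half_pos hδ) hk1')
  set J := ∫ w in cB 0 (√(k:ℝ) * (δ / 2)), ex (-h w) with hJd
  have hB : bergmanDiag Ω (fun w => k * θ w) z ≤ (k:ℝ) ^ n * ex (k * θ z) * J⁻¹ := berg_le fun f hf hN => by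
    have hU := lemU (θ := θ) (half_lt_self hδ) (hf.mono hsub) hk0 zero_le_one
      (by rw [ENNReal.ofReal_one]; exact (lintegral_mono_set hsub).trans hN) (P2_diff θ z) (P2_zero θ z) hhc
      (fun c w => by simp only [hh, Lf_smul]; ring) (fun w hw => by
        have := (abs_le.1 (hT w (by linarith))).2
        simp only [hh]; linarith)
    rw [← hJd, Real.exp_neg] at hU
    have := Real.exp_pos (k * θ z)
    rw [← div_eq_mul_inv, le_div_iff₀ hI']
    have e : ((k:ℝ) ^ n)⁻¹ * ‖f z‖ ^ 2 * (ex (k * θ z))⁻¹ * J = (‖f z‖ ^ 2 * J) / (k ^ n * ex (k * θ z)) := by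
      field_simp
    rw [e, div_le_one (by positivity)] at hU
    exact hU
  calc _ ≤ ((k:ℝ) ^ n)⁻¹ * ((k:ℝ) ^ n * ex (k * θ z) * J⁻¹) * ex (-(k * θ z)) := by gcongr
    _ = J⁻¹ := by rw [Real.exp_neg]; field_simp

end P7c

section P7d
variable {Ω : Set (Cv n)}

lemma Lf_const_mul {f : Cv n → ℝ} {z : Cv n} (hf : ContDiffAt ℝ Tt f z) (k : ℝ) (v) :
    Lf (fun x => k * f x) z v = k * Lf f z v := by
  have h := cHess_add (φ := fun _ => 0) k contDiffAt_const hf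
  have h0 : cHessian (fun _ : Cv n => (0:ℝ)) z = 0 := by
    ext i j; simp [cHessian_apply, wD_const, show Dm (fun _ : Cv n => (0:ℂ)) = fun _ _ => 0 from by ext; simp [wD_const]]
  simp only [zero_add, h0] at h
  simp only [Lf, h, Matrix.smul_apply, smul_eq_mul, mul_assoc, ← Finset.mul_sum, re_ofReal_mul]

lemma peak (hΩ : IsOpen Ω) (hb : Bornology.IsBounded Ω) (hp : Pseudoconvex Ω) {θ : Cv n → ℝ} (hθ : SPSHOn Ω θ)
    {z : Cv n} (hz : z ∈ Ω) {ε : ℝ} (hε : 0 < ε) (hε1 : ε < 1) :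
    ∃ D c₁ : ℝ, 0 ≤ D ∧ 0 < c₁ ∧ ∀ k : ℝ, 1 ≤ k → ∃ f, DifferentiableOn ℂ f Ω ∧
      ‖f z - 1‖ ^ 2 ≤ D * (k ^ n * ex (-(c₁ * k))) ∧
      wnorm2 Ω (fun w => k * θ w) f ≤ oR (ex (-(k * θ z)) * (k ^ n)⁻¹ *
        ((1 + ε) * (((1 - ε) ^ n)⁻¹ * ∫ w, ex (-Lf θ z w)) + D * (k ^ n * ex (-(c₁ * k))))) := by
  obtain ⟨hd, hJi, hJ⟩ := gauss (hθ.2 z hz)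
  obtain ⟨δ, hδ, hsub, hT⟩ := taylorH hΩ hθ hz hε
  obtain ⟨c, hc, hcL⟩ := Lf_lower hΩ (isCompact_singleton (x := z)) (by simpa using hz) hθ
  obtain ⟨χ, h1, h2, h3, h4, U, hU, hzU, hUb, hχU⟩ := cutoff Metric.isOpen_ball (isCompact_singleton (x := z))
    (by simpa using hδ : {z} ⊆ mB z δ)
  obtain ⟨δ₁, hδ₁, hδU⟩ := Metric.isOpen_iff.1 hU z (hzU rfl)
  have hχT : Tst (mB z δ) (Rc χ) := ofReal_tst h1 h2 h3
  obtain ⟨c₀, hc₀, hcL₀⟩ := Lf_lower hΩ hχT.2.1.isCompact (hχT.2.2.trans hsub) hθ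
  have hMc : Continuous fun x => ∑ j, ‖wD I (Rc χ) j x‖ ^ 2 :=
    continuous_finsetSum _ fun j _ => ((Sm.wD hχT.1 I j).continuous.norm).pow 2
  have hMn : HasCompactSupport fun x => ∑ j, ‖wD I (Rc χ) j x‖ ^ 2 :=
    HasCompactSupport.intro hχT.2.1.isCompact fun x hx => by
      refine Finset.sum_eq_zero fun j _ => ?_
      rw [wD_eq_zero_of_notMem hx]; simp
  obtain ⟨M, hM⟩ := hMn.exists_bound_of_continuous hMc
  have hM0 : 0 ≤ M := (norm_nonneg _).trans (hM z)
  set P := P2 θ z with hP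
  set V := volume.real (mB z δ) with hV
  set c₁ := (1 - ε) * (c * δ₁ ^ 2) with hc₁
  have hc₁0 : 0 < c₁ := by have : 0 < 1 - ε := by linarith
                           positivity
  set D₀ := 4 * (n + 1) / c₀ * (M * V) with hD₀
  have hD₀0 : 0 ≤ D₀ := by positivity
  set h : Cv n → ℝ := fun w => (1 + ε) * Lf θ z w with hh
  have hhc : Continuous h := continuous_const.mul (Lf_cont θ z)
  have hI := posI hhc (half_pos hδ₁)
  set I₀ := ∫ w in cB 0 (δ₁ / 2), ex (-h w) with hI₀
  refine ⟨max (D₀ / I₀) ((1 + 1 / ε) * D₀), c₁, by positivity, hc₁0, fun k hk => ?_⟩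
  have hk0 : 0 < k := by linarith
  set e : Cv n → ℂ := fun x => cexp (k * P (x - z)) with he
  have hed : Differentiable ℂ e := by
    have := P2_diff θ z
    rw [← hP] at this
    fun_prop
  have heS : Sm e := by
    have hPs : ContDiff ℝ Tt P := by
      rw [hP]; unfold P2; fun_prop
    exact (contDiff_const.mul (hPs.comp (contDiff_id.sub contDiff_const))).cexp
  set g : Cv n → ℂ := fun x => χ x * e x with hg
  have hgT : Tst (mB z δ) g := hχT.mulS heS
  have hgD : ∀ j x, wD I g j x = wD I (Rc χ) j x * e x := fun j x => by
    rw [hg, wD_mul (Sm.diff hχT.1 x) (Sm.diff heS x), wD_of_holo (hed x)]; simp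
  have heb : ∀ x ∈ mB z δ, ‖e x‖ ^ 2 * ex (-(k * θ x))
      ≤ ex (-(k * θ z)) * ex (-(k * ((1 - ε) * Lf θ z (x - z)))) := fun x hx => by
    have hT' := (abs_le.1 (hT (x - z) (by rw [← dist_eq_norm]; exact hx))).1
    rw [add_sub_cancel] at hT'
    rw [he]
    simp only [norm_exp, re_ofReal_mul, ← Real.exp_nat_mul, ← Real.exp_add, Real.exp_le_exp]
    push_cast
    nlinarith
  have hgL : tsupport g ⊆ tsupport (Rc χ) := tsupport_mul_subset_left
  obtain ⟨f, hf, hfN⟩ := hormander hΩ hb hp (ψ := fun w => k * θ w) (contDiffOn_const.mul hθ.1) (fun x hx v => by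
      rw [Lf_const_mul (hθ.1.contDiffAt (hΩ.mem_nhds hx))]
      by_cases hv : v = 0
      · simp [hv, Lf]
      · exact mul_nonneg hk0.le (Lf_pos (hθ.2 x hx) hv).le) (hgT.mono hsub) (κ := k * (c₀ / (n + 1))) (by positivity)
    (fun x hx v => by
      rw [Lf_const_mul (hθ.1.contDiffAt (hΩ.mem_nhds (hsub (hgT.2.2 hx)))), mul_assoc]
      refine mul_le_mul_of_nonneg_left (le_trans ?_ (hcL₀ x (hgL hx) v)) hk0.le
      have : ∑ j, ‖v j‖ ^ 2 ≤ (n + 1) * ‖v‖ ^ 2 := by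
        calc ∑ j, ‖v j‖ ^ 2 ≤ ∑ _j : Fin n, ‖v‖ ^ 2 := Finset.sum_le_sum fun j _ => by
              gcongr; exact norm_le_pi_norm v j
          _ ≤ _ := by simp; nlinarith [sq_nonneg ‖v‖]
      rw [div_mul_eq_mul_div, div_le_iff₀ (by positivity)]
      nlinarith)
  have hint : ∫ x, (∑ j, ‖wD I g j x‖ ^ 2) * ex (-(k * θ x)) ≤ M * ex (-(k * θ z)) * ex (-(c₁ * k)) * V := by
    have hpt : ∀ x, (∑ j, ‖wD I g j x‖ ^ 2) * ex (-(k * θ x))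
        ≤ (mB z δ).indicator (fun _ => M * ex (-(k * θ z)) * ex (-(c₁ * k))) x := fun x => by
      simp only [hgD, norm_mul, mul_pow, ← Finset.sum_mul]
      by_cases hx : x ∈ mB z δ
      · rw [Set.indicator_of_mem hx, mul_assoc, mul_assoc]
        by_cases hxU : x ∈ U
        · have : ∀ j, wD I (Rc χ) j x = 0 := fun j => by
            rw [wD_congr (g := fun _ => 1) (by filter_upwards [hU.mem_nhds hxU] with y hy; simp [hχU y hy]), wD_const]
          simp only [this]; simp; positivity
        · refine mul_le_mul ((le_abs_self _).trans (hM x)) ((heb x hx).trans ?_) (by positivity) hM0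
          refine mul_le_mul_of_nonneg_left (Real.exp_le_exp.2 (neg_le_neg ?_)) (Real.exp_pos _).le
          have hd : δ₁ ≤ ‖x - z‖ := by
            by_contra hlt; push Not at hlt
            exact hxU (hδU (by rw [Metric.mem_ball, dist_eq_norm]; exact hlt))
          have : c * δ₁ ^ 2 ≤ Lf θ z (x - z) := le_trans (by gcongr) (hcL z rfl _)
          rw [hc₁, mul_comm]
          refine mul_le_mul_of_nonneg_left (mul_le_mul_of_nonneg_left this (by linarith)) hk0.le
      · rw [Set.indicator_of_notMem hx]
        have : ∀ j, wD I (Rc χ) j x = 0 := fun j => (Tst.wD hχT I j).off hx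
        simp [this]
    refine (integral_mono_of_nonneg (Eventually.of_forall fun x => by positivity)
      ((integrable_indicator_iff Metric.isOpen_ball.measurableSet).2 (integrableOn_const Metric.isBounded_ball.measure_lt_top.ne)) (Eventually.of_forall hpt)).trans ?_
    rw [integral_indicator Metric.isOpen_ball.measurableSet, setIntegral_const, smul_eq_mul, mul_comm]
  have hfN' : wnorm2 Ω (fun w => k * θ w) (fun x => f x - g x) ≤ oR (ex (-(k * θ z)) * (D₀ * ex (-(c₁ * k)))) := by
    refine hfN.trans (ENNReal.ofReal_le_ofReal ?_)
    calc _ ≤ 4 / (1 * (c₀ / (n + 1))) * (M * ex (-(k * θ z)) * ex (-(c₁ * k)) * V) := by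
          gcongr
      _ = _ := by rw [hD₀]; field_simp
  have hgz : ∀ x ∈ mB z δ₁, g x = e x := fun x hx => by simp [hg, hχU x (hδU hx)]
  have hez : e z = 1 := by simp [he, hP, P2_zero]
  refine ⟨f, hf, ?_, ?_⟩
  · have hb1 : mB z δ₁ ⊆ Ω := hδU.trans (hUb.trans hsub)
    have hdf : DifferentiableOn ℂ (fun x => f x - g x) (mB z δ₁) :=
      ((hf.mono hb1).sub hed.differentiableOn).congr fun x hx => by simp [hgz x hx]
    have hUU := lemU (θ := θ) (half_lt_self hδ₁) hdf hk0 (by positivity) ((lintegral_mono_set hb1).trans hfN') (P2_diff θ z) (P2_zero θ z) hhc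
      (fun c w => by simp only [hh, Lf_smul]; ring) (fun w hw => by
        have hw' : z + w ∈ mB z δ₁ := by simp; linarith
        have := (abs_le.1 (hT w (by simpa using hUb (hδU hw')))).2
        simp only [hh]; linarith)
    rw [hgz z (Metric.mem_ball_self hδ₁), hez] at hUU
    have hm := monoI hhc (half_pos hδ₁) hk
    rw [← hI₀] at hm
    have h5 : (k ^ n)⁻¹ * ‖f z - 1‖ ^ 2 * ex (-(k * θ z)) * I₀ ≤ ex (-(k * θ z)) * (D₀ * ex (-(c₁ * k))) :=
      le_trans (by gcongr) hUU
    refine le_trans ?_ (mul_le_mul_of_nonneg_right (le_max_left _ _) (by positivity))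
    have h6 : (k ^ n)⁻¹ * ‖f z - 1‖ ^ 2 * I₀ ≤ D₀ * ex (-(c₁ * k)) :=
      le_of_mul_le_mul_left (by linarith) (Real.exp_pos (-(k * θ z)))
    rw [div_mul_eq_mul_div, le_div_iff₀ hI]
    rw [mul_assoc, inv_mul_le_iff₀ (by positivity)] at h6
    linarith
  · have hgN : wnorm2 Ω (fun w => k * θ w) g ≤ oR (ex (-(k * θ z)) * (k ^ n)⁻¹ * (((1 - ε) ^ n)⁻¹ * ∫ w, ex (-Lf θ z w))) := by
      have hε' : 0 < 1 - ε := by linarith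
      have e1 : ex (-(k * θ z)) * (k ^ n)⁻¹ * (((1 - ε) ^ n)⁻¹ * ∫ w, ex (-Lf θ z w))
          = ∫ x, ex (-(k * θ z)) * ex (-(k * ((1 - ε) * Lf θ z (x - z)))) := by
        rw [integral_const_mul, integral_sub_right_eq_self (fun x => ex (-(k * ((1 - ε) * Lf θ z x)))) z,
          scaleI' (h := fun x => (1 - ε) * Lf θ z x) (fun c w => by simp only [Lf_smul]; ring) hk0, scaleI' (fun c w => Lf_smul θ z w c) hε', mul_assoc]
      have i1 : Integrable fun x => ex (-(k * θ z)) * ex (-(k * ((1 - ε) * Lf θ z (x - z)))) :=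
        ((scaleInt (h := fun x => (1 - ε) * Lf θ z x) (fun c w => by simp only [Lf_smul]; ring) hk0
          (scaleInt (fun c w => Lf_smul θ z w c) hε' hJi)).comp_sub_right z).const_mul _
      rw [e1, ofReal_integral_eq_lintegral_ofReal i1 (Eventually.of_forall fun x => by positivity)]
      refine (lintegral_mono fun x => ?_).trans (setLIntegral_le_lintegral Ω _)
      refine ENNReal.ofReal_le_ofReal ?_
      by_cases hx : x ∈ mB z δ
      · refine le_trans ?_ (heb x hx)
        refine mul_le_mul_of_nonneg_right ?_ (Real.exp_pos _).le
        rw [hg]; simp only [norm_mul, mul_pow, norm_real]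
        have : ‖χ x‖ ^ 2 ≤ 1 := by
          rw [Real.norm_of_nonneg (h4 x).1]; exact pow_le_one₀ (h4 x).1 (h4 x).2
        nlinarith [sq_nonneg ‖e x‖]
      · rw [hgT.off hx]; simp; positivity
    have hpt : ∀ x, ‖f x‖ ^ 2 ≤ (1 + ε) * ‖g x‖ ^ 2 + (1 + 1 / ε) * ‖f x - g x‖ ^ 2 := fun x => by
      have h7 : ‖f x‖ ≤ ‖g x‖ + ‖f x - g x‖ := by simpa using norm_add_le (g x) (f x - g x)
      have h8 : ‖f x‖ ^ 2 ≤ (‖g x‖ + ‖f x - g x‖) ^ 2 := by gcongr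
      have h9 : (1 + ε) * ‖g x‖ ^ 2 + (1 + 1 / ε) * ‖f x - g x‖ ^ 2 - (‖g x‖ + ‖f x - g x‖) ^ 2
          = (ε * ‖g x‖ - ‖f x - g x‖) ^ 2 / ε := by field_simp; ring
      have : 0 ≤ (ε * ‖g x‖ - ‖f x - g x‖) ^ 2 / ε := by positivity
      linarith
    have hsum : wnorm2 Ω (fun w => k * θ w) f ≤ oR (1 + ε) * wnorm2 Ω (fun w => k * θ w) g
        + oR (1 + 1 / ε) * wnorm2 Ω (fun w => k * θ w) (fun x => f x - g x) := by
      unfold wnorm2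
      rw [← lintegral_const_mul' _ _ ENNReal.ofReal_ne_top, ← lintegral_const_mul' _ _ ENNReal.ofReal_ne_top]
      have hEm : AEMeasurable (fun x => ex (-(k * θ x))) (volume.restrict Ω) :=
        (Real.continuous_exp.comp_continuousOn (continuousOn_const.mul hθ.1.continuousOn).neg).aemeasurable hΩ.measurableSet
      have hgm : AEMeasurable (fun x => oR (1 + ε) * oR (‖g x‖ ^ 2 * ex (-(k * θ x)))) (volume.restrict Ω) :=
        (((hgT.1.continuous.norm.pow 2).measurable.aemeasurable.mul hEm).ennreal_ofReal).const_mul _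
      rw [← lintegral_add_left' hgm]
      refine lintegral_mono fun x => ?_
      simp only
      rw [← ENNReal.ofReal_mul (by positivity), ← ENNReal.ofReal_mul (by positivity), ← ENNReal.ofReal_add (by positivity) (by positivity)]
      refine ENNReal.ofReal_le_ofReal ?_
      have := mul_le_mul_of_nonneg_right (hpt x) (Real.exp_pos (-(k * θ x))).le
      linarith
    refine hsum.trans ?_
    refine (add_le_add (mul_le_mul_right hgN _) (mul_le_mul_right hfN' _)).trans ?_
    have hε' : 0 < 1 - ε := by linarith
    have hJ0 : 0 ≤ ∫ w, ex (-Lf θ z w) := integral_nonneg fun w => (Real.exp_pos _).le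
    rw [← ENNReal.ofReal_mul (by positivity), ← ENNReal.ofReal_mul (by positivity), ← ENNReal.ofReal_add (by positivity) (by positivity)]
    refine ENNReal.ofReal_le_ofReal ?_
    have h10 : ex (-(k * θ z)) * (k ^ n)⁻¹ * (((1 + 1 / ε) * D₀) * (k ^ n * ex (-(c₁ * k))))
        ≤ ex (-(k * θ z)) * (k ^ n)⁻¹ * (max (D₀ / I₀) ((1 + 1 / ε) * D₀) * (k ^ n * ex (-(c₁ * k)))) := by
      gcongr; exact le_max_right _ _
    have h11 : ex (-(k * θ z)) * (k ^ n)⁻¹ * (((1 + 1 / ε) * D₀) * (k ^ n * ex (-(c₁ * k))))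
        = (1 + 1 / ε) * (ex (-(k * θ z)) * (D₀ * ex (-(c₁ * k)))) := by
      field_simp
    rw [h11] at h10
    linarith

end P7d

section P7e
variable {Ω : Set (Cv n)}

lemma berg_bdd (hΩ : IsOpen Ω) {θ : Cv n → ℝ} (hθ : ContDiffOn ℝ Tt θ Ω) {z : Cv n} (hz : z ∈ Ω)
    {k : ℝ} (hk : 1 ≤ k) : ∃ A : ℝ, ∀ f, DifferentiableOn ℂ f Ω → wnorm2 Ω (fun w => k * θ w) f ≤ 1 → ‖f z‖ ^ 2 ≤ A := by
  obtain ⟨A, hA, h⟩ := dom hΩ (isCompact_singleton (x := z)) (by simpa using hz) hθ (contDiffOn_const (c := (0:ℝ)))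
  have hk0 : 0 < k := by linarith
  refine ⟨A / ((k ^ n)⁻¹ * ex (-(k * θ z))), fun f hf hN => ?_⟩
  have := h z rfl 0 (by simp) k hk f hf (by simpa using hN)
  rw [le_div_iff₀ (by positivity)]
  simp only [mul_zero, add_zero] at this
  linarith

lemma berg_lower (hΩ : IsOpen Ω) (hb : Bornology.IsBounded Ω) (hp : Pseudoconvex Ω) {θ : Cv n → ℝ} (hθ : SPSHOn Ω θ)
    {z : Cv n} (hz : z ∈ Ω) {a : ℝ} (ha : a < (π ^ n)⁻¹ * (cHessian θ z).det.re) :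
    ∀ᶠ k : ℕ in atTop, a < ((k:ℝ) ^ n)⁻¹ * bergmanDiag Ω (fun w => k * θ w) z * ex (-(k * θ z)) := by
  obtain ⟨hd, hJi, hJ⟩ := gauss (hθ.2 z hz)
  set J := ∫ w, ex (-Lf θ z w) with hJJ
  have hJ0 : 0 < J := by rw [hJ]; positivity
  have ha' : a < 1 / J := by rw [hJ]; convert ha using 1; field_simp
  obtain ⟨ε, hε, hε1, hεa⟩ : ∃ ε > 0, ε < 1 ∧ a < (1 - ε) ^ n / ((1 + ε) * J) := by
    have h1 : Tendsto (fun ε : ℝ => (1 - ε) ^ n / ((1 + ε) * J)) (𝓝[>] 0) (𝓝 ((1 - 0) ^ n / ((1 + 0) * J))) := by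
      refine Tendsto.mono_left ?_ nhdsWithin_le_nhds
      exact Tendsto.div ((by fun_prop : Continuous fun ε : ℝ => (1 - ε) ^ n).tendsto 0)
        ((by fun_prop : Continuous fun ε : ℝ => (1 + ε) * J).tendsto 0) (by simpa using hJ0.ne')
    have h4 : ∀ᶠ ε : ℝ in 𝓝[>] 0, ε < 1 := nhdsWithin_le_nhds (eventually_lt_nhds one_pos)
    obtain ⟨ε, ⟨h2, h3⟩, h5⟩ := (((h1.eventually_const_lt (u := a) (by simpa using ha')).and self_mem_nhdsWithin).and h4).exists
    exact ⟨ε, h3, h5, h2⟩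
  obtain ⟨D, c₁, hD, hc₁, H⟩ := peak hΩ hb hp hθ hz hε hε1
  rw [← hJJ] at H
  have hε' : 0 < 1 - ε := by linarith
  set η : ℕ → ℝ := fun k => D * ((k:ℝ) ^ n * ex (-(c₁ * k))) with hη
  have hη0 : Tendsto η atTop (𝓝 0) := by
    have h1 : Tendsto (fun k : ℕ => c₁ * (k:ℝ)) atTop atTop := tendsto_natCast_atTop_atTop.const_mul_atTop hc₁
    have h2 := ((Real.tendsto_pow_mul_exp_neg_atTop_nhds_zero n).comp h1).const_mul (D * (c₁ ^ n)⁻¹)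
    rw [mul_zero] at h2
    refine h2.congr fun k => ?_
    simp only [Function.comp, hη, mul_pow]; field_simp
  have hlim : Tendsto (fun k => (1 - √(η k)) ^ 2 / ((1 + ε) * (((1 - ε) ^ n)⁻¹ * J) + η k)) atTop
      (𝓝 ((1 - √0) ^ 2 / ((1 + ε) * (((1 - ε) ^ n)⁻¹ * J) + 0))) := by
    refine Tendsto.div ((tendsto_const_nhds.sub (hη0.sqrt)).pow 2) (tendsto_const_nhds.add hη0) (by positivity)
  have hη1 : ∀ᶠ k in atTop, η k < 1 := hη0.eventually_lt_const one_pos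
  filter_upwards [hlim.eventually_const_lt (u := a) (by
    rw [Real.sqrt_zero]; refine hεa.trans_eq ?_; field_simp; ring), hη1, eventually_ge_atTop 1] with k h1 h2 hk
  have hk' : (1:ℝ) ≤ k := by exact_mod_cast hk
  have hk0 : (0:ℝ) < k := by linarith
  refine h1.trans_le ?_
  obtain ⟨f, hf, hf1, hfN⟩ := H k hk'
  obtain ⟨A, hA⟩ := berg_bdd hΩ hθ.1 hz hk'
  have hηn : 0 ≤ η k := by positivity
  change ‖f z - 1‖ ^ 2 ≤ η k at hf1
  set S := (1 + ε) * (((1 - ε) ^ n)⁻¹ * J) + η k with hS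
  have hS0 : 0 < S := by positivity
  have hB := berg_ge hA (T := ex (-(k * θ z)) * ((k:ℝ) ^ n)⁻¹ * S) (by positivity) hf hfN
  have h3 : ‖f z - 1‖ ≤ √(η k) := Real.le_sqrt_of_sq_le hf1
  have h4 : 1 - √(η k) ≤ ‖f z‖ := by
    have := norm_sub_norm_le (1:ℂ) (f z)
    rw [norm_sub_rev, norm_one] at this
    linarith
  have h5 : 0 ≤ 1 - √(η k) := by
    have := Real.sqrt_le_one.2 h2.le
    linarith
  rw [div_le_iff₀ (by positivity)] at hB
  rw [div_le_iff₀ hS0]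
  calc (1 - √(η k)) ^ 2 ≤ ‖f z‖ ^ 2 := by gcongr
    _ ≤ _ := hB
    _ = _ := by ring

lemma berg_tendsto (hΩ : IsOpen Ω) (hb : Bornology.IsBounded Ω) (hp : Pseudoconvex Ω) {θ : Cv n → ℝ} (hθ : SPSHOn Ω θ)
    {z : Cv n} (hz : z ∈ Ω) :
    Tendsto (fun k : ℕ => ((k:ℝ) ^ n)⁻¹ * bergmanDiag Ω (fun w => k * θ w) z * ex (-(k * θ z))) atTop
      (𝓝 ((π ^ n)⁻¹ * (cHessian θ z).det.re)) :=
  tendsto_order.2 ⟨fun _ h => berg_lower hΩ hb hp hθ hz h, fun _ h => berg_upper hΩ hθ hz h⟩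

lemma spsh_interp (hΩ : IsOpen Ω) {φ u : Cv n → ℝ} (hφ : SPSHOn Ω φ) (hu : ContDiff ℝ Tt u)
    (ha : SPSHOn Ω (fun z => φ z + u z)) {t : ℝ} (ht : t ∈ Set.Icc (0:ℝ) 1) : SPSHOn Ω (fun z => φ z + t * u z) := by
  refine ⟨hφ.1.add (contDiffOn_const.mul hu.contDiffOn), fun z hz => ?_⟩
  rw [cHess_interp t (hφ.1.contDiffAt (hΩ.mem_nhds hz)) hu.contDiffAt]
  rcases eq_or_lt_of_le ht.1 with h0 | h0
  · rw [← h0]; simpa using hφ.2 z hz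
  rcases eq_or_lt_of_le ht.2 with h1 | h1
  · rw [h1]; simpa using ha.2 z hz
  · refine Matrix.PosDef.add ((ha.2 z hz).smul (by exact_mod_cast h0)) ((hφ.2 z hz).smul ?_)
    have : 0 < 1 - t := by linarith
    exact_mod_cast this

lemma berg_meas (hΩ : IsOpen Ω) {θ : Cv n → ℝ} (hθ : ContDiffOn ℝ Tt θ Ω) {k : ℝ} (hk : 1 ≤ k) :
    AEMeasurable (bergmanDiag Ω (fun w => k * θ w)) (volume.restrict Ω) := by
  set F := {f : Cv n → ℂ // DifferentiableOn ℂ f Ω ∧ wnorm2 Ω (fun w => k * θ w) f ≤ 1}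
  set G : Cv n → ℝ≥0∞ := fun z => ⨆ f : F, Ω.indicator (fun z => oR (‖f.1 z‖ ^ 2)) z with hG
  have hGl : LowerSemicontinuous G := by
    refine lowerSemicontinuous_iSup fun f => ?_
    intro z a ha
    by_cases hz : z ∈ Ω
    · rw [Set.indicator_of_mem hz] at ha
      have hc : ContinuousAt (fun z => oR (‖f.1 z‖ ^ 2)) z :=
        ENNReal.continuous_ofReal.continuousAt.comp (((f.2.1.continuousOn.continuousAt (hΩ.mem_nhds hz)).norm).pow 2)
      filter_upwards [hc.eventually_const_lt ha, hΩ.mem_nhds hz] with y hy hyΩ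
      rwa [Set.indicator_of_mem hyΩ]
    · rw [Set.indicator_of_notMem hz] at ha
      exact absurd ha not_lt_zero
  refine (hGl.measurable.ennreal_toReal.aemeasurable).congr ?_
  filter_upwards [ae_restrict_mem hΩ.measurableSet] with z hz
  obtain ⟨A, hA⟩ := berg_bdd hΩ hθ hz hk
  have hne : Nonempty F := ⟨⟨fun _ => 0, differentiableOn_const _, by simp [wnorm2]⟩⟩
  simp only [hG, Set.indicator_of_mem hz]
  rw [ENNReal.toReal_iSup (fun f => ENNReal.ofReal_ne_top)]
  simp only [ENNReal.toReal_ofReal (sq_nonneg _)]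
  unfold bergmanDiag
  rw [iSup]
  congr 1
  ext t
  constructor
  · rintro ⟨f, rfl⟩; exact ⟨f.1, f.2.1, f.2.2, rfl⟩
  · rintro ⟨f, h1, h2, rfl⟩; exact ⟨⟨f, h1, h2⟩, rfl⟩

lemma berg_compare {ψ₁ ψ₂ : Cv n → ℝ} {z : Cv n} {δ A : ℝ} (h : ∀ w, ψ₂ w ≤ ψ₁ w + δ)
    (hA : ∀ f, DifferentiableOn ℂ f Ω → wnorm2 Ω ψ₁ f ≤ 1 → ‖f z‖ ^ 2 ≤ A) :
    bergmanDiag Ω ψ₂ z ≤ ex δ * bergmanDiag Ω ψ₁ z := by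
  refine berg_le fun f hf hN => ?_
  have := berg_ge hA (Real.exp_pos δ) hf (f := f) (by
    rw [show ex δ = ex δ * 1 by ring, ENNReal.ofReal_mul (Real.exp_pos _).le, ENNReal.ofReal_one]
    refine le_trans ?_ (mul_le_mul_right hN _)
    unfold wnorm2
    rw [← lintegral_const_mul' _ _ ENNReal.ofReal_ne_top]
    refine lintegral_mono fun x => ?_
    simp only
    rw [← ENNReal.ofReal_mul (Real.exp_pos _).le]
    refine ENNReal.ofReal_le_ofReal ?_
    rw [mul_left_comm, ← Real.exp_add]
    gcongr
    linarith [h x])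
  rwa [div_le_iff₀ (Real.exp_pos _), mul_comm] at this

end P7e

section P8
variable {Ω : Set (Cv n)}

lemma berg_cont (hΩ : IsOpen Ω) {φ u : Cv n → ℝ} (hφ : ContDiffOn ℝ Tt φ Ω) (hu : ContDiff ℝ Tt u)
    (huc : HasCompactSupport u) {z : Cv n} (hz : z ∈ Ω) {k : ℝ} (hk : 1 ≤ k) :
    Continuous fun t : ℝ => bergmanDiag Ω (fun w => k * (φ w + t * u w)) z := by
  obtain ⟨M, hM⟩ := huc.exists_bound_of_continuous hu.continuous
  have key : ∀ s t : ℝ, bergmanDiag Ω (fun w => k * (φ w + s * u w)) z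
      ≤ ex (k * (|s - t| * M)) * bergmanDiag Ω (fun w => k * (φ w + t * u w)) z := fun s t => by
    obtain ⟨A, hA⟩ := berg_bdd hΩ (hφ.add (contDiffOn_const (c := t) |>.mul hu.contDiffOn)) hz hk
    refine berg_compare (fun w => ?_) hA
    have h1 : (s - t) * u w ≤ |s - t| * M := (le_abs_self _).trans (by
      rw [abs_mul]; exact mul_le_mul_of_nonneg_left (hM w) (abs_nonneg _))
    nlinarith
  refine continuous_iff_continuousAt.2 fun t => ?_
  have hc : Continuous fun s : ℝ => ex (k * (|s - t| * M)) := by fun_prop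
  have hc' : Continuous fun s : ℝ => (ex (k * (|t - s| * M)))⁻¹ :=
    (by fun_prop : Continuous fun s : ℝ => ex (k * (|t - s| * M))).inv₀ fun s => (Real.exp_pos _).ne'
  refine tendsto_of_tendsto_of_tendsto_of_le_of_le
    (g := fun s => (ex (k * (|t - s| * M)))⁻¹ * bergmanDiag Ω (fun w => k * (φ w + t * u w)) z)
    (h := fun s => ex (k * (|s - t| * M)) * bergmanDiag Ω (fun w => k * (φ w + t * u w)) z) ?_ ?_ ?_ ?_
  · simpa using (hc'.tendsto t).mul_const (bergmanDiag Ω (fun w => k * (φ w + t * u w)) z)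
  · simpa using (hc.tendsto t).mul_const (bergmanDiag Ω (fun w => k * (φ w + t * u w)) z)
  · intro s
    simp only
    rw [inv_mul_le_iff₀ (Real.exp_pos _)]
    exact key t s
  · exact fun s => key s t

lemma final_limit (hΩ : IsOpen Ω) (hb : Bornology.IsBounded Ω) (hp : Pseudoconvex Ω)
    {φ u : Cv n → ℝ} (hφ : SPSHOn Ω φ) (hu : ContDiff ℝ Tt u) (huc : HasCompactSupport u)
    (hus : tsupport u ⊆ Ω) (hadm : SPSHOn Ω (fun z => φ z + u z)) :
    Tendsto
      (fun k : ℕ => ∫ t in (0:ℝ)..1, ∫ z in Ω,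
        ((k : ℝ) ^ n)⁻¹ * bergmanDiag Ω (fun w => k * (φ w + t * u w)) z * u z *
          ex (-(k * (φ z + t * u z))))
      atTop
      (𝓝 (((π : ℝ) ^ n)⁻¹ * ∫ t in (0:ℝ)..1, ∫ z in Ω,
        u z * (cHessian (fun w => φ w + t * u w) z).det.re)) := by
  obtain ⟨A, hA0, hA⟩ := dom hΩ huc.isCompact hus hφ.1 hu.contDiffOn
  set F : ℕ → ℝ → Cv n → ℝ := fun k t z => ((k : ℝ) ^ n)⁻¹ * bergmanDiag Ω (fun w => k * (φ w + t * u w)) z * u z *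
          ex (-(k * (φ z + t * u z))) with hF
  have hbound : ∀ k : ℕ, 1 ≤ k → ∀ t ∈ Set.Icc (0:ℝ) 1, ∀ z, ‖F k t z‖ ≤ A * ‖u z‖ := fun k hk t ht z => by
    have hk' : (1:ℝ) ≤ k := by exact_mod_cast hk
    have hk0 : (0:ℝ) < k := by linarith
    by_cases hz : z ∈ tsupport u
    · have h1 : bergmanDiag Ω (fun w => k * (φ w + t * u w)) z ≤ A / (((k:ℝ) ^ n)⁻¹ * ex (-(k * (φ z + t * u z)))) :=
        berg_le fun f hf hN => by
          rw [le_div_iff₀ (by positivity)]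
          linarith [hA z hz t ht k hk' f hf hN]
      rw [le_div_iff₀ (by positivity)] at h1
      have h2 := berg_nonneg (Ω := Ω) (fun w => k * (φ w + t * u w)) z
      have h3 : F k t z = (bergmanDiag Ω (fun w => k * (φ w + t * u w)) z * (((k:ℝ) ^ n)⁻¹ * ex (-(k * (φ z + t * u z))))) * u z := by
        simp only [hF]; ring
      rw [h3, norm_mul, Real.norm_of_nonneg (by positivity)]
      gcongr
    · simp [hF, image_eq_zero_of_notMem_tsupport hz]
  have hui : Integrable (fun z => A * ‖u z‖) (volume.restrict Ω) :=
    ((hu.continuous.integrable_of_hasCompactSupport huc).norm.const_mul A).integrableOn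
  have hmeas : ∀ k : ℕ, 1 ≤ k → ∀ t : ℝ, AEStronglyMeasurable (F k t) (volume.restrict Ω) := fun k hk t => by
    have hk' : (1:ℝ) ≤ k := by exact_mod_cast hk
    have hs : ContDiffOn ℝ Tt (fun w => φ w + t * u w) Ω := hφ.1.add (contDiffOn_const.mul hu.contDiffOn)
    refine AEMeasurable.aestronglyMeasurable ?_
    refine (((berg_meas hΩ hs hk').const_mul _).mul hu.continuous.measurable.aemeasurable).mul ?_
    exact (Real.continuous_exp.comp_continuousOn (continuousOn_const.mul hs.continuousOn).neg).aemeasurable hΩ.measurableSet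
  have hmain : Tendsto (fun k : ℕ => ∫ t in (0:ℝ)..1, ∫ z in Ω, F k t z) atTop
      (𝓝 (∫ t in (0:ℝ)..1, ∫ z in Ω, (π ^ n)⁻¹ * (u z * (cHessian (fun w => φ w + t * u w) z).det.re))) := by
    have h01 : ∀ t ∈ Set.uIoc (0:ℝ) 1, t ∈ Set.Icc (0:ℝ) 1 := fun t ht => by
      rw [Set.uIoc_of_le zero_le_one] at ht; exact ⟨ht.1.le, ht.2⟩
    refine intervalIntegral.tendsto_integral_filter_of_dominated_convergence (fun _ => ∫ z in Ω, A * ‖u z‖) ?_ ?_ ?_ ?_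
    · filter_upwards [eventually_ge_atTop 1] with k hk
      have hk' : (1:ℝ) ≤ k := by exact_mod_cast hk
      have hc : ContinuousOn (fun t => ∫ z in Ω, F k t z) (Set.Icc (0:ℝ) 1) := by
        refine continuousOn_of_dominated (bound := fun z => A * ‖u z‖) (fun t _ => hmeas k hk t)
          (fun t ht => Eventually.of_forall (hbound k hk t ht)) hui ?_
        filter_upwards [ae_restrict_mem hΩ.measurableSet] with z hz
        refine Continuous.continuousOn ?_
        have := berg_cont hΩ hφ.1 hu huc hz hk'
        simp only [hF]
        fun_prop
      refine (hc.mono fun t ht => h01 t ht).aestronglyMeasurable ?_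
      rw [Set.uIoc_of_le zero_le_one]; exact measurableSet_Ioc
    · filter_upwards [eventually_ge_atTop 1] with k hk
      refine Eventually.of_forall fun t ht => ?_
      exact norm_integral_le_of_norm_le hui (Eventually.of_forall (hbound k hk t (h01 t ht)))
    · exact intervalIntegrable_const
    · refine Eventually.of_forall fun t ht => ?_
      refine tendsto_integral_filter_of_dominated_convergence (fun z => A * ‖u z‖) ?_ ?_ hui ?_
      · filter_upwards [eventually_ge_atTop 1] with k hk using hmeas k hk t
      · filter_upwards [eventually_ge_atTop 1] with k hk using Eventually.of_forall (hbound k hk t (h01 t ht))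
      · filter_upwards [ae_restrict_mem hΩ.measurableSet] with z hz
        have := (berg_tendsto hΩ hb hp (spsh_interp hΩ hφ hu hadm (h01 t ht)) hz).mul_const (u z)
        refine (this.congr fun k => ?_).trans_eq ?_
        · simp only [hF]; ring
        · congr 1; ring
  simp only [integral_const_mul, intervalIntegral.integral_const_mul] at hmain
  exact hmain

end P8

theorem integrated_bergman_measure_limit_is_energy
    (Ω : Set (Fin n → ℂ)) (hΩo : IsOpen Ω) (hΩconn : IsConnected Ω)
    (hΩb : Bornology.IsBounded Ω) (hΩp : Pseudoconvex Ω)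
    (φ : (Fin n → ℂ) → ℝ) (hφ : SPSHOn Ω φ)
    (u : (Fin n → ℂ) → ℝ) (hu : ContDiff ℝ (⊤ : ℕ∞) u) (huc : HasCompactSupport u)
    (hus : tsupport u ⊆ Ω) (hadm : SPSHOn Ω (fun z => φ z + u z)) :
    Tendsto
      (fun k : ℕ => ∫ t in (0:ℝ)..1, ∫ z in Ω,
        ((k : ℝ) ^ n)⁻¹ * bergmanDiag Ω (fun w => k * (φ w + t * u w)) z * u z *
          Real.exp (-(k * (φ z + t * u z))))
      atTop
      (𝓝 (((π : ℝ) ^ n)⁻¹ * ∫ t in (0:ℝ)..1, ∫ z in Ω,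
        u z * (cHessian (fun w => φ w + t * u w) z).det.re)) ∧
    ((π : ℝ) ^ n)⁻¹ * (∫ t in (0:ℝ)..1, ∫ z in Ω,
        u z * (cHessian (fun w => φ w + t * u w) z).det.re) =
      (((π : ℝ) ^ n)⁻¹ / (n + 1)) * ∑ j ∈ Finset.range (n + 1),
        ∫ z in Ω, u z *
          (mixedDet (cHessian (fun w => φ w + u w) z) (cHessian φ z) j).re := by
  refine ⟨final_limit hΩo hΩb hΩp hφ hu huc hus hadm, ?_⟩
  rw [energy_identity hΩo hφ.1 hu huc hus]
  ring
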